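/- Let G be a plane graph that is generically rigid in the plane, and let v be a vertex of degree three in a Laman spanning subgraph of G such that G ∖ v is not generically rigid. Then there exists an edge e = ab between two neighbors a and b of v such that G' := (G ∖ v) ∪ e is generically rigid and every CPT-labelling of G' with the generalized Laman property extends to a CPT-labelling of G with the generalized Laman property (where all angles common to G and G', except possibly those at the endpoints of e, keep their labels). -/

import Mathlib

/-! ## Combinatorial plane graphs via rotation systems -/

/-- The permutation of darts of a simple graph reversing each dart. -/
def dartSymmPerm {V : Type} (G : SimpleGraph V) : Equiv.Perm G.Dart where
  toFun := SimpleGraph.Dart.symm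
  invFun := SimpleGraph.Dart.symm
  left_inv d := SimpleGraph.Dart.symm_symm d
  right_inv d := SimpleGraph.Dart.symm_symm d

/-- The setoid on `α` whose classes are the cycles (orbits) of a permutation `σ`. -/
def faceSetoid {α : Type} (σ : Equiv.Perm α) : Setoid α :=
  ⟨σ.SameCycle, ⟨fun x => Equiv.Perm.SameCycle.refl σ x,
    fun h => h.symm, fun h h' => h.trans h'⟩⟩

/-- A (topological, non-crossing) embedding of a connected graph `G` in the plane, encoded
combinatorially: a rotation system (the counterclockwise cyclic order of the darts around
each vertex), which is planar in the sense of Euler's formula (the number of orbits of the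
face permutation `rot * symm` is the number of faces), together with a distinguished
outer (unbounded) face.  A *plane graph* is a graph `G` together with such a structure. -/
structure PlaneEmb {V : Type} (G : SimpleGraph V) where
  rot : Equiv.Perm G.Dart
  rot_fst : ∀ d : G.Dart, (rot d).fst = d.fst
  rot_vertex : ∀ d d' : G.Dart, d.fst = d'.fst → ∃ n : ℕ, (rot ^ n) d = d'
  connected : G.Connected
  outer : Quotient (faceSetoid (rot * dartSymmPerm G))
  euler : Nat.card V + Nat.card (Quotient (faceSetoid (rot * dartSymmPerm G)))
      = Nat.card G.edgeSet + 2

namespace PlaneEmb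

variable {V : Type} {G : SimpleGraph V}

/-- The faces of a plane graph: orbits of the face permutation. -/
abbrev Face (E : PlaneEmb G) : Type := Quotient (faceSetoid (E.rot * dartSymmPerm G))

/-- The face having the dart `d` on its contour. -/
def dartFace (E : PlaneEmb G) (d : G.Dart) : E.Face :=
  Quotient.mk (faceSetoid (E.rot * dartSymmPerm G)) d

/-- Each dart `d` determines an *angle* of the plane graph, namely the angle at the vertex
`d.fst` between the edges of `d` and `rot d`; `E.angleFace d` is the face this angle lies in. -/
def angleFace (E : PlaneEmb G) (d : G.Dart) : E.Face :=
  Quotient.mk (faceSetoid (E.rot * dartSymmPerm G)) d.symm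

end PlaneEmb

/-- A vertex is *pointed* (w.r.t. an assignment `big` of which angles are labelled big)
if some angle at it is labelled big. -/
def PointedVx {V : Type} {G : SimpleGraph V} (big : G.Dart → Prop) (v : V) : Prop :=
  ∃ d : G.Dart, big d ∧ d.fst = v

/-- A *combinatorial pseudo-triangulation labelling* (CPT-labelling): every bounded face has
exactly three small angles, all angles of the unbounded face are big, and no vertex is
incident to more than one big angle. -/
structure IsCPTLabelling {V : Type} {G : SimpleGraph V} (E : PlaneEmb G)
    (big : G.Dart → Prop) : Prop where
  bounded_small : ∀ F : E.Face, F ≠ E.outer →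
    Nat.card {d : G.Dart | E.angleFace d = F ∧ ¬ big d} = 3
  outer_big : ∀ d : G.Dart, E.angleFace d = E.outer → big d
  one_big : ∀ d d' : G.Dart, big d → big d' → d.fst = d'.fst → d = d'

/-- The generalized Laman property of a combinatorial pseudo-triangulation: any `x` non-pointed
plus `y` pointed vertices, with `x + y ≥ 2`, induce at most `3x + 2y - 3` edges. -/
def GenLaman {V : Type} (G : SimpleGraph V) (big : G.Dart → Prop) : Prop :=
  ∀ S : Set V, 2 ≤ Nat.card S →
    (Nat.card ((G.induce S).edgeSet) : ℤ) ≤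
      3 * Nat.card {v ∈ S | ¬ PointedVx big v} + 2 * Nat.card {v ∈ S | PointedVx big v} - 3

/-! ## Rigidity -/

/-- Dot product in the plane. -/
def dot2 (u w : ℝ × ℝ) : ℝ := u.1 * w.1 + u.2 * w.2

/-- Rotation by 90 degrees. -/
def rot90 (u : ℝ × ℝ) : ℝ × ℝ := (-u.2, u.1)

/-- `q` is an infinitesimal motion of the bar-and-joint framework `(G, p)`. -/
def IsInfMotion {V : Type} (G : SimpleGraph V) (p q : V → ℝ × ℝ) : Prop :=
  ∀ u v : V, G.Adj u v → dot2 (p u - p v) (q u - q v) = 0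

/-- Trivial infinitesimal motions: those coming from rigid motions of the plane
(infinitesimal rotations and translations). -/
def IsTrivialMotion {V : Type} (p q : V → ℝ × ℝ) : Prop :=
  ∃ (a : ℝ) (t : ℝ × ℝ), ∀ v : V, q v = a • rot90 (p v) + t

/-- The framework `(G, p)` is infinitesimally rigid: it has no non-trivial infinitesimal
motions. -/
def InfRigid {V : Type} (G : SimpleGraph V) (p : V → ℝ × ℝ) : Prop :=
  ∀ q : V → ℝ × ℝ, IsInfMotion G p q → IsTrivialMotion p q

/-- A configuration of points is *generic* if its coordinates are algebraically
independent over `ℚ`. -/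
def GenericConf {V : Type} (p : V → ℝ × ℝ) : Prop :=
  AlgebraicIndependent ℚ (fun x : V ⊕ V => Sum.elim (fun v => (p v).1) (fun v => (p v).2) x)

/-- A graph is *generically rigid in the plane* if every generic framework on it has no
non-trivial infinitesimal motions. -/
def GenRigid {V : Type} (G : SimpleGraph V) : Prop :=
  ∀ p : V → ℝ × ℝ, GenericConf p → InfRigid G p

/-- A graph is *isostatic* (generically minimally rigid) if it is generically rigid and
removing any edge destroys generic rigidity. -/
def Isostatic {V : Type} (G : SimpleGraph V) : Prop :=
  GenRigid G ∧ ∀ e ∈ G.edgeSet, ¬ GenRigid (G.deleteEdges {e})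

/-- Laman's condition: exactly `2n - 3` edges, and every `k ≥ 2` vertices span at most
`2k - 3` edges. -/
def LamanGraph {V : Type} (L : SimpleGraph V) : Prop :=
  (Nat.card L.edgeSet : ℤ) = 2 * Nat.card V - 3 ∧
  ∀ S : Set V, 2 ≤ Nat.card S →
    (Nat.card ((L.induce S).edgeSet) : ℤ) ≤ 2 * Nat.card S - 3

/-! ## Geometry: straight-line drawings, angles, stretching -/

/-- The counterclockwise angle from the direction `u` to the direction `w`,
normalized to lie in `(0, 2π]` (a full turn for `w` pointing in the direction of `u`). -/
noncomputable def ccwAngle (u w : ℝ × ℝ) : ℝ :=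
  if 0 < Complex.arg ((⟨w.1, w.2⟩ : ℂ) / (⟨u.1, u.2⟩ : ℂ)) then
    Complex.arg ((⟨w.1, w.2⟩ : ℂ) / (⟨u.1, u.2⟩ : ℂ))
  else Complex.arg ((⟨w.1, w.2⟩ : ℂ) / (⟨u.1, u.2⟩ : ℂ)) + 2 * Real.pi

/-- The (counterclockwise) geometric angle, in the straight-line drawing `p`, of the angle of
the dart `d`, i.e. the angle at `d.fst` between the edge of `d` and the edge of `rot d`. -/
noncomputable def dartAngle {V : Type} {G : SimpleGraph V} (E : PlaneEmb G)
    (p : V → ℝ × ℝ) (d : G.Dart) : ℝ :=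
  ccwAngle (p d.snd - p d.fst) (p (E.rot d).snd - p (E.rot d).fst)

/-- A straight-line drawing is non-crossing: distinct edges meet only in common endpoints,
and no vertex lies on an edge not incident to it. -/
def NonCrossing {V : Type} (G : SimpleGraph V) (p : V → ℝ × ℝ) : Prop :=
  (∀ a b c d : V, G.Adj a b → G.Adj c d → ({a, b} : Set V) ≠ {c, d} →
    segment ℝ (p a) (p b) ∩ segment ℝ (p c) (p d) ⊆ p '' ({a, b} ∩ {c, d} : Set V)) ∧
  (∀ x a b : V, G.Adj a b → x ≠ a → x ≠ b → p x ∉ segment ℝ (p a) (p b))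

/-- The points of the drawing are in general position: no three of them are collinear. -/
def GenPos {V : Type} (p : V → ℝ × ℝ) : Prop :=
  ∀ u v w : V, u ≠ v → u ≠ w → v ≠ w → ¬ Collinear ℝ ({p u, p v, p w} : Set (ℝ × ℝ))

/-- The straight-line drawing `p` realizes the plane graph `(G, E)`: it is injective and
non-crossing, and around every (non-isolated) vertex the counterclockwise angles between
rotation-consecutive darts sum to `2π`, so the drawing induces the given rotation system. -/
def RealizesEmb {V : Type} [Fintype V] [DecidableEq V] (G : SimpleGraph V)
    [DecidableRel G.Adj] (E : PlaneEmb G) (p : V → ℝ × ℝ) : Prop :=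
  Function.Injective p ∧ NonCrossing G p ∧
  ∀ v : V, (∃ d : G.Dart, d.fst = v) →
    ∑ d ∈ Finset.univ.filter (fun d : G.Dart => d.fst = v), dartAngle E p d = 2 * Real.pi

/-- The drawing `p` *stretches* the angle labelling `big` of the plane graph `(G, E)`:
it realizes the embedding, has its (finitely many) vertices in general position, and every
angle labelled big is reflex (> 180°) while every angle labelled small is convex (< 180°).
If `big` is a CPT-labelling this makes `p` a pseudo-triangulation of its vertex set:
every bounded face is a pseudo-triangle and the convex hull edges are present. -/
def Stretches {V : Type} [Fintype V] [DecidableEq V] (G : SimpleGraph V)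
    [DecidableRel G.Adj] (E : PlaneEmb G) (big : G.Dart → Prop) (p : V → ℝ × ℝ) : Prop :=
  RealizesEmb G E p ∧ GenPos p ∧
  ∀ d : G.Dart, (big d → Real.pi < dartAngle E p d) ∧ (¬ big d → dartAngle E p d < Real.pi)

/-- The drawing `p` makes the plane graph `(G, E)` a pseudo-triangulation of its vertex set
(with the given embedding): for the labelling of the angles of the drawing as big (reflex)
or small (convex), every bounded face has exactly three small angles (is a pseudo-triangle)
and all outer angles are big (so the convex hull edges are present). -/
def StretchesToPT {V : Type} [Fintype V] [DecidableEq V] (G : SimpleGraph V)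
    [DecidableRel G.Adj] (E : PlaneEmb G) (p : V → ℝ × ℝ) : Prop :=
  ∃ big : G.Dart → Prop, IsCPTLabelling E big ∧ Stretches G E big p

/-- A vertex `v` of a geometric straight-line drawing is *pointed* if all the edges at `v`
lie in a closed half-plane supported at `v`. -/
def GeoPointed {V : Type} (G : SimpleGraph V) (p : V → ℝ × ℝ) (v : V) : Prop :=
  ∃ u : ℝ × ℝ, u ≠ 0 ∧ ∀ w : V, G.Adj v w → 0 ≤ dot2 u (p w - p v)

/-! ## Subgraphs, outer face, corners -/

/-- One step of dual connectivity avoiding the edge set `A`: the faces `F`, `F'` are the two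
sides of some edge of `G` not belonging to `A`. -/
def FaceStep {V : Type} {G : SimpleGraph V} (E : PlaneEmb G) (A : Set (Sym2 V)) :
    E.Face → E.Face → Prop :=
  fun F F' => ∃ d : G.Dart, E.dartFace d = F ∧ E.dartFace d.symm = F' ∧ d.edge ∉ A

/-- The face `F` of `G` is contained in the outer (unbounded) face of the plane subgraph of
`G` with edge set `A`: `F` can reach the outer face of `G` in the dual graph without
crossing the edges of `A`. -/
def InOuterOf {V : Type} {G : SimpleGraph V} (E : PlaneEmb G) (A : Set (Sym2 V))
    (F : E.Face) : Prop :=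
  Relation.ReflTransGen (FaceStep E A) F E.outer

/-- `v` is a *corner* of the subgraph `H` of the combinatorial pseudo-triangulation
`(G, E, big)`: either `v` is pointed in `G` and its big angle is contained in the
outer face of `H`, or `v` is non-pointed in `G` and two consecutive (small) angles at `v`
are contained in the outer face of `H`. -/
def IsCPTCorner {V : Type} {G : SimpleGraph V} (E : PlaneEmb G) (big : G.Dart → Prop)
    (H : G.Subgraph) (v : V) : Prop :=
  (v ∈ H.verts ∧ ∃ d : G.Dart, big d ∧ d.fst = v ∧ InOuterOf E H.edgeSet (E.angleFace d)) ∨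
  (v ∈ H.verts ∧ ¬ PointedVx big v ∧ ∃ d : G.Dart, d.fst = v ∧
    InOuterOf E H.edgeSet (E.angleFace d) ∧ InOuterOf E H.edgeSet (E.angleFace (E.rot d)) ∧
    (E.rot d).edge ∉ H.edgeSet)

/-- A plane graph has *non-degenerate faces* if no edge appears twice on the contour cycle of
a face, i.e. the edges incident to every face form a simple closed cycle. -/
def NonDegenerateFaces {V : Type} {G : SimpleGraph V} (E : PlaneEmb G) : Prop :=
  ∀ d : G.Dart, ¬ (E.rot * dartSymmPerm G).SameCycle d d.symm


/-- Correspondence between darts of `G'' = (G ∖ v) ∪ ab` (a graph on the vertex set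
`V ∖ {v}`) and darts of `G`: darts of surviving edges correspond via their endpoints, while
the darts of the newly inserted edge `ab` correspond to the darts `a → v` and `b → v` of
`G` (in the induced embedding the edge `ab` takes up the rotation slots of the deleted
edges `av` and `bv`). -/
def AddCorr {V : Type} (G : SimpleGraph V) (v : V) (a b : ↥({v}ᶜ : Set V))
    (G'' : SimpleGraph ↥({v}ᶜ : Set V)) (d'' : G''.Dart) (d : G.Dart) : Prop :=
  d.toProd = ((d''.fst : V), (d''.snd : V)) ∨
  (d''.fst = a ∧ d''.snd = b ∧ d.toProd = ((a : V), v)) ∨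
  (d''.fst = b ∧ d''.snd = a ∧ d.toProd = ((b : V), v))

/-- `E''` is the plane embedding of `G'' = (G ∖ v) ∪ ab` induced by the plane embedding `E`
of `G`: the rotation of `E''` is obtained from the rotation of `E` by skipping at each
vertex the darts going to the deleted vertex `v` (with the new edge `ab` inserted in the
slots of the deleted edges `av`, `bv`), and the outer faces correspond. -/
def IsInducedPlaneEmbAdd {V : Type} (G : SimpleGraph V) (v : V) (a b : ↥({v}ᶜ : Set V))
    (G'' : SimpleGraph ↥({v}ᶜ : Set V)) (E : PlaneEmb G) (E'' : PlaneEmb G'') : Prop :=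
  (∀ (d'' : G''.Dart) (d : G.Dart), AddCorr G v a b G'' d'' d →
    ∃ (e : G.Dart) (k : ℕ), AddCorr G v a b G'' (E''.rot d'') e ∧ 0 < k ∧
      (E.rot ^ k) d = e ∧ ∀ j : ℕ, 0 < j → j < k → ((E.rot ^ j) d).snd = v) ∧
  (∃ (d'' : G''.Dart) (d : G.Dart), AddCorr G v a b G'' d'' d ∧
    E''.dartFace d'' = E''.outer ∧ E.dartFace d = E.outer)

/-- The labelling `big` of the angles of `G` extends the labelling `big''` of the angles of
`G'' = (G ∖ v) ∪ ab`: every angle common to `G` and `G''`, except possibly the angles at the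
endpoints `a`, `b` of the inserted edge, keeps its label. -/
def ExtendsAddLabel {V : Type} (G : SimpleGraph V) (v : V) (a b : ↥({v}ᶜ : Set V))
    (G'' : SimpleGraph ↥({v}ᶜ : Set V)) (E : PlaneEmb G) (E'' : PlaneEmb G'')
    (big : G.Dart → Prop) (big'' : G''.Dart → Prop) : Prop :=
  ∀ (d'' : G''.Dart) (d : G.Dart), AddCorr G v a b G'' d'' d →
    AddCorr G v a b G'' (E''.rot d'') (E.rot d) →
    d''.fst ≠ a → d''.fst ≠ b → (big d ↔ big'' d'')


set_option linter.unusedSectionVars false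
set_option linter.unusedVariables false
set_option linter.style.longLine false

open Classical in
def ES {V : Type} (G : SimpleGraph V) (S : Finset V) : Set (Sym2 V) :=
  {e ∈ G.edgeSet | ∀ x ∈ e, x ∈ S}

noncomputable def ec {V : Type} (G : SimpleGraph V) (S : Finset V) : ℕ := (ES G S).ncard

noncomputable def slk {V : Type} (G : SimpleGraph V) (w : V → ℤ) (S : Finset V) : ℤ :=
  (∑ x ∈ S, w x) - 3 - (ec G S : ℤ)

section count
variable {V : Type} [Fintype V] [DecidableEq V]

lemma mem_ES {G : SimpleGraph V} {S : Finset V} {x y : V} :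
    s(x, y) ∈ ES G S ↔ G.Adj x y ∧ x ∈ S ∧ y ∈ S := by
  simp [ES]

lemma ES_mono {G G' : SimpleGraph V} {S T : Finset V} (h : G ≤ G') (hs : S ⊆ T) : ES G S ⊆ ES G' T := by
  rintro ⟨x, y⟩ he
  rw [mem_ES] at *
  exact ⟨h he.1, hs he.2.1, hs he.2.2⟩

lemma ec_mono {G G' : SimpleGraph V} {S T : Finset V} (h : G ≤ G') (hs : S ⊆ T) : ec G S ≤ ec G' T :=
  Set.ncard_le_ncard (ES_mono h hs) (Set.toFinite _)

lemma ec_card_induce (G : SimpleGraph V) (S : Finset V) :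
    Nat.card (G.induce (S : Set V)).edgeSet = ec G S := by
  unfold ec
  have : ES G S = Sym2.map Subtype.val '' (G.induce (S : Set V)).edgeSet := by
    ext ⟨x, y⟩
    rw [mem_ES]
    constructor
    · rintro ⟨h, hx, hy⟩
      exact ⟨s(⟨x, hx⟩, ⟨y, hy⟩), by simpa using h, rfl⟩
    · rintro ⟨⟨x', y'⟩, h, h'⟩
      have h1 : G.Adj x' y' := h
      have h2 : s((x' : V), (y' : V)) = s(x, y) := h'
      rw [Sym2.eq_iff] at h2
      rcases h2 with ⟨rfl, rfl⟩ | ⟨rfl, rfl⟩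
      · exact ⟨h1, x'.2, y'.2⟩
      · exact ⟨h1.symm, y'.2, x'.2⟩
  rw [this, Set.ncard_image_of_injective _ (Sym2.map.injective Subtype.val_injective)]
  rfl

lemma ec_univ (G : SimpleGraph V) : ec G Finset.univ = Nat.card G.edgeSet := by
  unfold ec ES
  simp [Set.ncard]

lemma ec_union_inter (G : SimpleGraph V) (A B : Finset V) :
    ec G A + ec G B ≤ ec G (A ∪ B) + ec G (A ∩ B) := by
  unfold ec
  have h1 : ES G (A ∩ B) = ES G A ∩ ES G B := by
    ext ⟨x, y⟩
    simp only [Set.mem_inter_iff, mem_ES, Finset.mem_inter]; tauto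
  rw [← Set.ncard_union_add_ncard_inter _ _ (Set.toFinite _) (Set.toFinite _), h1]
  gcongr
  · exact Set.toFinite _
  · exact Set.union_subset (ES_mono le_rfl Finset.subset_union_left) (ES_mono le_rfl Finset.subset_union_right)

lemma ec_union_inter_strict (G : SimpleGraph V) (A B : Finset V) {x y : V} (h : G.Adj x y)
    (hx : x ∈ A) (hxB : x ∉ B) (hy : y ∈ B) (hyA : y ∉ A) :
    ec G A + ec G B + 1 ≤ ec G (A ∪ B) + ec G (A ∩ B) := by
  unfold ec
  have h1 : ES G (A ∩ B) = ES G A ∩ ES G B := by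
    ext ⟨x, y⟩
    simp only [Set.mem_inter_iff, mem_ES, Finset.mem_inter]; tauto
  rw [← Set.ncard_union_add_ncard_inter _ _ (Set.toFinite _) (Set.toFinite _), h1]
  have : (ES G A ∪ ES G B).ncard < (ES G (A ∪ B)).ncard := by
    apply Set.ncard_lt_ncard _ (Set.toFinite _)
    refine ⟨Set.union_subset (ES_mono le_rfl Finset.subset_union_left) (ES_mono le_rfl Finset.subset_union_right), fun hh => ?_⟩
    have : s(x, y) ∈ ES G A ∪ ES G B := hh (by rw [mem_ES]; simp [h, hx, hy])
    simp only [Set.mem_union, mem_ES] at this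
    tauto
  omega

lemma ec_union_inter_eq (G : SimpleGraph V) (A B : Finset V)
    (hno : ∀ x y, G.Adj x y → x ∈ A → x ∉ B → y ∈ B → y ∈ A) :
    ec G A + ec G B = ec G (A ∪ B) + ec G (A ∩ B) := by
  unfold ec
  have h1 : ES G (A ∩ B) = ES G A ∩ ES G B := by
    ext ⟨x, y⟩
    simp only [Set.mem_inter_iff, mem_ES, Finset.mem_inter]; tauto
  have h2 : ES G (A ∪ B) = ES G A ∪ ES G B := by
    ext ⟨x, y⟩
    have := hno x y
    have h3 := hno y x
    simp only [Set.mem_union, mem_ES, Finset.mem_union]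
    have := G.adj_comm x y
    tauto
  rw [← Set.ncard_union_add_ncard_inter _ _ (Set.toFinite _) (Set.toFinite _), h1, h2]

lemma slk_union_inter (G : SimpleGraph V) (w : V → ℤ) (A B : Finset V) :
    slk G w (A ∪ B) + slk G w (A ∩ B) ≤ slk G w A + slk G w B := by
  unfold slk
  have := ec_union_inter G A B
  have := Finset.sum_union_inter (s₁ := A) (s₂ := B) (f := w)
  zify at *; linarith

lemma slk_union_inter_strict (G : SimpleGraph V) (w : V → ℤ) (A B : Finset V) {x y : V} (h : G.Adj x y)
    (hx : x ∈ A) (hxB : x ∉ B) (hy : y ∈ B) (hyA : y ∉ A) :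
    slk G w (A ∪ B) + slk G w (A ∩ B) + 1 ≤ slk G w A + slk G w B := by
  unfold slk
  have := ec_union_inter_strict G A B h hx hxB hy hyA
  have := Finset.sum_union_inter (s₁ := A) (s₂ := B) (f := w)
  zify at *; linarith

lemma slk_union_inter_eq (G : SimpleGraph V) (w : V → ℤ) (A B : Finset V)
    (hno : ∀ x y, G.Adj x y → x ∈ A → x ∉ B → y ∈ B → y ∈ A) :
    slk G w (A ∪ B) + slk G w (A ∩ B) = slk G w A + slk G w B := by
  unfold slk
  have := ec_union_inter_eq G A B hno
  have := Finset.sum_union_inter (s₁ := A) (s₂ := B) (f := w)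
  zify at *; linarith

lemma ec_singleton (G : SimpleGraph V) (x : V) : ec G {x} = 0 := by
  unfold ec
  rw [Set.ncard_eq_zero]
  ext ⟨y, z⟩
  rw [mem_ES]
  simp only [Finset.mem_singleton, Set.mem_empty_iff_false, iff_false]
  rintro ⟨h, rfl, rfl⟩
  exact G.irrefl h

lemma ec_empty (G : SimpleGraph V) : ec G ∅ = 0 := by
  have := ec_mono (G := G) le_rfl (Finset.empty_subset Finset.univ)
  unfold ec
  rw [Set.ncard_eq_zero]
  ext ⟨y, z⟩
  rw [mem_ES]
  simp

lemma ec_pair (G : SimpleGraph V) {x y : V} (h : G.Adj x y) : ec G {x, y} = 1 := by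
  unfold ec
  rw [Set.ncard_eq_one]
  refine ⟨s(x, y), ?_⟩
  ext ⟨u, z⟩
  rw [mem_ES]
  simp only [Finset.mem_insert, Finset.mem_singleton, Set.mem_singleton_iff]
  constructor
  · rintro ⟨h1, rfl | rfl, rfl | rfl⟩
    · exact absurd h1 (G.irrefl)
    · rfl
    · exact Sym2.eq_swap
    · exact absurd h1 (G.irrefl)
  · intro h1
    rcases Sym2.eq_iff.1 h1 with ⟨rfl, rfl⟩ | ⟨rfl, rfl⟩
    · simp [h]
    · simp [h.symm]

def Spr (G : SimpleGraph V) (w : V → ℤ) : Prop := ∀ S : Finset V, 2 ≤ S.card → 0 ≤ slk G w S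

lemma laman_iff (L : SimpleGraph V) : LamanGraph L ↔ slk L (fun _ => 2) Finset.univ = 0 ∧ Spr L (fun _ => 2) := by
  unfold LamanGraph Spr slk
  rw [ec_univ]
  simp only [Finset.sum_const, Finset.card_univ, Nat.card_eq_fintype_card (α := V), nsmul_eq_mul]
  constructor
  · rintro ⟨h1, h2⟩
    refine ⟨by linarith, fun S hS => ?_⟩
    have := h2 S (by simpa using hS)
    rw [ec_card_induce] at this
    simp at this
    linarith
  · rintro ⟨h1, h2⟩
    refine ⟨by linarith, fun S hS => ?_⟩
    classical
    have h3 := h2 S.toFinset (by rw [Nat.card_eq_card_toFinset] at hS; exact hS)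
    have h4 := ec_card_induce L S.toFinset
    rw [Set.coe_toFinset] at h4
    rw [h4, Nat.card_eq_card_toFinset]
    linarith

open Classical in
noncomputable def wt {G : SimpleGraph V} (big : G.Dart → Prop) (x : V) : ℤ := if PointedVx big x then 2 else 3

lemma genLaman_iff (G : SimpleGraph V) (big : G.Dart → Prop) : GenLaman G big ↔ Spr G (wt big) := by
  classical
  have key : ∀ S : Finset V, (∑ x ∈ S, wt big x) =
      3 * (Nat.card {v ∈ (S : Set V) | ¬ PointedVx big v} : ℤ) + 2 * Nat.card {v ∈ (S : Set V) | PointedVx big v} := by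
    intro S
    have e1 : Nat.card {v ∈ (S : Set V) | ¬ PointedVx big v} = (S.filter (fun v => ¬ PointedVx big v)).card := by
      rw [Nat.card_eq_card_toFinset]; congr 1; ext; simp
    have e2 : Nat.card {v ∈ (S : Set V) | PointedVx big v} = (S.filter (fun v => PointedVx big v)).card := by
      rw [Nat.card_eq_card_toFinset]; congr 1; ext; simp
    rw [e1, e2]
    unfold wt
    rw [Finset.sum_ite]
    simp; ring
  unfold GenLaman Spr slk
  constructor
  · intro h S hS
    have := h S (by simpa using hS)
    rw [ec_card_induce, ← key] at this
    linarith
  · intro h S hS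
    have h3 := h S.toFinset (by rw [Nat.card_eq_card_toFinset] at hS; exact hS)
    have h4 := ec_card_induce G S.toFinset
    have h5 := key S.toFinset
    rw [Set.coe_toFinset] at h4 h5
    rw [h4, ← h5]
    linarith

end count

section rigid
variable {V : Type} [Fintype V] [DecidableEq V]

def MotOn (G : SimpleGraph V) (S : Finset V) (p q : V → ℝ × ℝ) : Prop :=
  ∀ u v : V, u ∈ S → v ∈ S → G.Adj u v → dot2 (p u - p v) (q u - q v) = 0

def TrivOn (S : Finset V) (p q : V → ℝ × ℝ) : Prop :=
  ∃ (a : ℝ) (t : ℝ × ℝ), ∀ v ∈ S, q v = a • rot90 (p v) + t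

def RigOn (G : SimpleGraph V) (S : Finset V) (p : V → ℝ × ℝ) : Prop :=
  ∀ q, MotOn G S p q → TrivOn S p q

lemma rigOn_univ (G : SimpleGraph V) (p : V → ℝ × ℝ) : RigOn G Finset.univ p ↔ InfRigid G p := by
  simp [RigOn, InfRigid, MotOn, TrivOn, IsInfMotion, IsTrivialMotion]

def rmat (G : SimpleGraph V) [DecidableRel G.Adj] (S : Finset V) (u w : V) {R : Type} [CommRing R] (X : V ⊕ V → R) :
    Matrix ((V × V) ⊕ (V ⊕ V) ⊕ Unit) (V ⊕ V) R :=
  fun r c => match r with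
  | Sum.inl (x, y) => if G.Adj x y ∧ x ∈ S ∧ y ∈ S then (match c with
      | Sum.inl z => (X (Sum.inl x) - X (Sum.inl y)) * ((if z = x then 1 else 0) - (if z = y then 1 else 0))
      | Sum.inr z => (X (Sum.inr x) - X (Sum.inr y)) * ((if z = x then 1 else 0) - (if z = y then 1 else 0))) else 0
  | Sum.inr (Sum.inl s) => if (Sum.elim id id s = u ∨ Sum.elim id id s ∉ S) ∧ s = c then 1 else 0
  | Sum.inr (Sum.inr _) => match c with
      | Sum.inl z => if z = w then X (Sum.inr u) - X (Sum.inr w) else 0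
      | Sum.inr z => if z = w then - (X (Sum.inl u) - X (Sum.inl w)) else 0

lemma rmat_map (G : SimpleGraph V) [DecidableRel G.Adj] (S : Finset V) (u w : V) {R R' : Type} [CommRing R] [CommRing R']
    (f : R →+* R') (X : V ⊕ V → R) : (rmat G S u w X).map f = rmat G S u w (f ∘ X) := by
  ext r c
  rcases r with ⟨x, y⟩ | s | _ <;> rcases c with z | z <;> simp [rmat, apply_ite f] 

def crd (p : V → ℝ × ℝ) : V ⊕ V → ℝ := Sum.elim (fun v => (p v).1) (fun v => (p v).2)

lemma rmat_mulVec (G : SimpleGraph V) [DecidableRel G.Adj] (S : Finset V) (u w : V) (p q : V → ℝ × ℝ) :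
    (rmat G S u w (crd p)).mulVec (crd q) = 0 ↔
      MotOn G S p q ∧ (∀ x, (x = u ∨ x ∉ S) → q x = 0) ∧ dot2 (rot90 (p u - p w)) (q w) = 0 := by
  have h1 : ∀ x y, (rmat G S u w (crd p)).mulVec (crd q) (Sum.inl (x, y)) =
      if G.Adj x y ∧ x ∈ S ∧ y ∈ S then dot2 (p x - p y) (q x - q y) else 0 := by
    intro x y
    simp only [Matrix.mulVec, dotProduct, Fintype.sum_sum_type, rmat, crd]
    split_ifs with h
    · simp [mul_sub, sub_mul, Finset.sum_sub_distrib, dot2]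
    · simp
  have h2 : ∀ s, (rmat G S u w (crd p)).mulVec (crd q) (Sum.inr (Sum.inl s)) =
      if (Sum.elim id id s = u ∨ Sum.elim id id s ∉ S) then crd q s else 0 := by
    intro s
    simp only [Matrix.mulVec, dotProduct, rmat, ite_mul, one_mul, zero_mul]
    by_cases h : (Sum.elim id id s = u ∨ Sum.elim id id s ∉ S) <;> simp [h]
  have h3 : (rmat G S u w (crd p)).mulVec (crd q) (Sum.inr (Sum.inr ())) = - dot2 (rot90 (p u - p w)) (q w) := by
    simp only [Matrix.mulVec, dotProduct, Fintype.sum_sum_type, rmat, crd]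
    simp [dot2, rot90, ite_mul]
    ring
  constructor
  · intro h
    refine ⟨fun x y hx hy ha => ?_, fun x hx => ?_, ?_⟩
    · have := h1 x y
      rw [h] at this
      simpa [hx, hy, ha] using this.symm
    · have e1 := h2 (Sum.inl x)
      have e2 := h2 (Sum.inr x)
      rw [h] at e1 e2
      simp [hx, crd] at e1 e2
      exact Prod.ext e1.symm e2.symm
    · rw [h] at h3
      simpa using h3.symm
  · rintro ⟨a1, a2, a3⟩
    funext r
    rcases r with ⟨x, y⟩ | s | _
    · rw [h1]
      split_ifs with h
      · exact a1 x y h.2.1 h.2.2 h.1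
      · rfl
    · rw [h2]
      split_ifs with h
      · have := a2 _ h
        rcases s with x | x <;> simp at this <;> simp [crd, this]
      · rfl
    · erw [h3, a3]; simp

lemma crd_surj (f : V ⊕ V → ℝ) : ∃ q : V → ℝ × ℝ, crd q = f :=
  ⟨fun v => (f (Sum.inl v), f (Sum.inr v)), by funext x; rcases x with x | x <;> rfl⟩

lemma poly_generic {p p0 : V → ℝ × ℝ} (hp : GenericConf p) (P : MvPolynomial (V ⊕ V) ℚ)
    (h : MvPolynomial.aeval (crd p0) P ≠ 0) : MvPolynomial.aeval (crd p) P ≠ 0 := by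
  intro h0
  have : P = 0 := (algebraicIndependent_iff.1 hp) P h0
  exact h (by simp [this])

lemma pin_generic (G : SimpleGraph V) (S : Finset V) (u w : V) {p p0 : V → ℝ × ℝ} (hp : GenericConf p)
    (h : ∀ q, MotOn G S p0 q → (∀ x, (x = u ∨ x ∉ S) → q x = 0) → dot2 (rot90 (p0 u - p0 w)) (q w) = 0 → q = 0) :
    ∀ q, MotOn G S p q → (∀ x, (x = u ∨ x ∉ S) → q x = 0) → dot2 (rot90 (p u - p w)) (q w) = 0 → q = 0 := by
  classical
  let A := rmat G S u w (R := MvPolynomial (V ⊕ V) ℚ) MvPolynomial.X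
  have hev : ∀ p : V → ℝ × ℝ, MvPolynomial.aeval (crd p) (A.transpose * A).det
      = ((rmat G S u w (crd p)).transpose * rmat G S u w (crd p)).det := by
    intro p
    have := (MvPolynomial.aeval (R := ℚ) (crd p)).toRingHom.map_det (A.transpose * A)
    rw [RingHom.mapMatrix_apply, Matrix.map_mul, Matrix.transpose_map, rmat_map] at this
    have e : (⇑(MvPolynomial.aeval (R := ℚ) (crd p)).toRingHom ∘ MvPolynomial.X) = crd p := by
      funext x; simp
    rw [e] at this
    exact this
  have hiff : ∀ p : V → ℝ × ℝ, ((rmat G S u w (crd p)).transpose * rmat G S u w (crd p)).det ≠ 0 ↔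
      ∀ q, MotOn G S p q → (∀ x, (x = u ∨ x ∉ S) → q x = 0) → dot2 (rot90 (p u - p w)) (q w) = 0 → q = 0 := by
    intro p
    rw [← not_iff_not, not_not, ← Matrix.exists_mulVec_eq_zero_iff]
    have hk : ∀ f, ((rmat G S u w (crd p)).transpose * rmat G S u w (crd p)).mulVec f = 0 ↔
        (rmat G S u w (crd p)).mulVec f = 0 := by
      intro f
      have := Matrix.ker_mulVecLin_transpose_mul_self (rmat G S u w (crd p))
      have := SetLike.ext_iff.1 this f
      rw [LinearMap.mem_ker, LinearMap.mem_ker, Matrix.mulVecLin_apply, Matrix.mulVecLin_apply] at this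
      exact this
    constructor
    · rintro ⟨f, hf, hf0⟩ hall
      rw [hk] at hf0
      obtain ⟨q, rfl⟩ := crd_surj f
      rw [rmat_mulVec] at hf0
      apply hf
      rw [hall q hf0.1 hf0.2.1 hf0.2.2]
      funext x; rcases x with x | x <;> rfl
    · intro hall
      push Not at hall
      obtain ⟨q, h1, h2, h3, h4⟩ := hall
      refine ⟨crd q, fun h0 => h4 ?_, by rw [hk, rmat_mulVec]; exact ⟨h1, h2, h3⟩⟩
      funext x
      exact Prod.ext (congrFun h0 (Sum.inl x)) (congrFun h0 (Sum.inr x))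
  have h0 := (hiff p0).2 h
  rw [← hev] at h0
  have := poly_generic hp _ h0
  rw [hev] at this
  exact (hiff p).1 this

lemma pin_of_rig {G : SimpleGraph V} {S : Finset V} {u w : V} {p : V → ℝ × ℝ} (hu : u ∈ S) (hw : w ∈ S) (hne : p u ≠ p w)
    (h : RigOn G S p) :
    ∀ q, MotOn G S p q → (∀ x, (x = u ∨ x ∉ S) → q x = 0) → dot2 (rot90 (p u - p w)) (q w) = 0 → q = 0 := by
  intro q h1 h2 h3
  obtain ⟨a, t, hq⟩ := h q h1
  have hu0 := h2 u (Or.inl rfl)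
  rw [hq u hu] at hu0
  rw [hq w hw] at h3
  have e1 := congrArg Prod.fst hu0
  have e2 := congrArg Prod.snd hu0
  simp [rot90] at e1 e2
  simp [dot2, rot90] at h3
  have ha : a * (((p u).1 - (p w).1)^2 + ((p u).2 - (p w).2)^2) = 0 := by
    have ht1 : t.1 = a * (p u).2 := by linarith
    have ht2 : t.2 = - (a * (p u).1) := by linarith
    rw [ht1, ht2] at h3; linarith
  have ha0 : a = 0 := by
    rcases mul_eq_zero.1 ha with h | h
    · exact h
    · exfalso; apply hne
      have : (p u).1 - (p w).1 = 0 := by nlinarith [sq_nonneg ((p u).1 - (p w).1), sq_nonneg ((p u).2 - (p w).2)]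
      have : (p u).2 - (p w).2 = 0 := by nlinarith [sq_nonneg ((p u).1 - (p w).1), sq_nonneg ((p u).2 - (p w).2)]
      exact Prod.ext (by linarith) (by linarith)
  subst ha0
  have ht : t = 0 := by simpa using hu0
  funext x
  by_cases hx : x ∈ S
  · rw [hq x hx, ht]; simp
  · exact h2 x (Or.inr hx)

lemma rig_of_pin {G : SimpleGraph V} {S : Finset V} {u w : V} {p : V → ℝ × ℝ} (hu : u ∈ S) (hw : w ∈ S) (hne : p u ≠ p w)
    (h : ∀ q, MotOn G S p q → (∀ x, (x = u ∨ x ∉ S) → q x = 0) → dot2 (rot90 (p u - p w)) (q w) = 0 → q = 0) :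
    RigOn G S p := by
  intro q hq
  have hD : 0 < ((p u).1 - (p w).1)^2 + ((p u).2 - (p w).2)^2 := by
    by_contra hle
    apply hne
    have : (p u).1 - (p w).1 = 0 := by nlinarith [sq_nonneg ((p u).1 - (p w).1), sq_nonneg ((p u).2 - (p w).2)]
    have : (p u).2 - (p w).2 = 0 := by nlinarith [sq_nonneg ((p u).1 - (p w).1), sq_nonneg ((p u).2 - (p w).2)]
    exact Prod.ext (by linarith) (by linarith)
  set D := ((p u).1 - (p w).1)^2 + ((p u).2 - (p w).2)^2 with hDd
  set a : ℝ := - dot2 (rot90 (p u - p w)) (q w - q u) / D with had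
  have haD : a * D = - dot2 (rot90 (p u - p w)) (q w - q u) := by rw [had]; field_simp
  have := h (fun x => if x ∈ S then q x - (a • rot90 (p x - p u) + q u) else 0) ?_ ?_ ?_
  · refine ⟨a, q u - a • rot90 (p u), fun x hx => ?_⟩
    have := congrFun this x
    simp only [hx, if_true, Pi.zero_apply] at this
    rw [sub_eq_zero.1 this]
    ext <;> simp [rot90] <;> ring
  · intro x y hx hy hxy
    have := hq x y hx hy hxy
    simp only [hx, hy, if_true]
    simp [dot2, rot90] at *
    linarith
  · rintro x (rfl | hx)
    · simp [hu, rot90]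
    · simp [hx]
  · simp only [hw, if_true]
    simp [dot2, rot90] at *
    nlinarith [haD]

lemma gen_ne {p : V → ℝ × ℝ} (hp : GenericConf p) {u w : V} (h : u ≠ w) : p u ≠ p w := by
  intro h0
  have := AlgebraicIndependent.injective hp (a₁ := Sum.inl u) (a₂ := Sum.inl w) (by simp [h0])
  exact h (by simpa using this)

lemma rig_generic {G : SimpleGraph V} {S : Finset V} {u w : V} {p p0 : V → ℝ × ℝ} (hu : u ∈ S) (hw : w ∈ S)
    (hne : p0 u ≠ p0 w) (hp : GenericConf p) (h : RigOn G S p0) : RigOn G S p :=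
  rig_of_pin hu hw (gen_ne hp (fun h => hne (by rw [h]))) (pin_generic G S u w hp (pin_of_rig hu hw hne h))

lemma gen_noncol {p : V → ℝ × ℝ} (hp : GenericConf p) {x y z : V} (hxy : x ≠ y) (hxz : x ≠ z) (hyz : y ≠ z) :
    dot2 (rot90 (p y - p x)) (p z - p x) ≠ 0 := by
  have := poly_generic (p0 := fun t => if t = y then (1, 0) else if t = z then (0, 1) else (0, 0)) hp
    (- (MvPolynomial.X (Sum.inr y) - MvPolynomial.X (Sum.inr x)) * (MvPolynomial.X (Sum.inl z) - MvPolynomial.X (Sum.inl x)) +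
    (MvPolynomial.X (Sum.inl y) - MvPolynomial.X (Sum.inl x)) * (MvPolynomial.X (Sum.inr z) - MvPolynomial.X (Sum.inr x)))
    (by simp [crd, hxy, hxz, hyz, Ne.symm hyz])
  simpa [crd, dot2, rot90] using this

open Cardinal in
lemma exists_generic (V : Type) [Fintype V] : ∃ p : V → ℝ × ℝ, GenericConf p := by
  obtain ⟨B, hB⟩ := exists_isTranscendenceBasis ℚ ℝ
  have hinf : Infinite B := by
    by_contra hfin
    rw [not_infinite_iff_finite] at hfin
    have hK : Algebra.IsAlgebraic (Algebra.adjoin ℚ (Set.range ((↑) : B → ℝ))) ℝ := hB.isAlgebraic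
    have h1 := Algebra.IsAlgebraic.cardinalMk_le_max (Algebra.adjoin ℚ (Set.range ((↑) : B → ℝ))) ℝ
    have h2 : #(Algebra.adjoin ℚ (Set.range ((↑) : B → ℝ))) ≤ ℵ₀ := by
      rw [← Cardinal.mk_congr hB.1.aevalEquiv.toEquiv]
      refine MvPolynomial.cardinalMk_le_max.trans ?_
      simp
    rw [max_eq_right h2, Cardinal.mk_real] at h1
    exact absurd h1 (not_le.2 Cardinal.aleph0_lt_continuum)
  obtain ⟨f⟩ : Nonempty (V ⊕ V ↪ B) := by
    have e : V ⊕ V ↪ ℕ := (Fintype.equivFin (V ⊕ V)).toEmbedding.trans Fin.valEmbedding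
    exact ⟨e.trans (Infinite.natEmbedding B)⟩
  refine ⟨fun v => ((f (Sum.inl v) : ℝ), (f (Sum.inr v) : ℝ)), ?_⟩
  have := hB.1.comp f f.injective
  unfold GenericConf
  convert this using 1
  funext x
  rcases x with x | x <;> rfl
end rigid

section henne
variable {V : Type} [Fintype V] [DecidableEq V]

open Classical in
noncomputable def nb (G : SimpleGraph V) (S : Finset V) (z : V) : Finset V := S.filter (fun y => G.Adj z y)

lemma mem_nb {G : SimpleGraph V} {S : Finset V} {z y : V} : y ∈ nb G S z ↔ y ∈ S ∧ G.Adj z y := by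
  simp [nb]

lemma ec_erase (G : SimpleGraph V) {S : Finset V} {z : V} (hz : z ∈ S) :
    ec G S = ec G (S.erase z) + (nb G S z).card := by
  unfold ec
  have h : ES G S = ES G (S.erase z) ∪ (fun y => s(z, y)) '' (nb G S z : Set V) := by
    ext ⟨x, y⟩
    constructor
    · intro h
      rw [mem_ES] at h
      by_cases hx : x = z
      · subst hx; right; exact ⟨y, by simp [mem_nb, h], rfl⟩
      by_cases hy : y = z
      · subst hy; right; exact ⟨x, by simp [mem_nb, h, h.1.symm], Sym2.eq_swap⟩
      left; rw [mem_ES]; simp [h, hx, hy]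
    · rintro (h | ⟨u, hu, h⟩)
      · exact ES_mono le_rfl (Finset.erase_subset _ _) h
      · change s(x, y) ∈ _
        have h : s(z, u) = s(x, y) := h
        rw [← h, mem_ES]
        have := mem_nb.1 hu
        exact ⟨this.2, hz, this.1⟩
  rw [h, Set.ncard_union_eq _ (Set.toFinite _) (Set.toFinite _)]
  · rw [Set.ncard_image_of_injective]
    · simp
    · intro a b h
      have h' := Sym2.eq_iff.1 h; rcases h' with h' | h'; exacts [h'.2, h'.2.trans h'.1]
  · rw [Set.disjoint_left]
    rintro _ h1 ⟨u, hu, rfl⟩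
    have h1 : s(z, u) ∈ ES G (S.erase z) := h1
    rw [mem_ES] at h1
    simp at h1

lemma sum_nb (G : SimpleGraph V) (S : Finset V) : ∑ z ∈ S, (nb G S z).card = 2 * ec G S := by
  classical
  let R : SimpleGraph V := ⟨fun x y => G.Adj x y ∧ x ∈ S ∧ y ∈ S, ⟨fun x y h => ⟨h.1.symm, h.2.2, h.2.1⟩⟩, ⟨fun x h => G.irrefl h.1⟩⟩
  have h := R.sum_degrees_eq_twice_card_edges
  have h2 : R.edgeFinset.card = ec G S := by
    unfold ec
    rw [← Set.ncard_coe_finset]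
    congr 1
    ext ⟨x, y⟩
    change s(x, y) ∈ _ ↔ s(x, y) ∈ _
    simp [mem_ES, R]
  rw [← h2, ← h, ← Finset.sum_subset (Finset.subset_univ S)]
  · apply Finset.sum_congr rfl
    intro x hx
    rw [← R.card_neighborFinset_eq_degree]
    congr 1
    ext y
    simp [mem_nb, R, hx]; tauto
  · intro x _ hx
    rw [← R.card_neighborFinset_eq_degree, Finset.card_eq_zero]
    ext y
    simp [R, hx]

abbrev c2 : V → ℤ := fun _ => 2

lemma slk_c2 (G : SimpleGraph V) (S : Finset V) : slk G c2 S = 2 * S.card - 3 - ec G S := by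
  simp [slk, c2, mul_comm]

lemma slk_erase (G : SimpleGraph V) (w : V → ℤ) {S : Finset V} {z : V} (hz : z ∈ S) :
    slk G w S = slk G w (S.erase z) + w z - (nb G S z).card := by
  unfold slk
  rw [ec_erase G hz, ← Finset.add_sum_erase _ _ hz]
  push_cast; ring

lemma deg3_pair (G : SimpleGraph V) {U : Finset V} (hsp : ∀ T ⊆ U, 2 ≤ T.card → 0 ≤ slk G c2 T)
    {x y w : V} (hxy : x ≠ y) (hxw : x ≠ w) (hyw : y ≠ w)
    (h3 : ∀ T ⊆ U, x ∈ T → y ∈ T → w ∈ T → 1 ≤ slk G c2 T)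
    (hA : ∃ A ⊆ U, x ∈ A ∧ y ∈ A ∧ slk G c2 A = 0) (hB : ∃ A ⊆ U, y ∈ A ∧ w ∈ A ∧ slk G c2 A = 0)
    (hC : ∃ A ⊆ U, x ∈ A ∧ w ∈ A ∧ slk G c2 A = 0) : False := by
  obtain ⟨A, hAU, hxA, hyA, hA⟩ := hA
  obtain ⟨B, hBU, hyB, hwB, hB⟩ := hB
  obtain ⟨C, hCU, hxC, hwC, hC⟩ := hC
  have key : ∀ A B : Finset V, A ⊆ U → B ⊆ U → slk G c2 A = 0 → slk G c2 B = 0 → ∀ z, z ∈ A → z ∈ B →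
      (x ∈ A ∪ B ∧ y ∈ A ∪ B ∧ w ∈ A ∪ B) → A ∩ B = {z} := by
    intro A B hAU hBU hA hB z hzA hzB hh
    by_contra hne
    have h2 : 2 ≤ (A ∩ B).card := by
      by_contra hlt
      have h1 : (A ∩ B).card ≤ 1 := by omega
      apply hne
      rw [Finset.card_le_one] at h1
      ext t
      simp only [Finset.mem_singleton]
      exact ⟨fun ht => h1 _ ht _ (Finset.mem_inter.2 ⟨hzA, hzB⟩), fun ht => ht ▸ Finset.mem_inter.2 ⟨hzA, hzB⟩⟩
    have h4 := slk_union_inter G c2 A B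
    have h5 := hsp _ (Finset.inter_subset_left.trans hAU) h2
    have h6 := h3 _ (Finset.union_subset hAU hBU) hh.1 hh.2.1 hh.2.2
    omega
  have kAB := key A B hAU hBU hA hB y hyA hyB (by simp [*])
  have kAC := key A C hAU hCU hA hC x hxA hxC (by simp [*])
  have kBC := key B C hBU hCU hB hC w hwB hwC (by simp [*])
  have hs1 : slk G c2 {y} = -1 := by rw [slk_c2, ec_singleton]; simp
  have hD3 := h3 (A ∪ B) (Finset.union_subset hAU hBU) (by simp [*]) (by simp [*]) (by simp [*])
  have hxB : x ∉ B := fun h => by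
    have : x ∈ A ∩ B := Finset.mem_inter.2 ⟨hxA, h⟩
    rw [kAB] at this; simp at this; exact hxy this
  have hwA : w ∉ A := fun h => by
    have : w ∈ A ∩ B := Finset.mem_inter.2 ⟨h, hwB⟩
    rw [kAB] at this; simp at this; exact hyw this.symm
  by_cases hadj : G.Adj x w
  · have := slk_union_inter_strict G c2 A B hadj hxA hxB hwB hwA
    rw [kAB, hs1] at this
    omega
  · have h1 := slk_union_inter G c2 A B
    rw [kAB, hs1] at h1
    have h2 := slk_union_inter G c2 (A ∪ B) C
    have h4 : (A ∪ B) ∩ C = {x, w} := by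
      rw [Finset.union_inter_distrib_right, kAC, kBC]; rfl
    have h5 : slk G c2 {x, w} = 1 := by
      rw [slk_c2, Finset.card_pair hxw, show ec G {x, w} = 0 from ?_]
      · norm_num
      · unfold ec; rw [Set.ncard_eq_zero]; ext ⟨s, t⟩
        rw [mem_ES]; simp only [Finset.mem_insert, Finset.mem_singleton, Set.mem_empty_iff_false, iff_false]
        rintro ⟨h1, rfl | rfl, rfl | rfl⟩
        · exact G.irrefl h1
        · exact hadj h1
        · exact hadj h1.symm
        · exact G.irrefl h1
    rw [h4, h5] at h2
    have := h3 (A ∪ B ∪ C) (Finset.union_subset (Finset.union_subset hAU hBU) hCU) (by simp [*]) (by simp [*]) (by simp [*])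
    omega
end henne

section henne
variable {V : Type} [Fintype V] [DecidableEq V]

lemma perp2 {d d' e : ℝ × ℝ} (h1 : dot2 d e = 0) (h2 : dot2 d' e = 0) (h : dot2 (rot90 d) d' ≠ 0) : e = 0 := by
  simp only [dot2, rot90] at *
  have e1 : e.1 * (-d.2 * d'.1 + d.1 * d'.2) = 0 := by linear_combination d'.2 * h1 - d.2 * h2
  have e2 : e.2 * (-d.2 * d'.1 + d.1 * d'.2) = 0 := by linear_combination -d'.1 * h1 + d.1 * h2
  exact Prod.ext ((mul_eq_zero.1 e1).resolve_right h) ((mul_eq_zero.1 e2).resolve_right h)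

lemma perp1 {d e : ℝ × ℝ} (hd : d ≠ 0) (h1 : dot2 d e = 0) : ∃ a : ℝ, e = a • rot90 d := by
  simp only [dot2, rot90] at *
  have hD : d.1 ^ 2 + d.2 ^ 2 ≠ 0 := by
    intro h0
    apply hd
    have h1 : d.1 ^ 2 = 0 := by nlinarith [sq_nonneg d.1, sq_nonneg d.2]
    have h2 : d.2 ^ 2 = 0 := by nlinarith [sq_nonneg d.1, sq_nonneg d.2]
    exact Prod.ext (by simpa using h1) (by simpa using h2)
  refine ⟨(-d.2 * e.1 + d.1 * e.2) / (d.1 ^ 2 + d.2 ^ 2), Prod.ext ?_ ?_⟩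
  · simp only [Prod.smul_mk, smul_eq_mul]
    rw [eq_comm, div_mul_eq_mul_div, div_eq_iff hD]
    linear_combination -d.1 * h1
  · simp only [Prod.smul_mk, smul_eq_mul]
    rw [eq_comm, div_mul_eq_mul_div, div_eq_iff hD]
    linear_combination -d.2 * h1

lemma dot_triv (a : ℝ) (t x y : ℝ × ℝ) : dot2 (x - y) ((a • rot90 x + t) - (a • rot90 y + t)) = 0 := by
  simp [dot2, rot90]; ring

lemma dot2_sub_right (d e f : ℝ × ℝ) : dot2 d (e - f) = dot2 d e - dot2 d f := by
  simp [dot2]; ring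

lemma triv_extend {S : Finset V} {z x y : V} {p q : V → ℝ × ℝ} (hx : x ∈ S.erase z) (hy : y ∈ S.erase z)
    (ht : TrivOn (S.erase z) p q) (h1 : dot2 (p z - p x) (q z - q x) = 0) (h2 : dot2 (p z - p y) (q z - q y) = 0)
    (hnc : dot2 (rot90 (p z - p x)) (p z - p y) ≠ 0) : TrivOn S p q := by
  obtain ⟨a, t, ht⟩ := ht
  refine ⟨a, t, fun u hu => ?_⟩
  by_cases huz : u = z
  · subst huz
    have e : q u - (a • rot90 (p u) + t) = 0 := by
      apply perp2 (d := p u - p x) (d' := p u - p y) _ _ hnc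
      · have := dot_triv a t (p u) (p x)
        rw [← ht x hx, dot2_sub_right] at this
        rw [dot2_sub_right] at h1 ⊢; linarith
      · have := dot_triv a t (p u) (p y)
        rw [← ht y hy, dot2_sub_right] at this
        rw [dot2_sub_right] at h2 ⊢; linarith
    exact sub_eq_zero.1 e
  · exact ht u (Finset.mem_erase.2 ⟨huz, hu⟩)

lemma ec_add_edge (G : SimpleGraph V) {a b : V} (hab : a ≠ b) (hn : ¬ G.Adj a b) (T : Finset V) :
    ec (G ⊔ SimpleGraph.fromEdgeSet {s(a, b)}) T = ec G T + if a ∈ T ∧ b ∈ T then 1 else 0 := by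
  unfold ec
  split_ifs with h
  · have : ES (G ⊔ SimpleGraph.fromEdgeSet {s(a, b)}) T = insert s(a, b) (ES G T) := by
      ext ⟨x, y⟩
      change s(x, y) ∈ _ ↔ s(x, y) ∈ _
      rw [Set.mem_insert_iff, mem_ES, mem_ES]
      simp only [SimpleGraph.sup_adj, SimpleGraph.fromEdgeSet_adj, Set.mem_singleton_iff]
      constructor
      · tauto
      · rintro (h1 | h1)
        · refine ⟨Or.inr ⟨h1, ?_⟩, ?_⟩
          · rintro rfl
            have := Sym2.eq_iff.1 h1
            rcases this with ⟨h1, h2⟩ | ⟨h1, h2⟩ <;> simp_all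
          · rcases Sym2.eq_iff.1 h1 with ⟨h1, h2⟩ | ⟨h1, h2⟩ <;> simp_all
        · tauto
    rw [this, Set.ncard_insert_of_notMem _ (Set.toFinite _)]
    rw [mem_ES]; tauto
  · congr 1
    ext ⟨x, y⟩
    change s(x, y) ∈ _ ↔ s(x, y) ∈ _
    rw [mem_ES, mem_ES]
    simp only [SimpleGraph.sup_adj, SimpleGraph.fromEdgeSet_adj, Set.mem_singleton_iff]
    constructor
    · rintro ⟨h1 | h1, h2, h3⟩
      · exact ⟨h1, h2, h3⟩
      · exfalso; apply h
        rcases Sym2.eq_iff.1 h1.1 with ⟨h1, h2⟩ | ⟨h1, h2⟩ <;> simp_all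
    · tauto

lemma lamRig_aux (n : ℕ) : ∀ (M : SimpleGraph V) (S : Finset V), S.card = n → 2 ≤ S.card → slk M c2 S = 0 →
    (∀ T ⊆ S, 2 ≤ T.card → 0 ≤ slk M c2 T) → ∀ p : V → ℝ × ℝ, GenericConf p → RigOn M S p := by
  induction n with
  | zero => intro M S h1 h2; omega
  | succ n ih =>
    intro M S hcard h2 htight hsp p hp
    by_cases hS2 : S.card = 2
    · obtain ⟨x, y, hxy, rfl⟩ := Finset.card_eq_two.1 hS2
      have hadj : M.Adj x y := by
        by_contra hn
        have h := slk_erase M c2 (S := {x, y}) (z := x) (by simp)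
        have : nb M {x, y} x = ∅ := by
          ext u; simp only [mem_nb, Finset.mem_insert, Finset.mem_singleton, Finset.notMem_empty, iff_false]
          rintro ⟨hu | hu, h'⟩
          · rw [hu] at h'; exact M.irrefl h'
          · rw [hu] at h'; exact hn h'
        rw [this, Finset.erase_insert (by simpa using hxy), slk_c2 M {y}, ec_singleton] at h
        rw [htight] at h
        simp [c2] at h
      intro q hq
      have h1 := hq x y (by simp) (by simp) hadj
      obtain ⟨a, ha⟩ := perp1 (sub_ne_zero.2 (gen_ne hp hxy)) h1
      refine ⟨a, q y - a • rot90 (p y), ?_⟩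
      have e : q x = q y + a • rot90 (p x - p y) := by rw [← ha]; abel
      intro u hu
      simp only [Finset.mem_insert, Finset.mem_singleton] at hu
      rcases hu with rfl | rfl
      · rw [e]; ext <;> simp [rot90] <;> ring
      · abel
    · have h3 : 3 ≤ S.card := by omega
      obtain ⟨z, hz, hdz⟩ : ∃ z ∈ S, (nb M S z).card ≤ 3 := by
        by_contra hcon
        push Not at hcon
        have := Finset.sum_le_sum (f := fun _ => 4) (g := fun z => (nb M S z).card) (s := S) (fun z hz => hcon z hz)
        rw [sum_nb] at this
        rw [slk_c2] at htight
        simp at this; omega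
      have hsl := slk_erase M c2 hz
      have hce : (S.erase z).card = n := by rw [Finset.card_erase_of_mem hz]; omega
      have hge := hsp (S.erase z) (Finset.erase_subset _ _) (by omega)
      have hnbS : ∀ y ∈ nb M S z, y ∈ S.erase z ∧ M.Adj z y := by
        intro y hy
        rw [mem_nb] at hy
        exact ⟨Finset.mem_erase.2 ⟨hy.2.ne', hy.1⟩, hy.2⟩
      rcases (by simp [c2] at hsl; omega : (nb M S z).card = 2 ∨ (nb M S z).card = 3) with hd | hd
      · obtain ⟨x, y, hxy, hnb⟩ := Finset.card_eq_two.1 hd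
        have hx := hnbS x (by simp [hnb])
        have hy := hnbS y (by simp [hnb])
        have hr := ih M (S.erase z) hce (by omega) (by simp [c2] at hsl; omega)
          (fun T hT => hsp T (hT.trans (Finset.erase_subset _ _))) p hp
        intro q hq
        refine triv_extend hx.1 hy.1 (hr q fun u v hu hv => hq u v (Finset.mem_of_mem_erase hu) (Finset.mem_of_mem_erase hv))
          (hq z x hz (Finset.mem_of_mem_erase hx.1) hx.2) (hq z y hz (Finset.mem_of_mem_erase hy.1) hy.2) ?_
        have := gen_noncol hp hx.2.ne hy.2.ne hxy
        intro h0; apply this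
        simp [dot2, rot90] at h0 ⊢; linarith
      · obtain ⟨x, y, w, hxy, hxw, hyw, hnb⟩ := Finset.card_eq_three.1 hd
        have hx := hnbS x (by simp [hnb])
        have hy := hnbS y (by simp [hnb])
        have hw := hnbS w (by simp [hnb])
        have hsl1 : slk M c2 (S.erase z) = 1 := by simp [c2] at hsl; omega
        have hsp' : ∀ T ⊆ S.erase z, 2 ≤ T.card → 0 ≤ slk M c2 T :=
          fun T hT => hsp T (hT.trans (Finset.erase_subset _ _))
        have h3' : ∀ T ⊆ S.erase z, x ∈ T → y ∈ T → w ∈ T → 1 ≤ slk M c2 T := by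
          intro T hT hxT hyT hwT
          have hzT : z ∉ T := fun h => by simpa using hT h
          have h1 := slk_erase M c2 (S := insert z T) (z := z) (by simp)
          rw [Finset.erase_insert hzT] at h1
          have h4 := hsp (insert z T) (Finset.insert_subset hz (hT.trans (Finset.erase_subset _ _)))
            (by rw [Finset.card_insert_of_notMem hzT]; have := Finset.card_pos.2 ⟨x, hxT⟩; omega)
          have h5 : ({x, y, w} : Finset V) ⊆ nb M (insert z T) z := by
            intro u hu
            simp only [Finset.mem_insert, Finset.mem_singleton] at hu
            rw [mem_nb]
            rcases hu with rfl | rfl | rfl <;> simp [*]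
          have h6 := Finset.card_le_card h5
          rw [Finset.card_eq_three.2 ⟨x, y, w, hxy, hxw, hyw, rfl⟩] at h6
          simp [c2] at h1; simp [c2] at h4 ⊢; omega
        have main : ∀ a b c : V, a ≠ b → a ≠ c → b ≠ c → (a ∈ S.erase z ∧ M.Adj z a) → (b ∈ S.erase z ∧ M.Adj z b) →
            (c ∈ S.erase z ∧ M.Adj z c) → (¬ ∃ A ⊆ S.erase z, a ∈ A ∧ b ∈ A ∧ slk M c2 A = 0) → RigOn M S p := by
          intro a b c hab hac hbc ha hb hc hno
          have hnadj : ¬ M.Adj a b := by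
            intro h
            apply hno
            refine ⟨{a, b}, ?_, by simp, by simp, ?_⟩
            · intro u hu; simp at hu; rcases hu with rfl | rfl; exacts [ha.1, hb.1]
            · rw [slk_c2, Finset.card_pair hab, ec_pair _ h]; norm_num
          have hec := ec_add_edge M hab hnadj
          have hr := ih (M ⊔ SimpleGraph.fromEdgeSet {s(a, b)}) (S.erase z) hce (by omega)
            (by rw [slk_c2, hec, if_pos ⟨ha.1, hb.1⟩]; rw [slk_c2] at hsl1; push_cast; omega)
            (fun T hT hT2 => by
              have h0 := hsp' T hT hT2
              rw [slk_c2, hec]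
              split_ifs with h
              · have : slk M c2 T ≠ 0 := fun h0 => hno ⟨T, hT, h.1, h.2, h0⟩
                rw [slk_c2] at this h0; push_cast; omega
              · rw [slk_c2] at h0; push_cast; omega) p hp
          let p0 : V → ℝ × ℝ := Function.update p z ((1/2 : ℝ) • (p a + p b))
          have hp0 : ∀ u ∈ S.erase z, p0 u = p u := fun u hu => Function.update_of_ne (Finset.ne_of_mem_erase hu) _ _
          have hp0z : p0 z = (1/2 : ℝ) • (p a + p b) := Function.update_self _ _ _
          have hS := fun u (hu : u ∈ S.erase z) => Finset.mem_of_mem_erase hu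
          apply rig_generic (hS a ha.1) (hS b hb.1) (p0 := p0) (by rw [hp0 a ha.1, hp0 b hb.1]; exact gen_ne hp hab) hp
          intro q hq
          have q1 := hq z a hz (hS a ha.1) ha.2
          have q2 := hq z b hz (hS b hb.1) hb.2
          have q3 := hq z c hz (hS c hc.1) hc.2
          have ht : TrivOn (S.erase z) p q := by
            apply hr
            intro u v hu hv huv
            have base : ∀ u v, M.Adj u v → u ∈ S.erase z → v ∈ S.erase z → dot2 (p u - p v) (q u - q v) = 0 := by
              intro u v h hu hv
              have := hq u v (hS u hu) (hS v hv) h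
              rwa [hp0 u hu, hp0 v hv] at this
            rw [hp0z, hp0 a ha.1] at q1
            rw [hp0z, hp0 b hb.1] at q2
            have habq : dot2 (p a - p b) (q a - q b) = 0 := by
              simp [dot2] at q1 q2 ⊢; linarith
            rcases huv with h | h
            · exact base u v h hu hv
            · rw [SimpleGraph.fromEdgeSet_adj] at h
              rcases Sym2.eq_iff.1 h.1 with ⟨rfl, rfl⟩ | ⟨rfl, rfl⟩
              · exact habq
              · simp [dot2] at habq ⊢; linarith
          have ht0 : TrivOn (S.erase z) p0 q := by
            obtain ⟨r, t, h⟩ := ht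
            exact ⟨r, t, fun u hu => by rw [hp0 u hu]; exact h u hu⟩
          refine triv_extend ha.1 hc.1 ht0 q1 q3 ?_
          rw [hp0z, hp0 a ha.1, hp0 c hc.1]
          have := gen_noncol hp hab hac hbc
          intro h0; apply this
          simp [dot2, rot90] at h0 ⊢; linarith
        by_cases hA : ∃ A ⊆ S.erase z, x ∈ A ∧ y ∈ A ∧ slk M c2 A = 0
        · by_cases hB : ∃ A ⊆ S.erase z, y ∈ A ∧ w ∈ A ∧ slk M c2 A = 0
          · by_cases hC : ∃ A ⊆ S.erase z, x ∈ A ∧ w ∈ A ∧ slk M c2 A = 0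
            · exact (deg3_pair M hsp' hxy hxw hyw h3' hA hB hC).elim
            · exact main x w y hxw hxy hyw.symm hx hw hy hC
          · exact main y w x hyw hxy.symm hxw.symm hy hw hx hB
        · exact main x y w hxy hxw hyw hx hy hw hA

lemma lamRig {M : SimpleGraph V} {S : Finset V} (h2 : 2 ≤ S.card) (ht : slk M c2 S = 0)
    (hs : ∀ T ⊆ S, 2 ≤ T.card → 0 ≤ slk M c2 T) {p : V → ℝ × ℝ} (hp : GenericConf p) : RigOn M S p :=
  lamRig_aux _ M S rfl h2 ht hs p hp
end henne

section R4
variable {V : Type} [Fintype V] [DecidableEq V]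

def lk {W : Type} (p q : W → ℝ × ℝ) (x y : W) : Prop := dot2 (p x - p y) (q x - q y) = 0

lemma lk_symm {W : Type} {p q : W → ℝ × ℝ} {x y : W} (h : lk p q x y) : lk p q y x := by
  simp [lk, dot2] at *; linarith

lemma lk_triv {W : Type} {p q : W → ℝ × ℝ} {x y : W} (hne : p x ≠ p y) (h : lk p q x y) :
    ∃ (m : ℝ × (ℝ × ℝ)), q x = m.1 • rot90 (p x) + m.2 ∧ q y = m.1 • rot90 (p y) + m.2 := by
  obtain ⟨a, ha⟩ := perp1 (sub_ne_zero.2 hne) h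
  have e : q x = q y + a • rot90 (p x - p y) := by rw [← ha]; abel
  refine ⟨(a, q y - a • rot90 (p y)), ?_, by simp⟩
  rw [e]; ext <;> simp [rot90] <;> ring

lemma triv_uniq {x y : ℝ × ℝ} (hne : x ≠ y) {m m' : ℝ × (ℝ × ℝ)}
    (h1 : m.1 • rot90 x + m.2 = m'.1 • rot90 x + m'.2) (h2 : m.1 • rot90 y + m.2 = m'.1 • rot90 y + m'.2) : m = m' := by
  obtain ⟨a, t1, t2⟩ := m
  obtain ⟨b, s1, s2⟩ := m'
  simp [rot90] at h1 h2
  obtain ⟨h1, h1'⟩ := h1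
  obtain ⟨h2, h2'⟩ := h2
  have hab : a = b := by
    by_contra hab
    apply hne
    have hab := sub_ne_zero.2 hab
    refine Prod.ext (mul_left_cancel₀ hab (by linarith)) (mul_left_cancel₀ hab (by linarith))
  subst hab
  simp_all

lemma lk_third {W : Type} {p q : W → ℝ × ℝ} {x y z : W} {m : ℝ × (ℝ × ℝ)}
    (hx : q x = m.1 • rot90 (p x) + m.2) (hy : q y = m.1 • rot90 (p y) + m.2)
    (h1 : lk p q z x) (h2 : lk p q z y) (hnc : dot2 (rot90 (p z - p x)) (p z - p y) ≠ 0) :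
    q z = m.1 • rot90 (p z) + m.2 := by
  have e : q z - (m.1 • rot90 (p z) + m.2) = 0 := by
    unfold lk at h1 h2
    apply perp2 (d := p z - p x) (d' := p z - p y) _ _ hnc
    · have := dot_triv m.1 m.2 (p z) (p x)
      rw [← hx, dot2_sub_right] at this
      rw [dot2_sub_right] at h1 ⊢; linarith
    · have := dot_triv m.1 m.2 (p z) (p y)
      rw [← hy, dot2_sub_right] at this
      rw [dot2_sub_right] at h2 ⊢; linarith
  exact sub_eq_zero.1 e

lemma generic_sub {p : V → ℝ × ℝ} (hp : GenericConf p) (s : Set V) : GenericConf (fun x : s => p x) := by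
  unfold GenericConf at *
  have := hp.comp (Sum.map (Subtype.val : s → V) (Subtype.val : s → V))
    (Sum.map_injective.2 ⟨Subtype.val_injective, Subtype.val_injective⟩)
  convert this using 1
  funext x; rcases x with x | x <;> rfl

lemma unlinked_rigid {G L : SimpleGraph V} {v : V} (hLG : L ≤ G) (hLaman : LamanGraph L)
    (hdeg : Nat.card (L.neighborSet v) = 3) {p : V → ℝ × ℝ} (hp : GenericConf p)
    {q0 : ↥({v}ᶜ : Set V) → ℝ × ℝ} (hq0 : IsInfMotion (G.induce ({v}ᶜ : Set V)) (fun x => p x) q0)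
    (hnt : ¬ IsTrivialMotion (fun x : ↥({v}ᶜ : Set V) => p x) q0)
    {x y : ↥({v}ᶜ : Set V)} (hxy : ¬ lk (fun x : ↥({v}ᶜ : Set V) => p x) q0 x y) :
    GenRigid (G.induce ({v}ᶜ : Set V) ⊔ SimpleGraph.fromEdgeSet {s(x, y)}) := by
  have hne : x ≠ y := by
    rintro rfl; apply hxy; simp [lk, dot2]
  intro p' hp'
  rw [← rigOn_univ]
  have hp1 := generic_sub hp ({v}ᶜ : Set V)
  refine rig_generic (u := x) (w := y) (p0 := fun x => p x) (by simp) (by simp) (gen_ne hp1 hne) hp' ?_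
  rw [rigOn_univ]
  have hLr : InfRigid L p := by
    rw [← rigOn_univ]
    rw [laman_iff] at hLaman
    refine lamRig ?_ hLaman.1 (fun T _ h => hLaman.2 T h) hp
    have : Nat.card (L.neighborSet v) ≤ Nat.card V := Nat.card_le_card_of_injective _ Subtype.val_injective
    rw [Nat.card_eq_fintype_card (α := V)] at this
    simp; omega
  obtain ⟨n1, n2, n3, h12, h13, h23, hN⟩ := Set.ncard_eq_three.1 hdeg
  have hadj : ∀ z, L.Adj v z ↔ z = n1 ∨ z = n2 ∨ z = n3 := by
    intro z
    rw [← SimpleGraph.mem_neighborSet, hN]; simp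
  have a1 := (hadj n1).2 (by simp)
  have a2 := (hadj n2).2 (by simp)
  have a3 := (hadj n3).2 (by simp)
  have hnc : dot2 (rot90 (p v - p n1)) (p v - p n2) ≠ 0 := by
    have := gen_noncol hp a1.ne a2.ne h12
    intro h0; apply this
    simp [dot2, rot90] at h0 ⊢; linarith
  set d1 := p v - p n1 with hd1
  set d2 := p v - p n2 with hd2
  set d3 := p v - p n3 with hd3
  set D := dot2 (rot90 d1) d2 with hD
  have hD' : D = -d1.2 * d2.1 + d1.1 * d2.2 := by simp [hD, dot2, rot90]
  obtain ⟨α, β, hαβ⟩ : ∃ α β : ℝ, d3 = α • d1 + β • d2 := by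
    refine ⟨(d3.1 * d2.2 - d3.2 * d2.1) / D, (d1.1 * d3.2 - d1.2 * d3.1) / D, Prod.ext ?_ ?_⟩
    · simp; field_simp; rw [hD']; ring
    · simp; field_simp; rw [hD']; ring
  let m1 : ↥({v}ᶜ : Set V) := ⟨n1, by simpa using a1.ne'⟩
  let m2 : ↥({v}ᶜ : Set V) := ⟨n2, by simpa using a2.ne'⟩
  let m3 : ↥({v}ᶜ : Set V) := ⟨n3, by simpa using a3.ne'⟩
  let Φ : (↥({v}ᶜ : Set V) → ℝ × ℝ) → ℝ := fun q => dot2 d3 (q m3) - α * dot2 d1 (q m1) - β * dot2 d2 (q m2)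
  have hΦ : ∀ q, IsInfMotion (G.induce ({v}ᶜ : Set V)) (fun x => p x) q → Φ q = 0 →
      IsTrivialMotion (fun x : ↥({v}ᶜ : Set V) => p x) q := by
    intro q hq h0
    obtain ⟨u, hu1, hu2⟩ : ∃ u : ℝ × ℝ, dot2 d1 u = dot2 d1 (q m1) ∧ dot2 d2 u = dot2 d2 (q m2) := by
      refine ⟨((dot2 d1 (q m1) * d2.2 - dot2 d2 (q m2) * d1.2) / D, (d1.1 * dot2 d2 (q m2) - d2.1 * dot2 d1 (q m1)) / D), ?_, ?_⟩
      · generalize dot2 d1 (q m1) = A; generalize dot2 d2 (q m2) = B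
        simp only [dot2]; field_simp; rw [hD']; ring
      · generalize dot2 d1 (q m1) = A; generalize dot2 d2 (q m2) = B
        simp only [dot2]; field_simp; rw [hD']; ring
    have hu3 : dot2 d3 u = dot2 d3 (q m3) := by
      have : dot2 d3 u = α * dot2 d1 u + β * dot2 d2 u := by rw [hαβ]; simp [dot2]; ring
      rw [this, hu1, hu2]; simp only [Φ] at h0; linarith
    let Q : V → ℝ × ℝ := fun z => if h : z = v then u else q ⟨z, by simpa using h⟩
    have Qv : Q v = u := by simp [Q]
    have Qz : ∀ z (h : z ≠ v), Q z = q ⟨z, by simpa using h⟩ := fun z h => by simp [Q, h]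
    have hv : ∀ z, L.Adj v z → dot2 (p v - p z) (Q v - Q z) = 0 := by
      intro z hz
      rw [Qv, Qz z hz.ne', dot2_sub_right, sub_eq_zero]
      rcases (hadj z).1 hz with rfl | rfl | rfl
      exacts [hu1, hu2, hu3]
    obtain ⟨a, t, ht⟩ := hLr Q (by
      intro z w hzw
      by_cases hz : z = v
      · subst hz; exact hv w hzw
      by_cases hw : w = v
      · subst hw
        have := hv z hzw.symm
        simp [dot2] at this ⊢; linarith
      rw [Qz z hz, Qz w hw]
      exact hq ⟨z, hz⟩ ⟨w, hw⟩ (hLG hzw))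
    exact ⟨a, t, fun z => by rw [← ht z, Qz z z.2]⟩
  have hΦ0 : Φ q0 ≠ 0 := fun h => hnt (hΦ q0 hq0 h)
  intro q hq
  have hqH : IsInfMotion (G.induce ({v}ᶜ : Set V)) (fun x => p x) q := fun u w h => hq u w (Or.inl h)
  set l := Φ q / Φ q0 with hl
  obtain ⟨a, t, ht⟩ := hΦ (fun z => q z - l • q0 z) (by
      intro u w h
      have h1 := hqH u w h
      have h2 := hq0 u w h
      simp [dot2] at h1 h2 ⊢
      linear_combination h1 - l * h2) (by
      have : Φ (fun z => q z - l • q0 z) = Φ q - l * Φ q0 := by simp [Φ, dot2]; ring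
      rw [this, hl]; field_simp; ring)
  have hqxy := hq x y (Or.inr (by simp [hne]))
  have hx : q x = l • q0 x + (a • rot90 (p x) + t) := by rw [← ht x]; simp
  have hy : q y = l • q0 y + (a • rot90 (p y) + t) := by rw [← ht y]; simp
  have hl0 : l * dot2 (p x - p y) (q0 x - q0 y) = 0 := by
    have h3 := dot_triv a t (p x) (p y)
    rw [hx, hy] at hqxy
    simp [dot2, rot90, -mul_eq_zero] at hqxy h3 ⊢
    linear_combination hqxy - h3
  have hl1 : l = 0 := (mul_eq_zero.1 hl0).resolve_right hxy
  exact ⟨a, t, fun z => by have := ht z; rw [hl1] at this; simpa using this⟩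

lemma nbrs_not_rigid {G : SimpleGraph V} {v : V} {p : V → ℝ × ℝ} (hr : InfRigid G p)
    {q0 : ↥({v}ᶜ : Set V) → ℝ × ℝ} (hq0 : IsInfMotion (G.induce ({v}ᶜ : Set V)) (fun x => p x) q0)
    (hnt : ¬ IsTrivialMotion (fun x : ↥({v}ᶜ : Set V) => p x) q0) (m : ℝ × (ℝ × ℝ)) :
    ∃ y : ↥({v}ᶜ : Set V), G.Adj v y ∧ q0 y ≠ m.1 • rot90 (p y) + m.2 := by
  by_contra hcon
  push Not at hcon
  let Q : V → ℝ × ℝ := fun z => if h : z = v then m.1 • rot90 (p v) + m.2 else q0 ⟨z, by simpa using h⟩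
  have Qv : Q v = m.1 • rot90 (p v) + m.2 := by simp [Q]
  have Qz : ∀ z (h : z ≠ v), Q z = q0 ⟨z, by simpa using h⟩ := fun z h => by simp [Q, h]
  have hv : ∀ z, G.Adj v z → dot2 (p v - p z) (Q v - Q z) = 0 := by
    intro z hz
    rw [Qv, Qz z hz.ne', hcon ⟨z, hz.ne'⟩ hz]
    exact dot_triv _ _ _ _
  obtain ⟨a, t, ht⟩ := hr Q (by
    intro z w hzw
    by_cases hz : z = v
    · subst hz; exact hv w hzw
    by_cases hw : w = v
    · subst hw
      have := hv z hzw.symm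
      simp [dot2] at this ⊢; linarith
    rw [Qz z hz, Qz w hw]
    exact hq0 ⟨z, hz⟩ ⟨w, hw⟩ hzw)
  exact hnt ⟨a, t, fun z => by rw [← ht z, Qz z z.2]⟩

lemma rigid_cut {G : SimpleGraph V} (hr : GenRigid G) {z b : V} {A : Set V} (hA : A.Nonempty) (hz : z ∉ A)
    (hb : b ≠ z) (hbA : b ∉ A) : ∃ x ∈ A, ∃ y, y ∉ A ∧ y ≠ z ∧ G.Adj x y := by
  classical
  by_contra hcon
  push Not at hcon
  obtain ⟨p, hp⟩ := exists_generic V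
  obtain ⟨a, t, ht⟩ := hr p hp (fun x => if x ∈ A then rot90 (p x - p z) else 0) (by
    have key : ∀ x y, x ∈ A → G.Adj x y → y = z ∨ y ∈ A := by
      intro x y hx h
      by_contra h'
      push Not at h'
      exact hcon x hx y h'.2 h'.1 h
    intro x y h
    by_cases hx : x ∈ A <;> by_cases hy : y ∈ A
    · simp [hx, hy, dot2, rot90]; ring
    · obtain rfl := (key x y hx h).resolve_right hy
      simp [hx, hy, dot2, rot90]; ring
    · obtain rfl := (key y x hy h.symm).resolve_right hx
      simp [hx, hy, dot2, rot90]; ring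
    · simp [hx, hy, dot2])
  have h0 := triv_uniq (gen_ne hp hb) (m := (a, t)) (m' := (0, 0)) (by rw [← ht b]; simp [hbA]) (by rw [← ht z]; simp [hz])
  obtain ⟨x, hx⟩ := hA
  have := ht x
  simp only [Prod.mk.injEq] at h0
  simp [hx, h0.1, h0.2, rot90] at this
  have hxz : x ≠ z := fun h => hz (h ▸ hx)
  apply gen_ne hp hxz
  exact Prod.ext (by linarith) (by linarith)

lemma ring_choice {W : Type} {p q : W → ℝ × ℝ} {w : ℕ → W} {d : ℕ} (hd : 3 ≤ d)
    (hper : ∀ i, w (i + d) = w i) (hinj : ∀ i j, i < j → j < i + d → w i ≠ w j)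
    (hne : ∀ x y, x ≠ y → p x ≠ p y)
    (hnc : ∀ x y z, x ≠ y → x ≠ z → y ≠ z → dot2 (rot90 (p y - p x)) (p z - p x) ≠ 0)
    (hlk : ∀ i, lk p q (w i) (w (i + 1))) (hnot : ∀ m : ℝ × (ℝ × ℝ), ∃ i, q (w i) ≠ m.1 • rot90 (p (w i)) + m.2) :
    ∃ i, q (w (i + 1)) ≠ 0 ∧ ¬ lk p q (w i) (w (i + 2)) := by
  by_contra hcon
  push Not at hcon
  have hn1 : ∀ i, w i ≠ w (i + 1) := fun i => hinj i (i + 1) (by omega) (by omega)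
  choose r hr1 hr2 using fun i => lk_triv (hne _ _ (hn1 i)) (hlk i)
  have hrper : ∀ i, r (i + d) = r i := by
    intro i
    apply triv_uniq (hne _ _ (hn1 i))
    · rw [← hr1 i, ← hper i, ← hr1 (i + d)]
    · rw [← hr2 i, ← hper (i + 1), show i + 1 + d = i + d + 1 by ring, ← hr2 (i + d)]
  have hch : ∀ i, r i ≠ r (i + 1) → q (w (i + 1)) = 0 := by
    intro i h
    by_contra h0
    apply h
    have hl := hcon i h0
    have hn2 : w i ≠ w (i + 2) := hinj i (i + 2) (by omega) (by omega)
    have := lk_third (hr1 i) (hr2 i) (lk_symm hl) (lk_symm (hlk (i + 1))) (by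
      have := hnc _ _ _ hn2.symm (hn1 (i + 1)).symm (hn1 i)
      intro h0; apply this
      simp [dot2, rot90] at h0 ⊢; linarith)
    apply triv_uniq (hne _ _ (hn1 (i + 1)))
    · rw [← hr2 i, ← hr1 (i + 1)]
    · have h3 := hr2 (i + 1)
      rw [show i + 1 + 1 = i + 2 by ring] at h3 ⊢
      rw [← this, h3]
  have hconst : ∀ i n, (∀ j, i ≤ j → j < i + n → r j = r (j + 1)) → r (i + n) = r i := by
    intro i n
    induction n with
    | zero => simp
    | succ n ih =>
      intro h
      rw [← ih fun j h1 h2 => h j h1 (by omega), ← add_assoc, h (i + n) (by omega) (by omega)]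
  have hnext : ∀ i, r i ≠ r (i + 1) → ∃ j, i < j ∧ j < i + d ∧ r j ≠ r (j + 1) ∧ r j = r (i + 1) := by
    intro i h
    have hex : ∃ n, r (i + 1 + n) ≠ r (i + 1 + n + 1) ∧ n + 1 < d := by
      by_contra hc
      push Not at hc
      apply h
      rw [← hrper i, ← hconst (i + 1) (d - 1)]
      · congr 1; omega
      · intro j h1 h2
        by_contra h3
        have := hc (j - (i + 1))
        rw [show i + 1 + (j - (i + 1)) = j by omega] at this
        have := this h3
        omega
    classical
    obtain ⟨h1, h2⟩ := Nat.find_spec hex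
    refine ⟨i + 1 + Nat.find hex, by omega, by omega, h1, hconst _ _ ?_⟩
    intro j h3 h4
    by_contra h5
    refine Nat.find_min hex (m := j - (i + 1)) (by omega) ⟨?_, by omega⟩
    rw [show i + 1 + (j - (i + 1)) = j by omega]; exact h5
  have hzero : ∀ i, r i ≠ r (i + 1) → r (i + 1) = 0 := by
    intro i h
    obtain ⟨j, h1, h2, h3, h4⟩ := hnext i h
    have e1 := hch i h
    have e2 := hch j h3
    apply triv_uniq (hne _ _ (hinj (i + 1) (j + 1) (by omega) (by omega)))
    · rw [← hr1, e1]; simp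
    · rw [← h4, ← hr2, e2]; simp
  have hno : ∀ i, r i = r (i + 1) := by
    intro i
    by_contra h
    obtain ⟨j, h1, h2, h3, h4⟩ := hnext i h
    exact h3 (by rw [h4, hzero i h, hzero j h3])
  obtain ⟨i, hi⟩ := hnot (r 0)
  apply hi
  have := hconst 0 i (fun j _ _ => hno j)
  rw [zero_add] at this
  rw [← this]; exact hr1 i
end R4

section plane
open scoped Classical
variable {V : Type} [Fintype V] {G : SimpleGraph V} 

noncomputable instance dartFin : Fintype G.Dart := 
  Fintype.ofInjective (fun d : G.Dart => d.toProd) (fun d d' h => SimpleGraph.Dart.ext _ _ h)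

def fac (E : PlaneEmb G) : Equiv.Perm G.Dart := E.rot * dartSymmPerm G

@[simp] lemma fac_apply (E : PlaneEmb G) (d : G.Dart) : fac E d = E.rot d.symm := rfl

noncomputable instance faceFin (E : PlaneEmb G) : Fintype E.Face := 
  Fintype.ofSurjective (fun d : G.Dart => E.dartFace d) (fun F => Quotient.exists_rep F)

lemma face_eq_iff (E : PlaneEmb G) (d d' : G.Dart) : E.dartFace d = E.dartFace d' ↔ (fac E).SameCycle d d' :=
  Quotient.eq (r := faceSetoid (E.rot * dartSymmPerm G))

lemma face_fac (E : PlaneEmb G) (d : G.Dart) : E.dartFace (fac E d) = E.dartFace d := by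
  rw [face_eq_iff]; exact (Equiv.Perm.sameCycle_apply_left).2 (Equiv.Perm.SameCycle.refl _ _)

lemma face_rot (E : PlaneEmb G) (d : G.Dart) : E.dartFace (E.rot d) = E.dartFace d.symm := by
  have := face_fac E d.symm
  rwa [fac_apply, SimpleGraph.Dart.symm_symm] at this

lemma angle_eq (E : PlaneEmb G) (d : G.Dart) : E.angleFace d = E.dartFace d.symm := rfl

lemma rot_ind (E : PlaneEmb G) {P : G.Dart → Prop} (h : ∀ d, P d → P (E.rot d)) {d d' : G.Dart} (hd : P d)
    (hf : d.fst = d'.fst) : P d' := by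
  obtain ⟨n, rfl⟩ := E.rot_vertex d d' hf
  have : ∀ n : ℕ, P ((E.rot ^ n) d) := by
    intro n
    induction n with
    | zero => simpa
    | succ n ih => rw [pow_succ']; exact h _ ih
  exact this n

lemma conn_cut {W : Type} {K : SimpleGraph W} (hc : K.Connected) {A : Set W} (h1 : A.Nonempty)
    (h : ∀ x y, K.Adj x y → x ∈ A → y ∈ A) (y : W) : y ∈ A := by
  obtain ⟨x, hx⟩ := h1
  obtain ⟨w⟩ := hc.preconnected x y
  induction w with
  | nil => exact hx
  | cons hadj _ ih => exact ih (h _ _ hadj hx)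

lemma dual_const (E : PlaneEmb G) {h : E.Face → ℝ} (hh : ∀ d, h (E.dartFace d) = h (E.dartFace d.symm)) (F F' : E.Face) :
    h F = h F' := by
  obtain ⟨d, rfl⟩ := Quotient.exists_rep F
  obtain ⟨d', rfl⟩ := Quotient.exists_rep F'
  change h (E.dartFace d) = h (E.dartFace d')
  have key : ∀ e e' : G.Dart, e.fst = e'.fst → h (E.dartFace e) = h (E.dartFace e') := fun e e' he =>
    rot_ind E (P := fun e' => h (E.dartFace e) = h (E.dartFace e')) (fun e' h' => by rw [h', face_rot, hh]) rfl he
  have := conn_cut E.connected (A := {x | ∀ e : G.Dart, e.fst = x → h (E.dartFace d) = h (E.dartFace e)}) ⟨d.fst, fun e he => key d e he.symm⟩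
    (fun x y hxy hx e he => by
      have h1 := hx ⟨(x, y), hxy⟩ rfl
      rw [h1, hh]
      exact key _ _ he.symm) d'.fst
  exact this d' rfl

noncomputable def dl (g : V → ℝ) (d : G.Dart) : ℝ := g d.snd - g d.fst
noncomputable def ds (E : PlaneEmb G) (h : E.Face → ℝ) (d : G.Dart) : ℝ := h (E.dartFace d) - h (E.dartFace d.symm)

lemma sum_symm (f : G.Dart → ℝ) : ∑ d : G.Dart, f d.symm = ∑ d, f d :=
  Equiv.sum_comp (dartSymmPerm G) f

lemma dl_face (E : PlaneEmb G) (g : V → ℝ) (h : E.Face → ℝ) : ∑ d, dl g d * h (E.dartFace d) = 0 := by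
  unfold dl
  simp only [sub_mul, Finset.sum_sub_distrib]
  rw [sub_eq_zero, ← Equiv.sum_comp (fac E) (fun d => g d.fst * h (E.dartFace d))]
  refine Finset.sum_congr rfl fun d _ => ?_
  rw [face_fac, fac_apply, E.rot_fst]; rfl

lemma anti_ds (E : PlaneEmb G) {ψ : G.Dart → ℝ} (ha : ∀ d, ψ d.symm = - ψ d) (h : E.Face → ℝ) :
    ∑ d, ψ d * ds E h d = 2 * ∑ d, ψ d * h (E.dartFace d) := by
  unfold ds
  simp only [mul_sub, Finset.sum_sub_distrib]
  rw [← sum_symm (fun d => ψ d * h (E.dartFace d.symm))]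
  simp only [ha, SimpleGraph.Dart.symm_symm]
  simp; ring

lemma dl_ds (E : PlaneEmb G) (g : V → ℝ) (h : E.Face → ℝ) : ∑ d, dl g d * ds E h d = 0 := by
  rw [anti_ds E (fun d => by simp [dl]), dl_face]; simp

lemma dl_const (E : PlaneEmb G) {g : V → ℝ} (hg : ∀ d : G.Dart, dl g d = 0) (x y : V) : g x = g y := by
  have := conn_cut E.connected (A := {z | g x = g z}) ⟨x, rfl⟩ (fun u w huw hu => by
    have := hg ⟨(u, w), huw⟩
    simp [dl] at this
    simp at hu ⊢; linarith) y
  exact this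

lemma edge_card_anti : ∀ A : Submodule ℝ (G.Dart → ℝ), (∀ ψ ∈ A, ∀ d : G.Dart, ψ d.symm = - ψ d) →
    Module.finrank ℝ A ≤ Nat.card G.edgeSet := by
  intro A hA
  have hex : ∀ e : G.edgeSet, ∃ d : G.Dart, d.edge = e := by
    rintro ⟨⟨x, y⟩, h⟩; exact ⟨⟨(x, y), h⟩, rfl⟩
  choose o ho using hex
  rw [Nat.card_eq_fintype_card, ← Module.finrank_fintype_fun_eq_card (R := ℝ)]
  let f : A →ₗ[ℝ] (G.edgeSet → ℝ) := 
    { toFun := fun ψ e => ψ.1 (o e)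
      map_add' := by intros; rfl
      map_smul' := by intros; rfl }
  refine LinearMap.finrank_le_finrank_of_injective (f := f) ?_
  rw [← LinearMap.ker_eq_bot, LinearMap.ker_eq_bot']
  intro ψ hψ
  ext d
  have h1 : ψ.1 (o ⟨d.edge, d.edge_mem⟩) = 0 := congrFun hψ ⟨d.edge, d.edge_mem⟩
  have h2 := ho ⟨d.edge, d.edge_mem⟩
  rcases SimpleGraph.dart_edge_eq_iff _ _ |>.1 h2 with h | h
  · rw [h] at h1; simpa using h1
  · rw [h, hA _ ψ.2] at h1; simpa using h1

lemma antisym_dec (E : PlaneEmb G) {ψ : G.Dart → ℝ} (ha : ∀ d, ψ d.symm = - ψ d) :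
    ∃ g h, ∀ d, ψ d = dl g d + ds E h d := by
  let A : Submodule ℝ (G.Dart → ℝ) := 
    { carrier := {ψ | ∀ d, ψ d.symm = - ψ d}
      add_mem' := by intro a b ha hb d; simp [ha d, hb d]; ring
      zero_mem' := by intro d; simp
      smul_mem' := by intro c a ha d; simp [ha d] }
  let Φ : ((V → ℝ) × (E.Face → ℝ)) →ₗ[ℝ] (G.Dart → ℝ) := 
    { toFun := fun p d => dl p.1 d + ds E p.2 d
      map_add' := by intros; funext d; simp [dl, ds]; ring
      map_smul' := by intros; funext d; simp [dl, ds]; ring }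
  obtain ⟨x0, d0, hd0⟩ : ∃ (x0 : V) (d0 : G.Dart), True := by
    obtain ⟨d, _⟩ := Quotient.exists_rep E.outer
    exact ⟨d.fst, d, trivial⟩
  have hker : Module.finrank ℝ (LinearMap.ker Φ) ≤ 2 := by
    have h2 : Module.finrank ℝ (ℝ × ℝ) = 2 := by simp
    rw [← h2]
    let f : LinearMap.ker Φ →ₗ[ℝ] ℝ × ℝ := 
      { toFun := fun p => (p.1.1 x0, p.1.2 (E.dartFace d0))
        map_add' := by intros; rfl
        map_smul' := by intros; rfl }
    refine LinearMap.finrank_le_finrank_of_injective (f := f) ?_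
    rw [← LinearMap.ker_eq_bot, LinearMap.ker_eq_bot']
    rintro ⟨⟨g, h⟩, hm⟩ h0
    have hm' : ∀ d, dl g d + ds E h d = 0 := fun d => congrFun (LinearMap.mem_ker.1 hm) d
    have hs : ∑ d : G.Dart, dl g d * dl g d = 0 := by
      have := dl_ds E g h
      rw [← neg_eq_zero, ← Finset.sum_neg_distrib] at this
      rw [← this]
      refine Finset.sum_congr rfl fun d _ => ?_
      rw [eq_neg_of_add_eq_zero_right (hm' d)]; ring
    have hg : ∀ d : G.Dart, dl g d = 0 := fun d => by
      have := (Finset.sum_eq_zero_iff_of_nonneg (fun d _ => mul_self_nonneg (dl g d))).1 hs d (Finset.mem_univ _)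
      simpa using this
    have hh : ∀ d : G.Dart, ds E h d = 0 := fun d => by have := hm' d; rw [hg d] at this; simpa using this
    have h00 : g x0 = 0 ∧ h (E.dartFace d0) = 0 := by simpa [f] using h0
    have e1 : g = 0 := by funext x; rw [dl_const E hg x x0]; exact h00.1
    have e2 : h = 0 := by
      funext F; rw [dual_const E (fun d => sub_eq_zero.1 (hh d)) F (E.dartFace d0)]; exact h00.2
    simp [e1, e2]
  have hrn := LinearMap.finrank_range_add_finrank_ker Φ
  rw [Module.finrank_prod, Module.finrank_fintype_fun_eq_card, Module.finrank_fintype_fun_eq_card] at hrn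
  have heu := E.euler
  rw [Nat.card_eq_fintype_card, Nat.card_eq_fintype_card] at heu
  have hA := edge_card_anti A (fun ψ h => h)
  have hle : LinearMap.range Φ ≤ A := by
    rintro _ ⟨p, rfl⟩ d
    simp [Φ, dl, ds]; ring
  have heq : LinearMap.range Φ = A := Submodule.eq_of_le_of_finrank_le hle (by
    change Fintype.card V + Fintype.card E.Face = _ at heu
    omega)
  have : ψ ∈ LinearMap.range Φ := by rw [heq]; exact ha
  obtain ⟨p, hp⟩ := this
  exact ⟨p.1, p.2, fun d => (congrFun hp d).symm⟩

lemma cocycle (E : PlaneEmb G) {ψ : G.Dart → ℝ} (ha : ∀ d, ψ d.symm = - ψ d)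
    (hF : ∀ F : E.Face, ∑ d with E.dartFace d = F, ψ d = 0) : ∃ g : V → ℝ, ∀ d : G.Dart, ψ d = g d.snd - g d.fst := by
  obtain ⟨g, h, hgh⟩ := antisym_dec E ha
  refine ⟨g, fun d => ?_⟩
  have h1 : ∑ d, ψ d * h (E.dartFace d) = 0 := by
    rw [← Finset.sum_fiberwise Finset.univ (fun d => E.dartFace d)]
    refine Finset.sum_eq_zero fun F _ => ?_
    have : ∑ d with E.dartFace d = F, ψ d * h (E.dartFace d) = ∑ d with E.dartFace d = F, ψ d * h F :=
      Finset.sum_congr rfl fun d hd => by rw [(Finset.mem_filter.1 hd).2]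
    rw [this, ← Finset.sum_mul, hF, zero_mul]
  have h2 : ∑ d, ds E h d * ds E h d = 0 := by
    have h3 := anti_ds E ha h
    rw [h1, mul_zero] at h3
    have h4 := dl_ds E g h
    simp only [hgh, add_mul, Finset.sum_add_distrib] at h3
    linarith
  have := (Finset.sum_eq_zero_iff_of_nonneg (fun d _ => mul_self_nonneg (ds E h d))).1 h2 d (Finset.mem_univ _)
  rw [hgh d, mul_self_eq_zero.1 this]; simp [dl]

lemma nonbridge (E : PlaneEmb G) {K : SimpleGraph V} (hK : K.Connected) (d0 : G.Dart)
    (hKG : ∀ x y, K.Adj x y → ∃ d : G.Dart, d.fst = x ∧ d.snd = y ∧ d ≠ d0 ∧ d ≠ d0.symm) : E.dartFace d0 ≠ E.dartFace d0.symm := by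
  intro heq
  have hne : d0 ≠ d0.symm := (SimpleGraph.Dart.symm_ne d0).symm
  obtain ⟨g, hg⟩ := cocycle E (ψ := fun d => (if d = d0 then 1 else 0) - (if d = d0.symm then 1 else 0)) (fun d => by
    have h1 : d.symm = d0 ↔ d = d0.symm := ⟨fun h => by rw [← h]; simp, fun h => by rw [h]; simp⟩
    have h2 : d.symm = d0.symm ↔ d = d0 := SimpleGraph.Dart.symm_involutive.injective.eq_iff
    simp [h1, h2]) (fun F => by
    rw [Finset.sum_sub_distrib]
    simp [Finset.sum_ite_eq', heq])
  have hconst : ∀ x, g d0.fst = g x := fun x => conn_cut hK (A := {z | g d0.fst = g z}) ⟨_, rfl⟩ (fun u w huw hu => by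
    obtain ⟨d, rfl, rfl, h1, h2⟩ := hKG u w huw
    have := hg d
    simp [h1, h2] at this
    simp at hu ⊢; linarith) x
  have := hg d0
  simp [hne, ← hconst d0.snd] at this

lemma face_bal (E : PlaneEmb G) (g : V → ℝ) (F : E.Face) : ∑ d with E.dartFace d = F, (g d.snd - g d.fst) = 0 := by
  have := dl_face E g (fun F' => if F' = F then 1 else 0)
  simp only [mul_ite, mul_one, mul_zero] at this
  rw [← this, Finset.sum_filter]; rfl

lemma bond (E : PlaneEmb G) {S : Set V}
    (hS : ∀ A ⊆ S, A.Nonempty → (∀ x ∈ A, ∀ y ∈ S, G.Adj x y → y ∈ A) → A = S)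
    (hI : ∀ A ⊆ Sᶜ, A.Nonempty → (∀ x ∈ A, ∀ y ∈ Sᶜ, G.Adj x y → y ∈ A) → A = Sᶜ)
    {d1 d2 : G.Dart} (h1 : d1.fst ∈ S) (h1' : d1.snd ∉ S) (h2 : d2.fst ∈ S) (h2' : d2.snd ∉ S)
    (hf : E.dartFace d1 = E.dartFace d2) : d1 = d2 := by
  by_contra hne
  let B := {d : G.Dart // d.fst ∈ S ∧ d.snd ∉ S}
  let R := {F : E.Face // ∃ d : B, E.dartFace d.1 = F}
  let ψ : (B → ℝ) → G.Dart → ℝ := fun b d =>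
    (if h : d.fst ∈ S ∧ d.snd ∉ S then b ⟨d, h⟩ else 0) - (if h : d.symm.fst ∈ S ∧ d.symm.snd ∉ S then b ⟨d.symm, h⟩ else 0)
  have hψa : ∀ b d, ψ b d.symm = - ψ b d := by intro b d; simp [ψ]
  let T : (B → ℝ) →ₗ[ℝ] (R → ℝ) := 
    { toFun := fun b F => (∑ d with E.dartFace d = F.1, ψ b d) + b ⟨d1, h1, h1'⟩
      map_add' := by
        intro b b'; funext F
        simp only [Pi.add_apply]
        have : ∀ d, ψ (b + b') d = ψ b d + ψ b' d := by intro d; simp only [ψ, Pi.add_apply]; split_ifs <;> ring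
        simp only [this, Finset.sum_add_distrib]; ring
      map_smul' := by
        intro c b; funext F
        have : ∀ d, ψ (c • b) d = c * ψ b d := by intro d; simp only [ψ, Pi.smul_apply, smul_eq_mul]; split_ifs <;> ring
        simp only [this, ← Finset.mul_sum, Pi.smul_apply, smul_eq_mul, RingHom.id_apply]; ring }
  have hcard : Fintype.card R < Fintype.card B := by
    let f : B → R := fun d => ⟨E.dartFace d.1, d, rfl⟩
    have hfs : Function.Surjective f := by rintro ⟨F, d, rfl⟩; exact ⟨d, rfl⟩
    have := Fintype.card_lt_of_surjective_not_injective f hfs (fun hinj => hne (by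
      have := @hinj ⟨d1, h1, h1'⟩ ⟨d2, h2, h2'⟩ (Subtype.ext hf)
      exact congrArg Subtype.val this))
    exact this
  obtain ⟨b, hb, hb0⟩ : ∃ b, T b = 0 ∧ b ≠ 0 := by
    by_contra hcon
    push Not at hcon
    have hinj : Function.Injective T := by
      rw [← LinearMap.ker_eq_bot, LinearMap.ker_eq_bot']; exact hcon
    have := LinearMap.finrank_le_finrank_of_injective hinj
    rw [Module.finrank_fintype_fun_eq_card, Module.finrank_fintype_fun_eq_card] at this
    omega
  have hoff : ∀ F : E.Face, (¬ ∃ d : B, E.dartFace d.1 = F) → ∀ d, E.dartFace d = F → ψ b d = 0 := by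
    intro F hF
    have hbal := face_bal E (fun x => if x ∈ S then 0 else 1) F
    have hn : ∀ d ∈ Finset.univ.filter (fun d : G.Dart => E.dartFace d = F), 
        0 ≤ -(((if d.snd ∈ S then 0 else 1 : ℝ)) - (if d.fst ∈ S then 0 else 1 : ℝ)) := by
      intro d hd
      have : ¬ (d.fst ∈ S ∧ d.snd ∉ S) := fun h => hF ⟨⟨d, h⟩, (Finset.mem_filter.1 hd).2⟩
      by_cases k1 : d.fst ∈ S <;> by_cases k2 : d.snd ∈ S
      · simp [k1, k2]
      · exact absurd ⟨k1, k2⟩ this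
      · simp [k1, k2]
      · simp [k1, k2]
    rw [← neg_eq_zero, ← Finset.sum_neg_distrib, Finset.sum_eq_zero_iff_of_nonneg hn] at hbal
    intro d hd
    have h3 := hbal d (by simp [hd])
    have : ¬ (d.fst ∈ S ∧ d.snd ∉ S) := fun h => hF ⟨⟨d, h⟩, hd⟩
    have h4 : ¬ (d.symm.fst ∈ S ∧ d.symm.snd ∉ S) := by
      intro h
      have h5 : d.snd ∈ S ∧ d.fst ∉ S := h
      simp [h5.1, h5.2] at h3
    simp only [ψ]
    rw [dif_neg this, dif_neg h4]; simp
  have htot : ∑ F : E.Face, ∑ d with E.dartFace d = F, ψ b d = 0 := by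
    rw [Finset.sum_fiberwise]
    have := sum_symm (ψ b)
    simp only [hψa, Finset.sum_neg_distrib] at this
    linarith
  have hT : ∀ F, (∃ d : B, E.dartFace d.1 = F) → ∑ d with E.dartFace d = F, ψ b d = - b ⟨d1, h1, h1'⟩ := by
    intro F hF
    have : (∑ d with E.dartFace d = F, ψ b d) + b ⟨d1, h1, h1'⟩ = 0 := congrFun hb ⟨F, hF⟩
    linarith
  have hb1 : b ⟨d1, h1, h1'⟩ = 0 := by
    by_contra hb1
    have : ∀ F : E.Face, ∑ d with E.dartFace d = F, ψ b d = (if (∃ d : B, E.dartFace d.1 = F) then 1 else 0) * (- b ⟨d1, h1, h1'⟩) := by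
      intro F
      split_ifs with h
      · rw [hT F h, one_mul]
      · rw [zero_mul]; exact Finset.sum_eq_zero fun d hd => hoff F h d (Finset.mem_filter.1 hd).2
    simp only [this, ← Finset.sum_mul] at htot
    have h3 := (mul_eq_zero.1 htot).resolve_right (by simpa using hb1)
    rw [Finset.sum_eq_zero_iff_of_nonneg (fun F _ => by split_ifs <;> norm_num)] at h3
    have := h3 (E.dartFace d1) (Finset.mem_univ _)
    rw [if_pos ⟨⟨d1, h1, h1'⟩, rfl⟩] at this
    norm_num at this
  obtain ⟨g, hg⟩ := cocycle E (hψa b) (fun F => by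
    by_cases h : ∃ d : B, E.dartFace d.1 = F
    · rw [hT F h, hb1, neg_zero]
    · exact Finset.sum_eq_zero fun d hd => hoff F h d (Finset.mem_filter.1 hd).2)
  have gS : ∀ x ∈ S, g x = g d1.fst := by
    have := hS {x ∈ S | g x = g d1.fst} (fun x h => h.1) ⟨d1.fst, h1, rfl⟩ (fun x hx y hy hxy => ⟨hy, by
      have := hg ⟨(x, y), hxy⟩
      simp only [ψ] at this
      rw [dif_neg (by simp [hy]), dif_neg (by simp [hx.1])] at this
      have h3 := hx.2
      simp at this; linarith⟩)
    intro x hx; rw [← this] at hx; exact hx.2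
  have gI : ∀ x ∈ Sᶜ, g x = g d1.snd := by
    have := hI {x ∈ Sᶜ | g x = g d1.snd} (fun x h => h.1) ⟨d1.snd, h1', rfl⟩ (fun x hx y hy hxy => ⟨hy, by
      have := hg ⟨(x, y), hxy⟩
      simp only [ψ] at this
      have hx1 : x ∉ S := hx.1
      have hy1 : y ∉ S := hy
      rw [dif_neg (by simp [hx1]), dif_neg (by simp [hy1])] at this
      have h3 := hx.2
      simp at this; linarith⟩)
    intro x hx; rw [← this] at hx; exact hx.2
  apply hb0
  have hval : ∀ d : B, b d = g d1.snd - g d1.fst := by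
    rintro ⟨d, hd⟩
    have := hg d
    simp only [ψ] at this
    rw [dif_pos hd, dif_neg (by simp [hd.1]), gS _ hd.1, gI _ hd.2] at this
    linarith
  have h3 := hval ⟨d1, h1, h1'⟩
  funext d
  rw [hval d, ← h3, hb1]; rfl
end plane

section planeY
open scoped Classical
variable {V : Type} [Fintype V] {G : SimpleGraph V} 

def DF (E : PlaneEmb G) (I : Finset V) (F : E.Face) : Prop := ∃ d : G.Dart, d.snd ∈ I ∧ E.dartFace d = F

lemma DF_fst {E : PlaneEmb G} {I : Finset V} {d : G.Dart} (h : d.fst ∈ I) : DF E I (E.dartFace d) := by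
  refine ⟨(E.rot.symm d).symm, ?_, ?_⟩
  · have := E.rot_fst (E.rot.symm d)
    rw [Equiv.apply_symm_apply] at this
    change (E.rot.symm d).fst ∈ I
    rwa [← this]
  · rw [← face_rot, Equiv.apply_symm_apply]

noncomputable def cz (E : PlaneEmb G) (big : G.Dart → Prop) (I : Finset V) (z : V) : ℤ :=
  (Finset.univ.filter (fun d : G.Dart => d.fst = z ∧ d.snd ∉ I ∧ DF E I (E.angleFace d))).card -
  (Finset.univ.filter (fun d : G.Dart => d.fst = z ∧ big d ∧ DF E I (E.angleFace d))).card

lemma rot_back (E : PlaneEmb G) {I : Finset V} {d e : G.Dart} (hd : d.snd ∈ I) (he : e.snd ∉ I) (hf : e.fst = d.fst) :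
    ∃ d0 : G.Dart, d0.fst = d.fst ∧ d0.snd ∉ I ∧ (E.rot d0).snd ∈ I ∧ DF E I (E.angleFace d0) := by
  by_contra hcon
  push Not at hcon
  have := rot_ind E (P := fun e => e.fst = d.fst ∧ e.snd ∉ I) (fun e h => ⟨by rw [E.rot_fst]; exact h.1, fun h' =>
    hcon e h.1 h.2 h' ⟨E.rot e, h', by rw [face_rot]; rfl⟩⟩) ⟨hf, he⟩ hf
  exact this.2 hd

lemma big_card_le {E : PlaneEmb G} {big : G.Dart → Prop} (hc : IsCPTLabelling E big) (I : Finset V) (z : V) :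
    (Finset.univ.filter (fun d : G.Dart => d.fst = z ∧ big d ∧ DF E I (E.angleFace d))).card ≤ 1 := by
  rw [Finset.card_le_one]
  intro d hd d' hd'
  simp only [Finset.mem_filter] at hd hd'
  exact hc.one_big d d' hd.2.2.1 hd'.2.2.1 (hd.2.1.trans hd'.2.1.symm)

lemma cz_nonneg {E : PlaneEmb G} {big : G.Dart → Prop} (hc : IsCPTLabelling E big) {I : Finset V} {z : V}
    (hz : (∃ y ∈ I, G.Adj z y) → ∃ y, y ∉ I ∧ G.Adj z y) : 0 ≤ cz E big I z := by
  unfold cz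
  have h1 := big_card_le hc I z
  by_cases h0 : (Finset.univ.filter (fun d : G.Dart => d.fst = z ∧ big d ∧ DF E I (E.angleFace d))).card = 0
  · rw [h0]; simp
  · obtain ⟨d, hd⟩ := Finset.card_pos.1 (Nat.pos_of_ne_zero h0)
    simp only [Finset.mem_filter, Finset.mem_univ, true_and] at hd
    have : 1 ≤ (Finset.univ.filter (fun d : G.Dart => d.fst = z ∧ d.snd ∉ I ∧ DF E I (E.angleFace d))).card := by
      apply Finset.card_pos.2
      by_cases hs : d.snd ∈ I
      · obtain ⟨y, hy, hzy⟩ := hz ⟨d.snd, hs, by rw [← hd.1]; exact d.adj⟩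
        obtain ⟨d0, h1, h2, h3, h4⟩ := rot_back E (e := ⟨(z, y), hzy⟩) hs hy hd.1.symm
        exact ⟨d0, by simp [h1, h2, h4, hd.1]⟩
      · exact ⟨d, by simp [hs, hd.1, hd.2.2]⟩
    omega

lemma cz_pos {E : PlaneEmb G} {big : G.Dart → Prop} {I : Finset V} {z y y' : V} (hnp : ¬ PointedVx big z) (hy : y ∈ I)
    (h1 : G.Adj z y) (hy' : y' ∉ I) (h2 : G.Adj z y') : 1 ≤ cz E big I z := by
  unfold cz
  have : (Finset.univ.filter (fun d : G.Dart => d.fst = z ∧ big d ∧ DF E I (E.angleFace d))) = ∅ := by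
    rw [Finset.filter_eq_empty_iff]
    rintro d _ ⟨h1, h2, _⟩
    exact hnp ⟨d, h2, h1⟩
  rw [this, Finset.card_empty]
  obtain ⟨d0, h1, h2, h3, h4⟩ := rot_back E (d := ⟨(z, y), h1⟩) (e := ⟨(z, y'), h2⟩) hy hy' rfl
  have := Finset.card_pos.2 ⟨d0, (by simp [h2, h4]; exact h1 : d0 ∈ Finset.univ.filter (fun d : G.Dart => d.fst = z ∧ d.snd ∉ I ∧ DF E I (E.angleFace d)))⟩
  omega

lemma cz_zero_no {E : PlaneEmb G} {big : G.Dart → Prop} (hc : IsCPTLabelling E big) {I : Finset V} {z : V} 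
    (h0 : cz E big I z ≤ 0) {d : G.Dart} (hd : d.fst = z) (hs : ¬ big d)
    (h1 : d.snd ∉ I) (h2 : (E.rot d).snd ∉ I) : ¬ DF E I (E.angleFace d) := by
  intro hD
  unfold cz at h0
  have hb := big_card_le hc I z
  have hm : d ∈ Finset.univ.filter (fun d : G.Dart => d.fst = z ∧ d.snd ∉ I ∧ DF E I (E.angleFace d)) := by simp [hd, h1, hD]
  have hp := Finset.card_pos.2 ⟨d, hm⟩
  obtain ⟨d1, hd1⟩ := Finset.card_pos.1 (by omega : 0 < (Finset.univ.filter (fun d : G.Dart => d.fst = z ∧ big d ∧ DF E I (E.angleFace d))).card)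
  simp only [Finset.mem_filter, Finset.mem_univ, true_and] at hd1
  obtain ⟨d', hd', hne⟩ : ∃ d' ∈ Finset.univ.filter (fun d : G.Dart => d.fst = z ∧ d.snd ∉ I ∧ DF E I (E.angleFace d)), d ≠ d' := by
    by_cases hs1 : d1.snd ∈ I
    · obtain ⟨d0, k1, k2, k3, k4⟩ := rot_back E (e := d) hs1 h1 (hd.trans hd1.1.symm)
      exact ⟨d0, by simp [k1, k2, k4, hd1.1], fun h => h2 (h ▸ k3)⟩
    · exact ⟨d1, by simp [hs1, hd1.1, hd1.2.2], fun h => hs (h ▸ hd1.2.1)⟩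
  have := Finset.one_lt_card.2 ⟨d, hm, d', hd', hne⟩
  omega

def EI (G : SimpleGraph V) (I : Finset V) : Set (Sym2 V) := {e ∈ G.edgeSet | ∃ x ∈ e, x ∈ I}

lemma EI_darts (I : Finset V) : (Finset.univ.filter (fun d : G.Dart => d.fst ∈ I ∨ d.snd ∈ I)).card = 2 * (EI G I).ncard := by
  rw [Set.ncard_eq_toFinset_card', Finset.card_eq_sum_card_fiberwise (f := fun d : G.Dart => d.edge) (t := (EI G I).toFinset)]
  · rw [Finset.sum_const_nat (m := 2), mul_comm]
    intro e he
    rw [Set.mem_toFinset] at he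
    rw [← SimpleGraph.dart_edge_fiber_card (G := G) e he.1]
    congr 1
    ext d
    simp only [Finset.mem_filter, Finset.mem_univ, true_and, and_iff_right_iff_imp]
    rintro rfl
    obtain ⟨x, hx, hxI⟩ := he.2
    have : x ∈ s(d.fst, d.snd) := hx
    rw [Sym2.mem_iff] at this
    rcases this with rfl | rfl
    · exact Or.inl hxI
    · exact Or.inr hxI
  · intro d hd
    simp at hd
    simp only [Set.coe_toFinset]
    refine ⟨d.edge_mem, ?_⟩
    rcases hd with h | h
    · exact ⟨d.fst, Sym2.mem_mk_left _ _, h⟩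
    · exact ⟨d.snd, Sym2.mem_mk_right _ _, h⟩

lemma Y_count (E : PlaneEmb G) {I : Finset V} {z0 : V} (hz0 : z0 ∉ I)
    (hI : ∀ B ⊆ I, B.Nonempty → (∀ x ∈ B, ∀ y ∈ I, G.Adj x y → y ∈ B) → ∃ d : G.Dart, d.fst ∈ B ∧ E.dartFace d = E.outer) :
    I.card + (Finset.univ.filter (fun F => DF E I F ∧ F ≠ E.outer)).card ≤ (EI G I).ncard := by
  let D := {F // DF E I F ∧ F ≠ E.outer}
  have hex : ∀ e : EI G I, ∃ d : G.Dart, d.edge = e := by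
    rintro ⟨⟨x, y⟩, h⟩; exact ⟨⟨(x, y), h.1⟩, rfl⟩
  choose o ho using hex
  let ge : (I → ℝ) → V → ℝ := fun g x => if h : x ∈ I then g ⟨x, h⟩ else 0
  let he : (D → ℝ) → E.Face → ℝ := fun g x => if h : DF E I x ∧ x ≠ E.outer then g ⟨x, h⟩ else 0
  let Φ : ((I → ℝ) × (D → ℝ)) →ₗ[ℝ] (EI G I → ℝ) := 
    { toFun := fun p e => dl (ge p.1) (o e) + ds E (he p.2) (o e)
      map_add' := by intros; funext e; simp only [dl, ds, ge, he, Prod.fst_add, Prod.snd_add, Pi.add_apply]; split_ifs <;> ring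
      map_smul' := by intros; funext e; simp only [dl, ds, ge, he, Prod.smul_fst, Prod.smul_snd, Pi.smul_apply, smul_eq_mul, RingHom.id_apply]; split_ifs <;> ring }
  have hinj : Function.Injective Φ := by
    rw [← LinearMap.ker_eq_bot, LinearMap.ker_eq_bot']
    rintro ⟨g, h⟩ h0
    have hm : ∀ d : G.Dart, d.fst ∈ I ∨ d.snd ∈ I → dl (ge g) d + ds E (he h) d = 0 := by
      intro d hd
      have hdE : d.edge ∈ EI G I := by
        refine ⟨d.edge_mem, ?_⟩
        rcases hd with h | h
        · exact ⟨d.fst, Sym2.mem_mk_left _ _, h⟩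
        · exact ⟨d.snd, Sym2.mem_mk_right _ _, h⟩
      have h1 : dl (ge g) (o ⟨d.edge, hdE⟩) + ds E (he h) (o ⟨d.edge, hdE⟩) = 0 := congrFun h0 ⟨d.edge, hdE⟩
      rcases SimpleGraph.dart_edge_eq_iff _ _ |>.1 (ho ⟨d.edge, hdE⟩) with h | h
      · rwa [h] at h1
      · rw [h] at h1; simp [dl, ds] at h1 ⊢; linarith
    have hdl0 : ∀ d : G.Dart, ¬ (d.fst ∈ I ∨ d.snd ∈ I) → dl (ge g) d = 0 := by
      intro d hd; push Not at hd; simp [dl, ge, hd.1, hd.2]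
    have hs : ∑ d : G.Dart, dl (ge g) d * dl (ge g) d = 0 := by
      have := dl_ds E (ge g) (he h)
      rw [← neg_eq_zero, ← Finset.sum_neg_distrib] at this
      rw [← this]
      refine Finset.sum_congr rfl fun d _ => ?_
      by_cases hd : d.fst ∈ I ∨ d.snd ∈ I
      · rw [eq_neg_of_add_eq_zero_right (hm d hd)]; ring
      · rw [hdl0 d hd]; ring
    have hg : ∀ d : G.Dart, dl (ge g) d = 0 := fun d => by
      have := (Finset.sum_eq_zero_iff_of_nonneg (fun d _ => mul_self_nonneg (dl (ge g) d))).1 hs d (Finset.mem_univ _)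
      simpa using this
    have e1 : g = 0 := by
      funext x
      have := dl_const E hg x z0
      simpa [ge, hz0] using this
    have hh : ∀ d : G.Dart, d.fst ∈ I ∨ d.snd ∈ I → he h (E.dartFace d) = he h (E.dartFace d.symm) := fun d hd => by
      have := hm d hd; rw [hg d] at this; simpa [ds, sub_eq_zero] using this
    have key : ∀ e e' : G.Dart, e.fst ∈ I → e.fst = e'.fst → he h (E.dartFace e) = he h (E.dartFace e') := by
      intro e e' hI hee
      refine (rot_ind E (P := fun e' => e'.fst = e.fst ∧ he h (E.dartFace e) = he h (E.dartFace e')) (fun e' h' => ⟨?_, ?_⟩) ⟨rfl, rfl⟩ hee).2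
      · rw [E.rot_fst]; exact h'.1
      · rw [h'.2, face_rot]; exact hh e' (Or.inl (h'.1 ▸ hI))
    have hall : ∀ x ∈ I, ∀ e : G.Dart, e.fst = x → he h (E.dartFace e) = 0 := by
      intro x hx e hex
      by_contra hne
      obtain ⟨d, hd1, hd2⟩ := hI (I.filter (fun x => ∃ e : G.Dart, e.fst = x ∧ he h (E.dartFace e) ≠ 0)) (Finset.filter_subset _ _)
        ⟨x, by simp only [Finset.mem_filter]; exact ⟨hx, e, hex, hne⟩⟩ (by
        intro x hx y hy hxy
        rw [Finset.mem_filter] at hx ⊢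
        obtain ⟨hxI, e, rfl, hne⟩ := hx
        refine ⟨hy, ⟨(y, e.fst), hxy.symm⟩, rfl, ?_⟩
        have h1 := key e ⟨(e.fst, y), hxy⟩ hxI rfl
        have h2 := hh ⟨(e.fst, y), hxy⟩ (Or.inl hxI)
        rw [h1, h2] at hne; exact hne)
      rw [Finset.mem_filter] at hd1
      obtain ⟨hdI, e', he1, he2⟩ := hd1
      apply he2
      rw [key e' d (by rw [he1]; exact hdI) he1, hd2]
      simp [he]
    have e2 : h = 0 := by
      funext ⟨F, ⟨d, hdI, hdF⟩, hout⟩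
      subst hdF
      have h1 := hall d.snd hdI d.symm rfl
      rw [← hh d (Or.inr hdI)] at h1
      have h3 : DF E I (E.dartFace d) ∧ E.dartFace d ≠ E.outer := ⟨⟨d, hdI, rfl⟩, hout⟩
      simp only [he] at h1
      rw [dif_pos h3] at h1
      exact h1
    rw [e1, e2]; rfl
  have := LinearMap.finrank_le_finrank_of_injective hinj
  rw [Module.finrank_prod, Module.finrank_fintype_fun_eq_card, Module.finrank_fintype_fun_eq_card, Module.finrank_fintype_fun_eq_card] at this
  rw [← Nat.card_coe_set_eq, Nat.card_eq_fintype_card, ← Fintype.card_subtype]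
  simpa using this
end planeY

section planeY2
open scoped Classical
variable {V : Type} [Fintype V] {G : SimpleGraph V} 

lemma smalls {E : PlaneEmb G} {big : G.Dart → Prop} (hc : IsCPTLabelling E big) (P : E.Face → Prop) (ho : P E.outer) :
    3 * (Finset.univ.filter (fun F => P F ∧ F ≠ E.outer)).card + (Finset.univ.filter (fun d : G.Dart => big d ∧ P (E.angleFace d))).card
      = (Finset.univ.filter (fun d : G.Dart => P (E.angleFace d))).card := by
  have h1 : (Finset.univ.filter (fun d : G.Dart => ¬ big d ∧ P (E.angleFace d))).card = 
      3 * (Finset.univ.filter (fun F => P F ∧ F ≠ E.outer)).card := by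
    rw [Finset.card_eq_sum_card_fiberwise (f := fun d : G.Dart => E.angleFace d) (t := Finset.univ.filter (fun F => P F ∧ F ≠ E.outer)), Finset.sum_const_nat (m := 3), mul_comm]
    · intro F hF
      simp only [Finset.mem_filter, Finset.mem_univ, true_and] at hF
      rw [← hc.bounded_small F hF.2, Nat.card_eq_fintype_card, Fintype.card_subtype]
      congr 1
      ext d
      simp only [Finset.mem_filter, Finset.mem_univ, true_and, Set.mem_setOf_eq]
      constructor
      · rintro ⟨⟨h1, h2⟩, h3⟩; exact ⟨h3, h1⟩
      · rintro ⟨h1, h2⟩; exact ⟨⟨h2, h1 ▸ hF.1⟩, h1⟩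
    · intro d hd
      simp at hd ⊢
      exact ⟨hd.2, fun h => hd.1 (hc.outer_big d h)⟩
  rw [← h1, ← Finset.card_union_of_disjoint]
  · congr 1; ext d; simp; tauto
  · rw [Finset.disjoint_left]; intro d h1 h2; simp at h1 h2; tauto

lemma sum_wt {E : PlaneEmb G} {big : G.Dart → Prop} (hc : IsCPTLabelling E big) (I : Finset V) :
    ∑ z ∈ I, wt big z = 3 * I.card - (Finset.univ.filter (fun d : G.Dart => big d ∧ d.fst ∈ I)).card := by
  have : (Finset.univ.filter (fun d : G.Dart => big d ∧ d.fst ∈ I)).card = (I.filter (fun z => PointedVx big z)).card := by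
    apply Finset.card_bij (fun d _ => d.fst)
    · intro d hd; simp at hd ⊢; exact ⟨hd.2, d, hd.1, rfl⟩
    · intro d hd d' hd' h; simp at hd hd'; exact hc.one_big d d' hd.1 hd'.1 h
    · intro z hz; simp at hz; obtain ⟨d, h1, h2⟩ := hz.2
      exact ⟨d, by simp [h1, h2, hz.1], h2⟩
  rw [this, Finset.card_filter]
  push_cast
  rw [← nsmul_eq_mul', ← Finset.sum_const, ← Finset.sum_sub_distrib]
  refine Finset.sum_congr rfl fun z _ => ?_
  unfold wt; split_ifs <;> norm_num

lemma slk_univ {E : PlaneEmb G} {big : G.Dart → Prop} (hc : IsCPTLabelling E big) : slk G (wt big) Finset.univ = 0 := by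
  have h1 : 3 * (Finset.univ.filter (fun F : E.Face => True ∧ F ≠ E.outer)).card + (Finset.univ.filter (fun d : G.Dart => big d ∧ d.fst ∈ (Finset.univ : Finset V))).card = (Finset.univ : Finset G.Dart).card := by
    have := smalls hc (fun _ => True) trivial
    convert this using 3 <;> simp
  have h2 := sum_wt hc Finset.univ
  have h3 := EI_darts (G := G) Finset.univ
  have h4 : EI G Finset.univ = ES G Finset.univ := by
    ext ⟨x, y⟩
    simp [EI, ES, Sym2.exists]
  have h5 : Nat.card V + Nat.card E.Face = _ := E.euler
  have h6 : Nat.card E.Face = (Finset.univ.filter (fun F : E.Face => True ∧ F ≠ E.outer)).card + 1 := by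
    simp only [true_and]
    rw [Finset.filter_ne' Finset.univ E.outer, Finset.card_erase_of_mem (Finset.mem_univ _), Finset.card_univ, Nat.card_eq_fintype_card]
    have : 0 < Fintype.card E.Face := Fintype.card_pos_iff.2 ⟨E.outer⟩
    omega
  rw [h6, ← ec_univ] at h5
  have hV : (Finset.univ : Finset V).card = Nat.card V := by rw [Nat.card_eq_fintype_card, Finset.card_univ]
  unfold slk
  rw [h2, hV]
  rw [h4, Finset.filter_true_of_mem (by intros; simp)] at h3
  change _ = 2 * ec G Finset.univ at h3
  omega

lemma lemY {E : PlaneEmb G} {big : G.Dart → Prop} (hc : IsCPTLabelling E big) {I A : Finset V} (hne : I.Nonempty)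
    (hI : ∀ B ⊆ I, B.Nonempty → (∀ x ∈ B, ∀ y ∈ I, G.Adj x y → y ∈ B) → ∃ d : G.Dart, d.fst ∈ B ∧ E.dartFace d = E.outer)
    (hA : A.Nonempty) (hd : Disjoint A I) (hno : ∀ x ∈ I, ∀ y, G.Adj x y → y ∈ A ∪ I) :
    slk G (wt big) (A ∪ I) + ∑ z ∈ Iᶜ, cz E big I z ≤ slk G (wt big) A := by
  obtain ⟨z0, hz0⟩ := hA
  have h1 := Y_count E (Finset.disjoint_left.1 hd hz0) hI
  have ho : DF E I E.outer := by
    obtain ⟨d, h1, h2⟩ := hI I subset_rfl hne (fun _ _ y hy _ => hy)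
    rw [← h2]; exact DF_fst h1
  have h2 := smalls hc (DF E I) ho
  have h3 := sum_wt hc I
  have h4 := EI_darts (G := G) I
  have h5 : ec G (A ∪ I) = ec G A + (EI G I).ncard := by
    unfold ec
    rw [← Set.ncard_union_eq]
    · congr 1
      ext ⟨x, y⟩
      simp only [Set.mem_union]
      change s(x, y) ∈ _ ↔ s(x, y) ∈ _ ∨ s(x, y) ∈ _
      rw [mem_ES, mem_ES]
      simp only [EI, Set.mem_setOf_eq, SimpleGraph.mem_edgeSet, Sym2.mem_iff]
      constructor
      · rintro ⟨h1, h2, h3⟩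
        by_cases hx : x ∈ I
        · exact Or.inr ⟨h1, x, Or.inl rfl, hx⟩
        · by_cases hy : y ∈ I
          · exact Or.inr ⟨h1, y, Or.inr rfl, hy⟩
          · simp [hx, hy] at h2 h3; exact Or.inl ⟨h1, h2, h3⟩
      · rintro (⟨h1, h2, h3⟩ | ⟨h1, z, rfl | rfl, h3⟩)
        · exact ⟨h1, Finset.mem_union_left _ h2, Finset.mem_union_left _ h3⟩
        · exact ⟨h1, Finset.mem_union_right _ h3, hno _ h3 _ h1⟩
        · exact ⟨h1, hno _ h3 _ h1.symm, Finset.mem_union_right _ h3⟩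
    · rw [Set.disjoint_left]
      rintro e h1 ⟨_, x, h2, h3⟩
      exact Finset.disjoint_left.1 hd (h1.2 x h2) h3
  have h6 : (Finset.univ.filter (fun d : G.Dart => DF E I (E.angleFace d))).card = (Finset.univ.filter (fun d : G.Dart => d.fst ∈ I ∨ d.snd ∈ I)).card
     + ∑ z ∈ Iᶜ, (Finset.univ.filter (fun d : G.Dart => d.fst = z ∧ d.snd ∉ I ∧ DF E I (E.angleFace d))).card := by
    have e1 : ∑ z ∈ Iᶜ, (Finset.univ.filter (fun d : G.Dart => d.fst = z ∧ d.snd ∉ I ∧ DF E I (E.angleFace d))).card =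
      (Finset.univ.filter (fun d : G.Dart => d.fst ∉ I ∧ d.snd ∉ I ∧ DF E I (E.angleFace d))).card := by
      rw [Finset.card_eq_sum_card_fiberwise (f := fun d : G.Dart => d.fst) (t := Iᶜ)]
      · refine Finset.sum_congr rfl fun z hz => ?_
        congr 1; ext d; simp at hz ⊢
        constructor
        · rintro ⟨rfl, h⟩; exact ⟨⟨hz, h⟩, rfl⟩
        · rintro ⟨⟨_, h⟩, rfl⟩; exact ⟨rfl, h⟩
      · intro d hd; simp at hd ⊢; exact hd.1
    rw [e1, ← Finset.card_union_of_disjoint]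
    · congr 1; ext d
      simp only [Finset.mem_filter, Finset.mem_univ, true_and, Finset.mem_union]
      constructor
      · intro h; tauto
      · rintro ((h | h) | h)
        · exact ⟨d.symm, h, rfl⟩
        · exact DF_fst (d := d.symm) h
        · exact h.2.2
    · rw [Finset.disjoint_left]; intro d h1 h2; simp at h1 h2; tauto
  have h7 : (Finset.univ.filter (fun d : G.Dart => big d ∧ DF E I (E.angleFace d))).card = (Finset.univ.filter (fun d : G.Dart => big d ∧ d.fst ∈ I)).card
     + ∑ z ∈ Iᶜ, (Finset.univ.filter (fun d : G.Dart => d.fst = z ∧ big d ∧ DF E I (E.angleFace d))).card := by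
    have e1 : ∑ z ∈ Iᶜ, (Finset.univ.filter (fun d : G.Dart => d.fst = z ∧ big d ∧ DF E I (E.angleFace d))).card =
      (Finset.univ.filter (fun d : G.Dart => d.fst ∉ I ∧ big d ∧ DF E I (E.angleFace d))).card := by
      rw [Finset.card_eq_sum_card_fiberwise (f := fun d : G.Dart => d.fst) (t := Iᶜ)]
      · refine Finset.sum_congr rfl fun z hz => ?_
        congr 1; ext d; simp at hz ⊢
        constructor
        · rintro ⟨rfl, h⟩; exact ⟨⟨hz, h⟩, rfl⟩
        · rintro ⟨⟨_, h⟩, rfl⟩; exact ⟨rfl, h⟩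
      · intro d hd; simp at hd ⊢; exact hd.1
    rw [e1, ← Finset.card_union_of_disjoint]
    · congr 1; ext d
      simp only [Finset.mem_filter, Finset.mem_univ, true_and, Finset.mem_union]
      constructor
      · intro h; tauto
      · rintro (h | h)
        · exact ⟨h.1, d.symm, h.2, rfl⟩
        · exact h.2
    · rw [Finset.disjoint_left]; intro d h1 h2; simp at h1 h2; tauto
  unfold slk cz
  rw [Finset.sum_sub_distrib, Finset.sum_union hd, h5]
  push_cast
  zify at h1 h2 h4 h6 h7
  linarith
end planeY2

section P2
open scoped Classical
variable {V : Type} [Fintype V] {K : SimpleGraph V} 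

def Outv (E : PlaneEmb K) (x : V) : Prop := ∃ d : K.Dart, d.fst = x ∧ E.dartFace d = E.outer

lemma outv_pair (E : PlaneEmb K) : ∃ d : K.Dart, E.dartFace d = E.outer ∧ Outv E d.fst ∧ Outv E d.snd := by
  obtain ⟨d, hd⟩ := Quotient.exists_rep E.outer
  have hd : E.dartFace d = E.outer := hd
  exact ⟨d, hd, ⟨d, rfl, hd⟩, fac E d, by rw [fac_apply, E.rot_fst]; rfl, by rw [face_fac, hd]⟩

noncomputable def Rch (E : PlaneEmb K) (B : Finset V) : Finset V :=
  Finset.univ.filter (fun x => ∃ o, Outv E o ∧ o ∉ B ∧ Relation.ReflTransGen (fun x y => K.Adj x y ∧ y ∉ B) o x)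

lemma Rch_step {E : PlaneEmb K} {B : Finset V} {x y : V} (hx : x ∈ Rch E B) (h : K.Adj x y) (hy : y ∉ B) : y ∈ Rch E B := by
  simp only [Rch, Finset.mem_filter, Finset.mem_univ, true_and] at *
  obtain ⟨o, h1, h2, h3⟩ := hx
  exact ⟨o, h1, h2, h3.tail ⟨h, hy⟩⟩

lemma Rch_out {E : PlaneEmb K} {B : Finset V} {o : V} (h : Outv E o) (hy : o ∉ B) : o ∈ Rch E B := by
  simp only [Rch, Finset.mem_filter, Finset.mem_univ, true_and]
  exact ⟨o, h, hy, .refl⟩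

lemma Rch_disj {E : PlaneEmb K} {B : Finset V} {x : V} (hx : x ∈ Rch E B) : x ∉ B := by
  simp only [Rch, Finset.mem_filter, Finset.mem_univ, true_and] at hx
  obtain ⟨o, h1, h2, h3⟩ := hx
  rcases h3.cases_tail with h | ⟨y, _, h⟩
  · rwa [h]
  · exact h.2

lemma Rch_hI (E : PlaneEmb K) (B : Finset V) : ∀ A ⊆ Rch E B, A.Nonempty → (∀ x ∈ A, ∀ y ∈ Rch E B, K.Adj x y → y ∈ A) → ∃ d : K.Dart, d.fst ∈ A ∧ E.dartFace d = E.outer := by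
  rintro A hA ⟨x, hx⟩ hcl
  have := hA hx
  simp only [Rch, Finset.mem_filter, Finset.mem_univ, true_and] at this
  obtain ⟨o, h1, h2, h3⟩ := this
  have key : ∀ x, Relation.ReflTransGen (fun x y => K.Adj x y ∧ y ∉ B) o x → x ∈ A → o ∈ A := by
    intro x h
    induction h with
    | refl => exact id
    | tail h1 h2 ih => exact fun hc => ih (hcl _ hc _ (by
        simp only [Rch, Finset.mem_filter, Finset.mem_univ, true_and]; exact ⟨o, ‹_›, ‹_›, h1⟩) h2.1.symm)
  obtain ⟨d, rfl, hd⟩ := h1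
  exact ⟨d, key x h3 hx, hd⟩

lemma tight_conn {M : SimpleGraph V} {B X : Finset V} (ht : slk M c2 B = 0) (hs : ∀ S ⊆ B, 2 ≤ S.card → 0 ≤ slk M c2 S)
    (hX : X ⊆ B) (hne : X.Nonempty) (hne' : (B \ X).Nonempty) : ∃ x ∈ X, ∃ y ∈ B \ X, M.Adj x y := by
  by_contra hcon
  push Not at hcon
  have h1 := ec_union_inter_eq M X (B \ X) (fun x y h hx _ hy => absurd h (hcon x hx y hy))
  rw [Finset.union_sdiff_of_subset hX, Finset.inter_sdiff_self, ec_empty] at h1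
  have key : ∀ S ⊆ B, S.Nonempty → (ec M S : ℤ) ≤ 2 * S.card - 2 := by
    intro S hS hne
    by_cases h : 2 ≤ S.card
    · have := hs S hS h; rw [slk_c2] at this; omega
    · have h' : S.card = 1 := by have := hne.card_pos; omega
      obtain ⟨x, rfl⟩ := Finset.card_eq_one.1 h'
      rw [ec_singleton]; simp
  have h2 := key X hX hne
  have h3 := key (B \ X) Finset.sdiff_subset hne'
  rw [slk_c2] at ht
  have := Finset.card_sdiff_add_card_eq_card hX
  omega

lemma ec_blocks {J : SimpleGraph V} {T : Finset V} (BB : Finset (Finset V)) (hT : ∀ B ∈ BB, B ⊆ T)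
    (hcov : ∀ x ∈ T, ∀ y ∈ T, J.Adj x y → ∃ B ∈ BB, x ∈ B ∧ y ∈ B)
    (hd : ∀ B ∈ BB, ∀ B' ∈ BB, ∀ x y, x ≠ y → x ∈ B → y ∈ B → x ∈ B' → y ∈ B' → B = B') :
    ec J T = ∑ B ∈ BB, ec J B := by
  have : (ES J T).toFinset = BB.biUnion (fun B => (ES J B).toFinset) := by
    ext ⟨x, y⟩
    change s(x, y) ∈ _ ↔ s(x, y) ∈ _
    simp only [Set.mem_toFinset, Finset.mem_biUnion, mem_ES]
    constructor
    · rintro ⟨h1, h2, h3⟩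
      obtain ⟨B, hB, h⟩ := hcov x h2 y h3 h1
      exact ⟨B, hB, h1, h⟩
    · rintro ⟨B, hB, h1, h2, h3⟩; exact ⟨h1, hT B hB h2, hT B hB h3⟩
  unfold ec
  rw [Set.ncard_eq_toFinset_card', this, Finset.card_biUnion]
  · exact Finset.sum_congr rfl fun B _ => (Set.ncard_eq_toFinset_card' _).symm
  · intro B hB B' hB' hne
    refine Finset.disjoint_left.2 ?_
    rintro ⟨x, y⟩ h1 h2
    change s(x, y) ∈ _ at h1
    change s(x, y) ∈ _ at h2
    rw [Set.mem_toFinset, mem_ES] at h1 h2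
    exact hne (hd B hB B' hB' x y h1.1.ne h1.2.1 h1.2.2 h2.2.1 h2.2.2)

lemma exists_max_sparse (K : SimpleGraph V) (T : Finset V) : ∃ M ≤ K, (∀ S ⊆ T, 2 ≤ S.card → 0 ≤ slk M c2 S) ∧
    ∀ x ∈ T, ∀ y ∈ T, K.Adj x y → ∃ B ⊆ T, 2 ≤ B.card ∧ slk M c2 B = 0 ∧ x ∈ B ∧ y ∈ B := by
  obtain ⟨M, hM⟩ := Set.Finite.exists_maximal (s := {M : SimpleGraph V | M ≤ K ∧ ∀ S ⊆ T, 2 ≤ S.card → 0 ≤ slk M c2 S}) (Set.toFinite _)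
    ⟨⊥, bot_le, fun S _ h => by
      rw [slk_c2]
      have : ec (⊥ : SimpleGraph V) S = 0 := by unfold ec ES; simp
      omega⟩
  refine ⟨M, hM.1.1, hM.1.2, fun x hx y hy hxy => ?_⟩
  by_cases hM' : M.Adj x y
  · have hc : ({x, y} : Finset V).card = 2 := Finset.card_pair hxy.ne
    refine ⟨{x, y}, by simp [Finset.insert_subset_iff, hx, hy], hc.ge, ?_, by simp, by simp⟩
    rw [slk_c2, ec_pair M hM', hc]; norm_num
  · by_contra hcon
    push Not at hcon
    have := hM.2 (y := M ⊔ SimpleGraph.fromEdgeSet {s(x, y)}) ⟨?_, ?_⟩ le_sup_left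
    · exact hM' (this (by simp [hxy.ne]))
    · refine sup_le hM.1.1 ?_
      intro u w h
      simp at h
      rcases h.1 with ⟨rfl, rfl⟩ | ⟨rfl, rfl⟩
      · exact hxy
      · exact hxy.symm
    · intro S hS h2
      have h3 := hM.1.2 S hS h2
      rw [slk_c2] at h3 ⊢
      rw [ec_add_edge M hxy.ne hM']
      split_ifs with h
      · by_contra hlt
        exact hcon S hS h2 (by rw [slk_c2]; push_cast at hlt; omega) h.1 h.2
      · simpa using h3

lemma lemP2 {E : PlaneEmb K} {big : K.Dart → Prop} (hc : IsCPTLabelling E big) (hs : Spr K (wt big))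
    (h2c : ∀ (z b : V) (A : Set V), A.Nonempty → z ∉ A → b ≠ z → b ∉ A → ∃ x ∈ A, ∃ y, y ∉ A ∧ y ≠ z ∧ K.Adj x y)
    {T : Finset V} (hT2 : 2 ≤ T.card) (hT : slk K (wt big) T = 0) :
    ∃ M ≤ K, slk M c2 T = 0 ∧ ∀ S ⊆ T, 2 ≤ S.card → 0 ≤ slk M c2 S := by
  obtain ⟨M, hMK, hsp, hmax⟩ := exists_max_sparse K T
  refine ⟨M, hMK, ?_, hsp⟩
  by_contra hne
  have hM1 : 1 ≤ slk M c2 T := by have := hsp T subset_rfl hT2; omega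
  let tt : Finset (Finset V) := T.powerset.filter (fun B => 2 ≤ B.card ∧ slk M c2 B = 0)
  have htt : ∀ B, B ∈ tt ↔ B ⊆ T ∧ 2 ≤ B.card ∧ slk M c2 B = 0 := by intro B; simp [tt]
  let BB := tt.filter (fun B => ∀ B' ∈ tt, B ⊆ B' → B' = B)
  have hBB : ∀ B, B ∈ BB ↔ B ∈ tt ∧ ∀ B' ∈ tt, B ⊆ B' → B' = B := by intro B; simp [BB]
  have hBT : ∀ B ∈ BB, B ⊆ T := fun B hB => ((htt B).1 ((hBB B).1 hB).1).1
  have hd : ∀ B ∈ BB, ∀ B' ∈ BB, ∀ x y, x ≠ y → x ∈ B → y ∈ B → x ∈ B' → y ∈ B' → B = B' := by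
    intro B hB B' hB' x y hxy h1 h2 h3 h4
    rw [hBB] at hB hB'
    have k1 := (htt B).1 hB.1
    have k2 := (htt B').1 hB'.1
    have hi : 2 ≤ (B ∩ B').card := Finset.one_lt_card.2 ⟨x, by simp [h1, h3], y, by simp [h2, h4], hxy⟩
    have hu : 2 ≤ (B ∪ B').card := hi.trans (Finset.card_le_card Finset.inter_subset_union)
    have hUT : B ∪ B' ⊆ T := Finset.union_subset k1.1 k2.1
    have : B ∪ B' ∈ tt := (htt _).2 ⟨hUT, hu, by
      have := slk_union_inter M c2 B B'
      have := hsp _ hUT hu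
      have := hsp _ (Finset.inter_subset_left.trans k1.1) hi
      omega⟩
    rw [← hB.2 _ this Finset.subset_union_left, hB'.2 _ this Finset.subset_union_right]
  have hcov : ∀ x ∈ T, ∀ y ∈ T, K.Adj x y → ∃ B ∈ BB, x ∈ B ∧ y ∈ B := by
    intro x hx y hy hxy
    obtain ⟨B, hB1, hB2, hB3, hB4, hB5⟩ := hmax x hx y hy hxy
    obtain ⟨B', hB'⟩ := tt.exists_le_maximal ((htt B).2 ⟨hB1, hB2, hB3⟩)
    refine ⟨B', (hBB _).2 ⟨hB'.2.1, fun B'' h1 h2 => ?_⟩, hB'.1 hB4, hB'.1 hB5⟩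
    exact le_antisymm (hB'.2.2 h1 h2) h2
  have eK := ec_blocks (J := K) BB hBT hcov hd
  have eM := ec_blocks (J := M) BB hBT (fun x hx y hy h => hcov x hx y hy (hMK h)) hd
  have hcon : ∀ B ∈ BB, ∀ X ⊆ B, X.Nonempty → (B \ X).Nonempty → ∃ x ∈ X, ∃ y ∈ B \ X, K.Adj x y := by
    intro B hB X hX h1 h2
    have k1 := (htt B).1 ((hBB B).1 hB).1
    obtain ⟨x, hx, y, hy, h⟩ := tight_conn k1.2.2 (fun S hS => hsp S (hS.trans k1.1)) hX h1 h2
    exact ⟨x, hx, y, hy, hMK h⟩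
  have hother : ∀ B ∈ BB, ∀ z ∈ B, ∃ y ∈ B, y ≠ z := by
    intro B hB z hz
    have k1 := (htt B).1 ((hBB B).1 hB).1
    exact Finset.exists_mem_ne (by omega) z
  have hnbr : ∀ B ∈ BB, ∀ z ∈ B, ∃ y ∈ B, K.Adj z y := by
    intro B hB z hz
    obtain ⟨y, hy, hyz⟩ := hother B hB z hz
    obtain ⟨x, hx, y, hy, h⟩ := hcon B hB {z} (by simpa using hz) (by simp) ⟨y, by simp [hy, hyz]⟩
    rw [Finset.mem_singleton] at hx
    subst hx
    exact ⟨y, (Finset.mem_sdiff.1 hy).1, h⟩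
  let np := fun B : Finset V => (B.filter (fun z => ¬ PointedVx big z)).card
  let nr := fun B : Finset V => (B.filter (fun z => ¬ PointedVx big z ∧ ¬ ∃ y ∈ Rch E B, K.Adj z y)).card
  have hslk : ∀ B, slk K (wt big) B = 2 * B.card + np B - 3 - ec K B := by
    intro B
    unfold slk
    have : ∑ x ∈ B, wt big x = 2 * B.card + np B := by
      simp only [np, Finset.card_filter, Nat.cast_sum]
      rw [← nsmul_eq_mul', ← Finset.sum_const, ← Finset.sum_add_distrib]
      refine Finset.sum_congr rfl fun z _ => ?_
      unfold wt; split_ifs <;> simp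
    rw [this]
  have hB : ∀ B ∈ BB, (np B : ℤ) ≤ slk K (wt big) B + nr B := by
    intro B hB
    have hB2 := ((htt B).1 ((hBB B).1 hB).1).2.1
    have hsplit : np B = (B.filter (fun z => ¬ PointedVx big z ∧ ∃ y ∈ Rch E B, K.Adj z y)).card + nr B := by
      simp only [np, nr]
      rw [← Finset.card_union_of_disjoint]
      · congr 1; ext z; simp only [Finset.mem_filter, Finset.mem_union]; by_cases hq : ∃ y ∈ Rch E B, K.Adj z y <;> simp [hq]
      · rw [Finset.disjoint_left]; intro z h1 h2; simp only [Finset.mem_filter] at h1 h2; exact h2.2.2 h1.2.2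
    rw [hsplit]
    by_cases hne : (Rch E B).Nonempty
    · have hdis : Disjoint B (Rch E B) := Finset.disjoint_right.2 fun x hx => Rch_disj hx
      have hY := lemY hc hne (Rch_hI E B) (Finset.card_pos.1 (by omega)) hdis (by
        intro x hx y hxy
        by_cases hy : y ∈ B
        · exact Finset.mem_union_left _ hy
        · exact Finset.mem_union_right _ (Rch_step hx hxy hy))
      have h0 := hs (B ∪ Rch E B) (hB2.trans (Finset.card_le_card Finset.subset_union_left))
      have hsum : ((B.filter (fun z => ¬ PointedVx big z ∧ ∃ y ∈ Rch E B, K.Adj z y)).card : ℤ) ≤ ∑ z ∈ (Rch E B)ᶜ, cz E big (Rch E B) z := by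
        rw [Finset.card_eq_sum_ones]
        push_cast
        refine (Finset.sum_le_sum (g := fun z => cz E big (Rch E B) z) ?_).trans (Finset.sum_le_sum_of_subset_of_nonneg ?_ ?_)
        · intro z hz
          simp only [Finset.mem_filter] at hz
          obtain ⟨y, hy, hzy⟩ := hz.2.2
          obtain ⟨y', hy', hzy'⟩ := hnbr B hB z hz.1
          exact cz_pos hz.2.1 hy hzy (fun h => Rch_disj h hy') hzy'
        · intro z hz
          simp only [Finset.mem_filter] at hz
          exact Finset.mem_compl.2 (fun h => Rch_disj h hz.1)
        · intro z hz _
          rw [Finset.mem_compl] at hz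
          refine cz_nonneg hc ?_
          rintro ⟨y, hy, hzy⟩
          have : z ∈ B := by
            by_contra hzB; exact hz (Rch_step hy hzy.symm hzB)
          obtain ⟨y', hy', hzy'⟩ := hnbr B hB z this
          exact ⟨y', fun h => Rch_disj h hy', hzy'⟩
      push_cast
      linarith
    · have : B.filter (fun z => ¬ PointedVx big z ∧ ∃ y ∈ Rch E B, K.Adj z y) = ∅ := by
        rw [Finset.filter_eq_empty_iff]
        rintro z _ ⟨_, y, hy, _⟩
        exact hne ⟨y, hy⟩
      rw [this, Finset.card_empty]
      have := hs B hB2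
      push_cast; omega
  have hsp2 : ∀ B ∈ BB, ∀ B' ∈ BB, B ≠ B' → ∀ z ∈ B, z ∈ B' → ∀ y ∈ B, y ∈ Rch E B' → ∃ y ∈ Rch E B', K.Adj z y := by
    intro B hB B' hB' hne z hz hz' y hy hyR
    obtain ⟨x, hx, w, hw, h⟩ := hcon B hB (B ∩ Rch E B') Finset.inter_subset_left ⟨y, by simp [hy, hyR]⟩
      ⟨z, by simp only [Finset.mem_sdiff, Finset.mem_inter, not_and]; exact ⟨hz, fun _ h => Rch_disj h hz'⟩⟩
    rw [Finset.mem_inter] at hx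
    simp only [Finset.mem_sdiff, Finset.mem_inter, not_and] at hw
    have hwB : w ∈ B' := by by_contra h'; exact hw.2 hw.1 (Rch_step hx.2 h h')
    have : w = z := by
      by_contra hwz
      exact hne (hd B hB B' hB' w z hwz hw.1 hz hwB hz')
    subst this
    exact ⟨x, hx.2, h.symm⟩
  have hone : ∀ B ∈ BB, ∀ B' ∈ BB, ∀ z ∈ B, z ∈ B' → (¬ ∃ y ∈ Rch E B, K.Adj z y) → (¬ ∃ y ∈ Rch E B', K.Adj z y) → B = B' := by
    intro B hB B' hB' z hz hz' hn hn'
    by_contra hne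
    have hint : ∀ y ∈ B, y ∈ B' → y = z := by
      intro y hy hy'; by_contra hyz; exact hne (hd B hB B' hB' y z hyz hy hz hy' hz')
    obtain ⟨o, ho, hoz⟩ : ∃ o, Outv E o ∧ o ≠ z := by
      obtain ⟨d, _, h1, h2⟩ := outv_pair E
      by_cases h : d.fst = z
      · exact ⟨d.snd, h2, fun h' => d.adj.ne (h.trans h'.symm)⟩
      · exact ⟨_, h1, h⟩
    have n1 : ∀ y ∈ B, y ∉ Rch E B' := fun y hy hyR => hn' (hsp2 B hB B' hB' hne z hz hz' y hy hyR)
    have n2 : ∀ y ∈ B', y ∉ Rch E B := fun y hy hyR => hn (hsp2 B' hB' B hB (Ne.symm hne) z hz' hz y hy hyR)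
    have ho1 : o ∉ B := fun h => n1 o h (Rch_out ho (fun h' => hoz (hint o h h')))
    have ho2 : o ∉ B' := fun h => n2 o h (Rch_out ho (fun h' => hoz (hint o h' h)))
    obtain ⟨b, hb, hbz⟩ := hother B hB z hz
    obtain ⟨x, hx, y, hy, hyz, hxy⟩ := h2c z b {x | x ∈ Rch E B ∧ x ∈ Rch E B'} ⟨o, Rch_out ho ho1, Rch_out ho ho2⟩ (fun h => Rch_disj h.1 hz) hbz (fun h => Rch_disj h.1 hb)
    by_cases h1 : y ∈ B
    · exact n1 y h1 (Rch_step hx.2 hxy (fun h => hyz (hint y h1 h)))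
    · by_cases h2 : y ∈ B'
      · exact n2 y h2 (Rch_step hx.1 hxy h1)
      · exact hy ⟨Rch_step hx.1 hxy h1, Rch_step hx.2 hxy h2⟩
  have hnr : ∑ B ∈ BB, nr B ≤ np T := by
    simp only [nr, np]
    rw [← Finset.card_biUnion]
    · apply Finset.card_le_card
      intro z hz
      simp only [Finset.mem_biUnion, Finset.mem_filter] at hz ⊢
      obtain ⟨B, hB, h1, h2, _⟩ := hz
      exact ⟨hBT B hB h1, h2⟩
    · intro B hB B' hB' hne
      refine Finset.disjoint_left.2 ?_
      intro z h1 h2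
      simp only [Finset.mem_filter] at h1 h2
      exact hne (hone B hB B' hB' z h1.1 h2.1 h1.2.2 h2.2.2)
  have hsum : ∑ B ∈ BB, (np B : ℤ) ≤ ∑ B ∈ BB, (slk K (wt big) B + nr B) := Finset.sum_le_sum hB
  have hMB : ∑ B ∈ BB, (2 * (B.card : ℤ) - 3 - ec M B) = 0 := by
    apply Finset.sum_eq_zero
    intro B hB
    have := ((htt B).1 ((hBB B).1 hB).1).2.2
    rwa [slk_c2] at this
  simp only [hslk] at hsum hT
  simp only [Finset.sum_add_distrib, Finset.sum_sub_distrib] at hsum hMB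
  rw [slk_c2, eM] at hM1
  rw [eK] at hT
  zify at hnr
  push_cast at *
  linarith
end P2

structure TS {V : Type} (G : SimpleGraph V) (E : PlaneEmb G) (v : V) (a b : ↥({v}ᶜ : Set V))
    (K : SimpleGraph ↥({v}ᶜ : Set V)) (F : PlaneEmb K) : Prop where
  hK : ∀ x y, K.Adj x y ↔ G.Adj (x : V) y ∨ (x = a ∧ y = b) ∨ (x = b ∧ y = a)
  hav : G.Adj v a
  hbv : G.Adj v b
  hab : a ≠ b
  hnab : ¬ G.Adj (a : V) b
  ind : IsInducedPlaneEmbAdd G v a b K E F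
  conn : ∀ A ⊆ ({v}ᶜ : Set V), A.Nonempty → (∀ x ∈ A, ∀ y ∈ ({v}ᶜ : Set V), G.Adj x y → y ∈ A) → A = ({v}ᶜ : Set V)

lemma addCorr_swap {V : Type} {G : SimpleGraph V} {v : V} {a b : ↥({v}ᶜ : Set V)} {K : SimpleGraph ↥({v}ᶜ : Set V)}
    {x : K.Dart} {e : G.Dart} : AddCorr G v a b K x e ↔ AddCorr G v b a K x e := by
  unfold AddCorr; tauto

lemma TS.swap {V : Type} {G : SimpleGraph V} {E : PlaneEmb G} {v : V} {a b : ↥({v}ᶜ : Set V)}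
    {K : SimpleGraph ↥({v}ᶜ : Set V)} {F : PlaneEmb K} (h : TS G E v a b K F) : TS G E v b a K F where
  hK x y := by rw [h.hK]; tauto
  hav := h.hbv
  hbv := h.hav
  hab := h.hab.symm
  hnab := fun h' => h.hnab h'.symm
  ind := by
    have := h.ind
    unfold IsInducedPlaneEmbAdd at *
    simpa only [addCorr_swap (a := a) (b := b)] using this
  conn := h.conn

section transfer
open scoped Classical
variable {V : Type} [Fintype V] {G : SimpleGraph V} {E : PlaneEmb G} {v : V} {a b : ↥({v}ᶜ : Set V)}
    {K : SimpleGraph ↥({v}ᶜ : Set V)} {F : PlaneEmb K}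
local notation "Vc" => (compl (Singleton.singleton v) : Set V)
local notation "TT" => TS G E v a b K F

def isH (v : V) (e : G.Dart) : Prop := e.fst ≠ v ∧ e.snd ≠ v

lemma isH.symm {e : G.Dart} (h : isH v e) : isH v e.symm := ⟨h.2, h.1⟩

noncomputable def up (F : PlaneEmb K) (e : G.Dart) : K.Dart :=
  if h : ∃ x : K.Dart, (x.fst : V) = e.fst ∧ (x.snd : V) = e.snd then h.choose else Quotient.out F.outer

def TS.ab (h : TT) : K.Dart := ⟨(a, b), (h.hK a b).2 (Or.inr (Or.inl ⟨rfl, rfl⟩))⟩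
def TS.av (h : TT) : G.Dart := ⟨(v, a), h.hav⟩

lemma TS.ab_symm (h : TT) : h.ab.symm = h.swap.ab := rfl

lemma dext {W : Type} {J : SimpleGraph W} {x y : J.Dart} (h1 : x.fst = y.fst) (h2 : x.snd = y.snd) : x = y :=
  SimpleGraph.Dart.ext _ _ (Prod.ext h1 h2)

lemma kext {x y : K.Dart} (h1 : (x.fst : V) = y.fst) (h2 : (x.snd : V) = y.snd) : x = y :=
  dext (Subtype.ext h1) (Subtype.ext h2)

lemma TS.up_spec (h : TT) {e : G.Dart} (he : isH v e) : ((up F e).fst : V) = e.fst ∧ ((up F e).snd : V) = e.snd := by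
  have : ∃ x : K.Dart, (x.fst : V) = e.fst ∧ (x.snd : V) = e.snd := 
    ⟨⟨(⟨e.fst, he.1⟩, ⟨e.snd, he.2⟩), (h.hK _ _).2 (Or.inl e.adj)⟩, rfl, rfl⟩
  unfold up
  rw [dif_pos this]
  exact this.choose_spec

lemma TS.up_eq (h : TT) {e : G.Dart} (he : isH v e) {x : K.Dart} (h1 : (x.fst : V) = e.fst) (h2 : (x.snd : V) = e.snd) : x = up F e :=
  kext (h1.trans (h.up_spec he).1.symm) (h2.trans (h.up_spec he).2.symm)

lemma TS.up_symm (h : TT) {e : G.Dart} (he : isH v e) : (up F e).symm = up F e.symm :=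
  h.up_eq he.symm (h.up_spec he).2 (h.up_spec he).1

lemma TS.up_inj (h : TT) {e e' : G.Dart} (he : isH v e) (he' : isH v e') (heq : up F e = up F e') : e = e' :=
  dext (by rw [← (h.up_spec he).1, heq, (h.up_spec he').1]) (by rw [← (h.up_spec he).2, heq, (h.up_spec he').2])

lemma TS.cls (h : TT) (x : K.Dart) : (∃ e : G.Dart, isH v e ∧ x = up F e) ∨ x = h.ab ∨ x = h.swap.ab := by
  rcases (h.hK _ _).1 x.adj with h1 | h1 | h1
  · have : isH v (⟨(x.fst, x.snd), h1⟩ : G.Dart) := ⟨x.fst.2, x.snd.2⟩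
    exact Or.inl ⟨_, this, h.up_eq this rfl rfl⟩
  · exact Or.inr (Or.inl (dext h1.1 h1.2))
  · exact Or.inr (Or.inr (dext h1.1 h1.2))

lemma TS.up_ne (h : TT) {e : G.Dart} (he : isH v e) : up F e ≠ h.ab := by
  intro heq
  apply h.hnab
  have := h.up_spec he
  rw [heq] at this
  have h3 := e.adj
  rw [← this.1, ← this.2] at h3
  exact h3

lemma TS.corr (h : TT) {e : G.Dart} (he : isH v e) {x : K.Dart} (hx : AddCorr G v a b K x e) : x = up F e := by
  rcases hx with h1 | ⟨_, _, h1⟩ | ⟨_, _, h1⟩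
  · exact h.up_eq he (congrArg Prod.fst h1).symm (congrArg Prod.snd h1).symm
  · exact absurd (congrArg Prod.snd h1) he.2
  · exact absurd (congrArg Prod.snd h1) he.2

lemma TS.rotH (h : TT) {e : G.Dart} (he : isH v e) (hr : isH v (E.rot e)) : F.rot (up F e) = up F (E.rot e) := by
  obtain ⟨e', k, h1, h2, h3, h4⟩ := h.ind.1 (up F e) e (Or.inl (Prod.ext (h.up_spec he).1.symm (h.up_spec he).2.symm))
  have hk : k = 1 := by
    by_contra hk
    exact hr.2 (h4 1 one_pos (by omega))
  subst hk
  rw [pow_one] at h3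
  subst h3
  exact h.corr hr h1

lemma TS.isH_rot (h : TT) {w : G.Dart} (hw : w.fst = v) : isH v (E.rot w.symm) := by
  have hy : w.snd ≠ v := fun h' => w.adj.ne (hw.trans h'.symm)
  refine ⟨by rw [E.rot_fst]; exact hy, fun hs => ?_⟩
  have hfix : E.rot w.symm = w.symm := dext (E.rot_fst _) (hs.trans hw.symm)
  have hall : ∀ e : G.Dart, e.fst = w.snd → e = w.symm := fun e he =>
    rot_ind E (P := fun e => e = w.symm) (by rintro e rfl; exact hfix) rfl (Eq.symm he)
  have := h.conn {w.snd} (by simpa using Ne.symm hy) ⟨_, rfl⟩ (by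
    rintro x hx y hy' hxy
    rw [Set.mem_singleton_iff] at hx; subst hx
    have := congrArg (fun d => d.snd) (hall ⟨(w.snd, y), hxy⟩ rfl)
    exact absurd (this.trans hw) hy')
  have h1 : (a : V) ∈ ({w.snd} : Set V) := by rw [this]; exact a.2
  have h2 : (b : V) ∈ ({w.snd} : Set V) := by rw [this]; exact b.2
  exact h.hab (Subtype.ext (h1.trans h2.symm))

noncomputable def pre (E : PlaneEmb G) (w : G.Dart) : G.Dart := E.rot.symm w.symm

lemma rot_pre (w : G.Dart) : E.rot (pre E w) = w.symm := by simp [pre]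

lemma pre_fst (w : G.Dart) : (pre E w).fst = w.snd := by
  rw [← E.rot_fst, rot_pre]; rfl

lemma TS.isH_pre (h : TT) {w : G.Dart} (hw : w.fst = v) : isH v (pre E w) := by
  have hy : w.snd ≠ v := fun h' => w.adj.ne (hw.trans h'.symm)
  refine ⟨by rw [pre_fst]; exact hy, fun hs => ?_⟩
  have : pre E w = w.symm := dext (pre_fst w) (hs.trans hw.symm)
  have h1 := rot_pre (E := E) w
  rw [this] at h1
  exact (h.isH_rot hw).2 (by rw [h1]; exact hw)

lemma TS.rot_pre (h : TT) {w : G.Dart} (hw : w.fst = v) (ha : w.snd ≠ a) (hb : w.snd ≠ b) :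
    F.rot (up F (pre E w)) = up F (E.rot w.symm) := by
  have he := h.isH_pre hw
  obtain ⟨e', k, h1, h2, h3, h4⟩ := h.ind.1 (up F (pre E w)) (pre E w) (Or.inl (Prod.ext (h.up_spec he).1.symm (h.up_spec he).2.symm))
  have hr := h.isH_rot hw
  have h2' : (E.rot ^ 2) (pre E w) = E.rot w.symm := by rw [pow_two, Equiv.Perm.mul_apply, _root_.rot_pre]
  have hk1 : k ≠ 1 := by
    rintro rfl
    rw [pow_one, _root_.rot_pre] at h3
    subst h3
    rcases h1 with h1 | ⟨_, _, h1⟩ | ⟨_, _, h1⟩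
    · have : w.fst = ((F.rot (up F (pre E w))).snd : V) := congrArg Prod.snd h1
      rw [hw] at this
      exact (F.rot (up F (pre E w))).snd.2 this.symm
    · exact ha (congrArg Prod.fst h1)
    · exact hb (congrArg Prod.fst h1)
  have hk : k = 2 := by
    by_contra hk
    have := h4 2 (by omega) (by omega)
    rw [h2'] at this
    exact hr.2 this
  subst hk
  rw [h2'] at h3
  subst h3
  exact h.corr hr h1

lemma TS.rot_ab (h : TT) : F.rot h.ab = up F (E.rot h.av.symm) := by
  have hr := h.isH_rot (w := h.av) rfl
  obtain ⟨e', k, h1, h2, h3, h4⟩ := h.ind.1 h.ab h.av.symm (Or.inr (Or.inl ⟨rfl, rfl, rfl⟩))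
  have hk : k = 1 := by
    by_contra hk
    exact hr.2 (h4 1 one_pos (by omega))
  subst hk
  rw [pow_one] at h3
  subst h3
  exact h.corr hr h1

lemma TS.rot_pre_a (h : TT) : F.rot (up F (pre E h.av)) = h.ab := by
  obtain ⟨x, hx⟩ := F.rot.surjective h.ab
  have hxa : x.fst = a := by rw [← F.rot_fst, hx]; rfl
  rcases h.cls x with ⟨e, he, rfl⟩ | rfl | rfl
  · have : E.rot e = h.av.symm := by
      obtain ⟨e', k, h1, h2, h3, h4⟩ := h.ind.1 (up F e) e (Or.inl (Prod.ext (h.up_spec he).1.symm (h.up_spec he).2.symm))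
      have hea : e.fst = a := by rw [← (h.up_spec he).1, hxa]
      refine dext (by rw [E.rot_fst, hea]; rfl) ?_
      change _ = v
      by_cases hk : k = 1
      · subst hk
        rw [hx] at h1
        rw [pow_one] at h3
        rw [h3]
        rcases h1 with h1 | ⟨_, _, h1⟩ | ⟨h1, _⟩
        · have h5 : e'.fst = a := congrArg Prod.fst h1
          have h6 : e'.snd = b := congrArg Prod.snd h1
          exact absurd (h5 ▸ h6 ▸ e'.adj) h.hnab
        · exact congrArg Prod.snd h1
        · exact absurd h1 h.hab
      · exact h4 1 one_pos (by omega)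
    have : e = pre E h.av := by rw [pre, ← this]; simp
    rwa [← this]
  · rw [h.rot_ab] at hx
    exact absurd hx (h.up_ne (h.isH_rot rfl))
  · exact absurd hxa h.hab.symm
end transfer

section transfer
open scoped Classical
variable {V : Type} [Fintype V] {G : SimpleGraph V} {E : PlaneEmb G} {v : V} {a b : ↥({v}ᶜ : Set V)}
    {K : SimpleGraph ↥({v}ᶜ : Set V)} {F : PlaneEmb K}
local notation "Vc" => (compl (Singleton.singleton v) : Set V)
local notation "TT" => TS G E v a b K F

lemma face_pow {E : PlaneEmb G} {e e' : G.Dart} (h : E.dartFace e = E.dartFace e') : ∃ n : ℕ, (fac E ^ n) e = e' := by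
  rw [face_eq_iff] at h
  obtain ⟨n, _, h⟩ := h.exists_pow_eq'
  exact ⟨n, h⟩

lemma face_ind (E : PlaneEmb G) {P : G.Dart → Prop} (hP : ∀ e, P e → P (fac E e)) {e e' : G.Dart} (he : P e) (h : E.dartFace e = E.dartFace e') : P e' := by
  obtain ⟨n, rfl⟩ := face_pow h
  clear h
  induction n with
  | zero => exact he
  | succ n ih => rw [pow_succ', Equiv.Perm.mul_apply]; exact hP _ ih

noncomputable def lam (v : V) (E : PlaneEmb G) (F : PlaneEmb K) (e : G.Dart) : F.Face :=
  if isH v e then F.dartFace (up F e) else if e.fst = v then F.dartFace (up F (E.rot e.symm)) else F.dartFace (F.rot (up F (pre E e.symm)))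

lemma lam_isH {e : G.Dart} (he : isH v e) : lam v E F e = F.dartFace (up F e) := by simp [lam, he]
lemma lam_v {e : G.Dart} (he : e.fst = v) : lam v E F e = F.dartFace (up F (E.rot e.symm)) := by simp [lam, he, isH]
lemma lam_to {w : G.Dart} (hw : w.fst = v) : lam v E F w.symm = F.dartFace (F.rot (up F (pre E w))) := by
  have : w.snd ≠ v := fun h' => w.adj.ne (hw.trans h'.symm)
  simp [lam, hw, isH, this]

lemma TS.lam_H (h : TT) {e : G.Dart} (he : isH v e) : lam v E F (fac E e) = lam v E F e := by
  have h1 : (fac E e).fst = e.snd := E.rot_fst _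
  rw [lam_isH he]
  by_cases h2 : isH v (fac E e)
  · rw [lam_isH h2, fac_apply, ← h.rotH he.symm h2, ← h.up_symm he]
    exact face_fac F _
  · have h3 : (fac E e).snd = v := by
      by_contra h3; exact h2 ⟨by rw [h1]; exact he.2, h3⟩
    have := lam_to (F := F) (E := E) (w := (fac E e).symm) h3
    rw [SimpleGraph.Dart.symm_symm] at this
    rw [this]
    have h4 : pre E (fac E e).symm = e.symm := by simp [pre]
    rw [h4, ← h.up_symm he]
    exact face_fac F _

lemma TS.from_unique (h : TT) {w w' : G.Dart} (h1 : w.fst = v) (h2 : w'.fst = v) (hf : E.dartFace w = E.dartFace w') : w = w' := by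
  refine bond E (S := {v}) ?_ h.conn h1 ?_ h2 ?_ hf
  · intro A hA hne _
    exact hA.antisymm (by rintro x rfl; obtain ⟨y, hy⟩ := hne; have := hA hy; rw [Set.mem_singleton_iff] at this; rwa [← this])
  · intro h'; exact w.adj.ne (h1.trans h'.symm)
  · intro h'; exact w'.adj.ne (h2.trans h'.symm)

lemma TS.gap_walk (h : TT) {w : G.Dart} (hw : w.fst = v) : ∃ n : ℕ, 2 ≤ n ∧ (fac E ^ n) (E.rot w) = w.symm ∧
    ∀ j, 1 ≤ j → j < n → isH v ((fac E ^ j) (E.rot w)) := by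
  have hw' : (E.rot w).fst = v := by rw [E.rot_fst, hw]
  have hex : ∃ n, 1 ≤ n ∧ ¬ isH v ((fac E ^ n) (E.rot w)) := by
    refine ⟨orderOf (fac E), orderOf_pos _, ?_⟩
    rw [pow_orderOf_eq_one]
    intro h'; exact h'.1 hw'
  obtain ⟨hn1, hn2⟩ := Nat.find_spec hex
  have hmin : ∀ j, 1 ≤ j → j < Nat.find hex → isH v ((fac E ^ j) (E.rot w)) := fun j h1 h2 => by
    have := Nat.find_min hex h2; by_contra h'; exact this ⟨h1, h'⟩
  generalize Nat.find hex = n at *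
  have h2 : 2 ≤ n := by
    by_contra h2
    have : n = 1 := by omega
    subst this
    exact hn2 (h.isH_rot hw')
  refine ⟨n, h2, ?_, hmin⟩
  obtain ⟨m, rfl⟩ := Nat.exists_eq_add_of_le h2
  have hm := hmin (1 + m) (by omega) (by omega)
  have e1 : (fac E ^ (2 + m)) (E.rot w) = fac E ((fac E ^ (1 + m)) (E.rot w)) := by
    have h' : 2 + m = (1 + m) + 1 := by omega
    rw [h', pow_succ', Equiv.Perm.mul_apply]
  have h4 : ((fac E ^ (2 + m)) (E.rot w)).fst ≠ v := by
    rw [e1, fac_apply, E.rot_fst]; exact hm.2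
  have h5 : ((fac E ^ (2 + m)) (E.rot w)).snd = v := by by_contra h5; exact hn2 ⟨h4, h5⟩
  have h6 : fac E ((fac E ^ (2 + m)) (E.rot w)) = E.rot w := by
    apply h.from_unique _ hw' _
    · rw [fac_apply, E.rot_fst]; exact h5
    · rw [face_fac, face_eq_iff]
      exact (Equiv.Perm.SameCycle.refl _ _).pow_left
  have h7 : fac E w.symm = E.rot w := by simp
  exact (fac E).injective (h6.trans h7.symm)

lemma TS.lam_fac (h : TT) (e : G.Dart) : lam v E F (fac E e) = lam v E F e := by
  by_cases he : isH v e
  · exact h.lam_H he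
  by_cases he1 : e.fst = v
  · rw [lam_v he1, fac_apply, lam_isH (h.isH_rot he1)]
  have he2 : e.snd = v := by by_contra h'; exact he ⟨he1, h'⟩
  obtain ⟨n, hn, h1, h2⟩ := h.gap_walk (w := e.symm) he2
  rw [SimpleGraph.Dart.symm_symm] at h1
  have key : ∀ j, j ≤ n → 1 ≤ j → lam v E F ((fac E ^ j) (E.rot e.symm)) = lam v E F (E.rot e.symm) := by
    intro j
    induction j with
    | zero => intro _ h'; omega
    | succ j ih =>
      intro hj _
      rw [pow_succ', Equiv.Perm.mul_apply]
      rcases Nat.eq_zero_or_pos j with rfl | hj0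
      · have hv : (E.rot e.symm).fst = v := by rw [E.rot_fst]; exact he2
        rw [lam_v hv]
        exact lam_isH (h.isH_rot hv)
      · rw [h.lam_H (h2 j hj0 (by omega)), ih (by omega) hj0]
  have := key n le_rfl (by omega)
  rw [h1] at this
  rw [this]; rfl

lemma TS.lam_face (h : TT) {e e' : G.Dart} (hf : E.dartFace e = E.dartFace e') : lam v E F e = lam v E F e' := by
  refine face_ind E (P := fun e' => lam v E F e = lam v E F e') (fun e1 h1 => ?_) rfl hf
  rw [h.lam_fac, h1]

def nov (v : V) (E : PlaneEmb G) (Q : E.Face) : Prop := ∀ e, E.dartFace e = Q → isH v e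

lemma touch {Q : E.Face} (hQ : ¬ nov v E Q) : ∃ w : G.Dart, w.fst = v ∧ E.angleFace w = Q := by
  unfold nov at hQ
  push Not at hQ
  obtain ⟨e, he, hn⟩ := hQ
  by_cases h1 : e.fst = v
  · refine ⟨E.rot.symm e, by rw [← E.rot_fst]; simpa using h1, ?_⟩
    rw [angle_eq, ← face_rot]; simpa using he
  · exact ⟨e.symm, by by_contra h2; exact hn ⟨h1, h2⟩, by rw [angle_eq]; simpa using he⟩

lemma TS.nov_face (h : TT) {e : G.Dart} (hQ : nov v E (E.dartFace e)) {x : K.Dart} (hx : F.dartFace (up F e) = F.dartFace x) :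
    ∃ e', isH v e' ∧ x = up F e' ∧ E.dartFace e' = E.dartFace e := by
  refine face_ind F (P := fun x => ∃ e', isH v e' ∧ x = up F e' ∧ E.dartFace e' = E.dartFace e) ?_ ⟨e, hQ e rfl, rfl, rfl⟩ hx
  rintro x ⟨e', h1, rfl, h3⟩
  have h4 : isH v (fac E e') := hQ _ (by rw [face_fac, h3])
  refine ⟨fac E e', h4, ?_, by rw [face_fac, h3]⟩
  rw [fac_apply, fac_apply, h.up_symm h1]
  exact h.rotH h1.symm h4

def TS.wi (h : TT) (i : ℕ) : G.Dart := (E.rot ^ i) h.av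

lemma TS.wi_zero (h : TT) : h.wi 0 = h.av := rfl
lemma TS.wi_succ (h : TT) (i : ℕ) : h.wi (i + 1) = E.rot (h.wi i) := by
  unfold TS.wi; rw [pow_succ']; rfl
lemma TS.wi_fst (h : TT) (i : ℕ) : (h.wi i).fst = v := by
  induction i with
  | zero => rfl
  | succ i ih => rw [h.wi_succ, E.rot_fst, ih]

noncomputable def TS.dg (h : TT) : ℕ := Function.minimalPeriod E.rot h.av

lemma TS.wi_iter (h : TT) (i : ℕ) : h.wi i = E.rot^[i] h.av := by
  unfold TS.wi; rw [Equiv.Perm.coe_pow]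

lemma TS.dg_pos (h : TT) : 0 < h.dg := by
  apply Function.IsPeriodicPt.minimalPeriod_pos (orderOf_pos E.rot)
  rw [Function.IsPeriodicPt, Function.IsFixedPt, ← Equiv.Perm.coe_pow, pow_orderOf_eq_one]; rfl

lemma TS.wi_inj (h : TT) {i j : ℕ} (hi : i < h.dg) (hj : j < h.dg) (hij : h.wi i = h.wi j) : i = j := by
  rw [h.wi_iter, h.wi_iter] at hij
  exact Function.iterate_injOn_Iio_minimalPeriod hi hj hij

lemma TS.wi_add (h : TT) (i : ℕ) : h.wi (i + h.dg) = h.wi i := by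
  rw [h.wi_iter, h.wi_iter]; exact Function.iterate_add_minimalPeriod_eq

lemma TS.wi_surj (h : TT) {w : G.Dart} (hw : w.fst = v) : ∃ i < h.dg, h.wi i = w := by
  obtain ⟨n, hn⟩ := E.rot_vertex h.av w (Eq.symm hw)
  refine ⟨n % h.dg, Nat.mod_lt _ h.dg_pos, ?_⟩
  rw [h.wi_iter, ← hn, Equiv.Perm.coe_pow]
  exact Function.iterate_mod_minimalPeriod_eq

lemma TS.ex_r (h : TT) : ∃ r, 0 < r ∧ r < h.dg ∧ h.wi r = h.swap.av := by
  obtain ⟨r, h1, h2⟩ := h.wi_surj (w := h.swap.av) rfl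
  refine ⟨r, Nat.pos_of_ne_zero ?_, h1, h2⟩
  rintro rfl
  have := congrArg (fun d => d.snd) h2
  exact h.hab (Subtype.ext this)

lemma TS.dg_swap (h : TT) : h.swap.dg = h.dg := by
  obtain ⟨r, h1, h2, h3⟩ := h.ex_r
  unfold TS.dg
  rw [← h3, h.wi_iter]
  exact Function.minimalPeriod_apply_iterate (Function.minimalPeriod_pos_iff_mem_periodicPts.1 h.dg_pos) r

lemma TS.wi_swap (h : TT) {r : ℕ} (hr : h.wi r = h.swap.av) (i : ℕ) : h.swap.wi i = h.wi (i + r) := by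
  unfold TS.wi at *; rw [← hr, pow_add]; rfl

lemma TS.gap_prev (h : TT) (i : ℕ) : E.dartFace (h.wi (i + 1)) = E.dartFace (h.wi i).symm := by
  rw [h.wi_succ, face_rot]

lemma TS.wi_ne (h : TT) {r : ℕ} (hr : h.wi r = h.swap.av) {i : ℕ} (hr' : r < h.dg) (hi0 : i < h.dg) (hi : i ≠ 0) (hir : i ≠ r) : (h.wi i).snd ≠ a ∧ (h.wi i).snd ≠ b := by
  constructor
  · intro h'
    exact hi (h.wi_inj hi0 h.dg_pos (dext (h.wi_fst i) h'))
  · intro h'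
    exact hir (h.wi_inj hi0 hr' (by rw [hr]; exact dext (h.wi_fst i) h'))

lemma TS.lam_side (h : TT) {r : ℕ} (hr : h.wi r = h.swap.av) (hrd : r < h.dg) {i : ℕ} (hi : i < r) :
    lam v E F (h.wi i).symm = F.dartFace h.ab := by
  induction i with
  | zero => 
    rw [lam_to (h.wi_fst 0), h.wi_zero, h.rot_pre_a]
  | succ i ih =>
    have hn := h.wi_ne hr hrd (by omega : i + 1 < h.dg) (by omega) (by omega)
    rw [lam_to (h.wi_fst _), h.rot_pre (h.wi_fst _) hn.1 hn.2, ← lam_v (h.wi_fst _), h.lam_face (h.gap_prev i), ih (by omega)]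

lemma TS.F12 (h : TT) : F.dartFace h.ab ≠ F.dartFace h.swap.ab := by
  rw [← h.ab_symm]
  refine nonbridge F (K := G.induce Vc) ?_ h.ab ?_
  · refine { preconnected := ?_, nonempty := ⟨a⟩ }
    intro x y
    have := h.conn {z : V | ∃ hz : z ∈ Vc, (G.induce Vc).Reachable x ⟨z, hz⟩} (fun z hz => hz.1) ⟨x, x.2, SimpleGraph.Reachable.refl _⟩ (by
      rintro z ⟨hz, hr⟩ u hu hzu
      refine ⟨hu, hr.trans (SimpleGraph.Adj.reachable ?_)⟩
      exact hzu)
    exact (this.ge y.2).2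
  · intro x y hxy
    have hxy' : G.Adj (x : V) y := hxy
    refine ⟨⟨(x, y), (h.hK x y).2 (Or.inl hxy')⟩, rfl, rfl, ?_, ?_⟩
    · intro h'
      have h1 : x = a := congrArg (fun d => d.fst) h'
      have h2 : y = b := congrArg (fun d => d.snd) h'
      subst h1 h2; exact h.hnab hxy'
    · intro h'
      have h1 : x = b := congrArg (fun d => d.fst) h'
      have h2 : y = a := congrArg (fun d => d.snd) h'
      subst h1 h2; exact h.hnab hxy'.symm
end transfer

section counting
open scoped Classical
variable {V : Type} [Fintype V] {G : SimpleGraph V} {E : PlaneEmb G} {v : V} {a b : ↥({v}ᶜ : Set V)}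
    {K : SimpleGraph ↥({v}ᶜ : Set V)} {F : PlaneEmb K}
local notation "Vc" => (compl (Singleton.singleton v) : Set V)
local notation "TT" => TS G E v a b K F

def cm (v : V) (E : PlaneEmb G) (e : G.Dart) : Prop := isH v e ∧ isH v (E.rot e)

lemma TS.pre_of (h : TT) {e : G.Dart} (he : isH v e) (hr : ¬ isH v (E.rot e)) : ∃ i < h.dg, pre E (h.wi i) = e := by
  have h1 : (E.rot e).snd = v := by
    by_contra h'; exact hr ⟨by rw [E.rot_fst]; exact he.1, h'⟩
  obtain ⟨i, hi, h2⟩ := h.wi_surj (w := (E.rot e).symm) h1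
  exact ⟨i, hi, by rw [h2, pre]; simp⟩

lemma TS.pre_inj (h : TT) {i j : ℕ} (hi : i < h.dg) (hj : j < h.dg) (hij : pre E (h.wi i) = pre E (h.wi j)) : i = j := by
  have := congrArg E.rot hij
  rw [_root_.rot_pre, _root_.rot_pre] at this
  exact h.wi_inj hi hj (SimpleGraph.Dart.symm_involutive.injective this)

lemma TS.not_cm_pre (h : TT) (i : ℕ) : ¬ cm v E (pre E (h.wi i)) := by
  intro h'
  have := h'.2.2
  rw [_root_.rot_pre] at this
  exact this (h.wi_fst i)

lemma TS.H_sum (h : TT) (f : G.Dart → ℕ) : ∑ e with isH v e, f e = ∑ e with cm v E e, f e + ∑ i ∈ Finset.range h.dg, f (pre E (h.wi i)) := by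
  rw [← Finset.sum_filter_add_sum_filter_not _ (fun e => isH v (E.rot e)), Finset.filter_filter]
  refine congrArg₂ (· + ·) (Finset.sum_congr (by ext; rw [Finset.mem_filter, Finset.mem_filter]; rfl) (fun _ _ => rfl)) ?_
  symm
  apply Finset.sum_nbij (fun i => pre E (h.wi i))
  · intro i hi
    simp only [Finset.mem_filter, Finset.mem_univ, true_and]
    exact ⟨h.isH_pre (h.wi_fst i), fun h' => h.not_cm_pre i ⟨h.isH_pre (h.wi_fst i), h'⟩⟩
  · intro i hi j hj hij
    exact h.pre_inj (by simpa using hi) (by simpa using hj) hij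
  · intro e he
    simp only [Finset.coe_filter, Finset.mem_filter, Finset.mem_univ, true_and, Set.mem_ofPred_eq] at he
    obtain ⟨i, hi, h1⟩ := h.pre_of he.1 he.2
    exact ⟨i, by simpa using hi, h1⟩
  · intros; rfl

lemma TS.K_sum (h : TT) (f : K.Dart → ℕ) : ∑ x, f x = ∑ e with cm v E e, f (up F e) + ∑ i ∈ Finset.range h.dg, f (up F (pre E (h.wi i))) + f h.ab + f h.swap.ab := by
  rw [← h.H_sum (fun e => f (up F e))]
  have h1 : (Finset.univ : Finset K.Dart) = insert h.ab (insert h.swap.ab ((Finset.univ.filter (fun e : G.Dart => isH v e)).image (up F))) := by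
    symm
    rw [Finset.eq_univ_iff_forall]
    intro x
    simp only [Finset.mem_insert, Finset.mem_image, Finset.mem_filter, Finset.mem_univ, true_and]
    rcases h.cls x with ⟨e, he, hx⟩ | hx | hx
    · exact Or.inr (Or.inr ⟨e, he, hx.symm⟩)
    · exact Or.inl hx
    · exact Or.inr (Or.inl hx)
  rw [h1, Finset.sum_insert, Finset.sum_insert, Finset.sum_image]
  · ring
  · intro e he e' he' hee
    exact h.up_inj (by simpa using he) (by simpa using he') hee
  · simp only [Finset.mem_image, Finset.mem_filter, Finset.mem_univ, true_and]
    rintro ⟨e, he, h2⟩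
    exact h.swap.up_ne he h2
  · simp only [Finset.mem_insert, Finset.mem_image, Finset.mem_filter, Finset.mem_univ, true_and]
    rintro (h2 | ⟨e, he, h2⟩)
    · exact h.hab (congrArg (fun d => d.fst) h2)
    · exact h.up_ne he h2

lemma TS.v_sum (h : TT) (f : G.Dart → ℕ) : ∑ e with e.fst = v, f e = ∑ i ∈ Finset.range h.dg, f (h.wi i) := by
  symm
  apply Finset.sum_nbij (fun i => h.wi i)
  · intro i hi; simp [h.wi_fst]
  · intro i hi j hj hij
    exact h.wi_inj (by simpa using hi) (by simpa using hj) hij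
  · intro e he
    obtain ⟨i, hi, h1⟩ := h.wi_surj (w := e) (by simpa using he)
    exact ⟨i, by simpa using hi, h1⟩
  · intros; rfl

lemma TS.G_sum (h : TT) (f : G.Dart → ℕ) : ∑ e, f e = ∑ e with cm v E e, f e + ∑ i ∈ Finset.range h.dg, f (pre E (h.wi i))
    + ∑ i ∈ Finset.range h.dg, f (h.wi i).symm + ∑ i ∈ Finset.range h.dg, f (h.wi i) := by
  rw [← h.H_sum, ← h.v_sum, ← h.v_sum (fun e => f e.symm)]
  rw [← Finset.sum_filter_add_sum_filter_not Finset.univ (fun e : G.Dart => isH v e), add_assoc]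
  congr 1
  rw [← Finset.sum_filter_add_sum_filter_not _ (fun e : G.Dart => e.snd = v), Finset.filter_filter, Finset.filter_filter]
  congr 1
  · apply Finset.sum_nbij (fun e => e.symm)
    · intro e he; simp at he ⊢; exact he.2
    · intro x _ y _ hxy; exact SimpleGraph.Dart.symm_involutive.injective hxy
    · intro e he
      refine ⟨e.symm, ?_, by simp⟩
      simp [isH] at he ⊢; simp [he]
    · intro e _; simp
  · apply Finset.sum_congr _ (fun _ _ => rfl)
    ext e
    rw [Finset.mem_filter, Finset.mem_filter]
    simp only [isH, Finset.mem_univ, true_and]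
    constructor
    · rintro ⟨h1, h2⟩; by_contra h3; exact h1 ⟨h3, h2⟩
    · intro h1
      have := e.adj.ne
      exact ⟨fun h2 => h2.1 h1, fun h2 => this (h1.trans h2.symm)⟩

def TS.gp (h : TT) (i : ℕ) : E.Face := E.angleFace (h.wi i)

lemma TS.gp_inj (h : TT) {i j : ℕ} (hi : i < h.dg) (hj : j < h.dg) (hij : h.gp i = h.gp j) : i = j := by
  unfold TS.gp at hij
  rw [angle_eq, angle_eq, ← face_rot, ← face_rot] at hij
  have := h.from_unique (by rw [E.rot_fst, h.wi_fst]) (by rw [E.rot_fst, h.wi_fst]) hij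
  exact h.wi_inj hi hj (E.rot.injective this)

lemma TS.gp_pre (h : TT) (i : ℕ) : E.angleFace (pre E (h.wi i)) = h.gp i := by
  unfold TS.gp
  rw [angle_eq, ← face_rot, _root_.rot_pre]; rfl

lemma TS.gp_bef (h : TT) (i : ℕ) : E.angleFace (h.wi (i + 1)).symm = h.gp i := by
  unfold TS.gp
  rw [angle_eq, SimpleGraph.Dart.symm_symm, h.gap_prev]; rfl

lemma TS.gp_touch (h : TT) {Q : E.Face} (hQ : ¬ nov v E Q) : ∃ i < h.dg, Q = h.gp i := by
  obtain ⟨w, hw, h1⟩ := touch hQ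
  obtain ⟨i, hi, h2⟩ := h.wi_surj hw
  exact ⟨i, hi, by rw [TS.gp, h2, h1]⟩

lemma TS.gp_not_nov (h : TT) (i : ℕ) : ¬ nov v E (h.gp i) := fun h' => (h' (h.wi i).symm rfl).2 (h.wi_fst i)

lemma TS.lam_side2 (h : TT) {r : ℕ} (hr : h.wi r = h.swap.av) (hrd : r < h.dg) {i : ℕ} (hi : r ≤ i) (hi' : i < h.dg) :
    lam v E F (h.wi i).symm = F.dartFace h.swap.ab := by
  have := h.swap.lam_side (r := h.dg - r) (i := i - r) ?_ ?_ (by omega)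
  · rw [h.wi_swap hr] at this
    rwa [show i - r + r = i by omega] at this
  · rw [h.wi_swap hr, show h.dg - r + r = 0 + h.dg by omega, h.wi_add]; rfl
  · rw [h.dg_swap]
    have : r ≠ 0 := by
      rintro rfl
      exact h.hab (Subtype.ext (congrArg (fun d => d.snd) hr))
    omega

lemma TS.outer_lam (h : TT) {e : G.Dart} (he : E.dartFace e = E.outer) : lam v E F e = F.outer := by
  obtain ⟨x, d, h1, h2, h3⟩ := h.ind.2
  rw [h.lam_face (he.trans h3.symm)]
  by_cases hd : isH v d
  · rw [lam_isH hd, ← h.corr hd h1, h2]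
  · rcases h1 with h1 | ⟨h4, h5, h1⟩ | ⟨h4, h5, h1⟩
    · exfalso; apply hd
      have e1 : d.fst = x.fst := congrArg Prod.fst h1
      have e2 : d.snd = x.snd := congrArg Prod.snd h1
      exact ⟨e1 ▸ x.fst.2, e2 ▸ x.snd.2⟩
    · have e1 : d = h.av.symm := SimpleGraph.Dart.ext _ _ h1
      have e2 : x = h.ab := dext h4 h5
      rw [e1, lam_to (w := h.av) (v := v) rfl, h.rot_pre_a, ← h2, e2]
    · have e1 : d = h.swap.av.symm := SimpleGraph.Dart.ext _ _ h1
      have e2 : x = h.swap.ab := dext h4 h5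
      rw [e1, lam_to (w := h.swap.av) (v := v) rfl, h.swap.rot_pre_a, ← h2, e2]

lemma TS.nov_ne (h : TT) {e : G.Dart} (hQ : nov v E (E.dartFace e)) : F.dartFace (up F e) ≠ F.dartFace h.ab := by
  intro h'
  obtain ⟨e', h1, h2, _⟩ := h.nov_face hQ h'
  exact h.up_ne h1 h2.symm

lemma TS.cm_face (h : TT) {e : G.Dart} (he : isH v e) : F.angleFace (up F e) = lam v E F e.symm := by
  rw [lam_isH he.symm, angle_eq, h.up_symm he]

lemma TS.pre_face (h : TT) (i : ℕ) : F.angleFace (up F (pre E (h.wi i))) = lam v E F (h.wi i).symm := by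
  rw [lam_to (h.wi_fst i), angle_eq, face_rot]

lemma TS.cm_side (h : TT) {r : ℕ} (hr : h.wi r = h.swap.av) (hrd : r < h.dg) {e : G.Dart} (he : isH v e) :
    F.angleFace (up F e) = F.dartFace h.ab ↔ ∃ i < r, E.angleFace e = h.gp i := by
  rw [h.cm_face he]
  constructor
  · intro h1
    by_cases hn : nov v E (E.angleFace e)
    · exfalso
      rw [lam_isH he.symm] at h1
      exact h.nov_ne (e := e.symm) hn h1
    · obtain ⟨i, hi, h2⟩ := h.gp_touch hn
      refine ⟨i, ?_, h2⟩
      by_contra h3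
      rw [h.lam_face (e' := (h.wi i).symm) h2, h.lam_side2 hr hrd (by omega) hi] at h1
      exact h.F12 h1.symm
  · rintro ⟨i, hi, h2⟩
    rw [h.lam_face (e' := (h.wi i).symm) h2, h.lam_side hr hrd hi]

lemma TS.pre_side (h : TT) {r : ℕ} (hr : h.wi r = h.swap.av) (hrd : r < h.dg) {i : ℕ} (hi : i < h.dg) :
    F.angleFace (up F (pre E (h.wi i))) = F.dartFace h.ab ↔ i < r := by
  rw [h.pre_face]
  constructor
  · intro h1
    by_contra h3
    rw [h.lam_side2 hr hrd (by omega) hi] at h1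
    exact h.F12 h1.symm
  · intro h1; exact h.lam_side hr hrd h1

lemma TS.outer_side (h : TT) {r : ℕ} (hr : h.wi r = h.swap.av) (hrd : r < h.dg) :
    F.dartFace h.ab = F.outer ↔ ∃ i < r, h.gp i = E.outer := by
  constructor
  · intro h1
    obtain ⟨x, d, h2, h3, h4⟩ := h.ind.2
    have h5 := h.outer_lam h4
    by_cases hn : nov v E E.outer
    · exfalso
      have hd := hn d h4
      rw [lam_isH hd, ← h1] at h5
      exact h.nov_ne (by rw [h4]; exact hn) h5
    · obtain ⟨i, hi, h6⟩ := h.gp_touch hn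
      refine ⟨i, ?_, h6.symm⟩
      by_contra h7
      have := h.outer_lam (e := (h.wi i).symm) h6.symm
      rw [h.lam_side2 hr hrd (by omega) hi, ← h1] at this
      exact h.F12 this.symm
  · rintro ⟨i, hi, h2⟩
    rw [← h.lam_side hr hrd hi]
    exact h.outer_lam h2
end counting

section counting
open scoped Classical
variable {V : Type} [Fintype V] {G : SimpleGraph V} {E : PlaneEmb G} {v : V} {a b : ↥({v}ᶜ : Set V)}
    {K : SimpleGraph ↥({v}ᶜ : Set V)} {F : PlaneEmb K}
local notation "Vc" => (compl (Singleton.singleton v) : Set V)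
local notation "TT" => TS G E v a b K F

noncomputable def ib (p : Prop) : ℕ := if p then 1 else 0
lemma ib_t {p : Prop} (h : p) : ib p = 1 := if_pos h
lemma ib_f {p : Prop} (h : ¬ p) : ib p = 0 := if_neg h
lemma ib_le (p : Prop) : ib p ≤ 1 := by unfold ib; split_ifs <;> omega
lemma ib_zero {p : Prop} : ib p = 0 ↔ ¬ p := by unfold ib; split_ifs <;> simp_all
lemma ib_one {p : Prop} : ib p = 1 ↔ p := by unfold ib; split_ifs <;> simp_all

lemma card_ib {α : Type} [Fintype α] (P : α → Prop) : Nat.card {d : α | P d} = ∑ d, ib (P d) := by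
  rw [Nat.card_eq_fintype_card, Fintype.card_subtype]
  simp [ib, Finset.sum_boole]

noncomputable def TS.m0 (h : TT) (B : K.Dart → Prop) (i : ℕ) : ℕ := ∑ e with cm v E e, ib (E.angleFace e = h.gp i ∧ ¬ B (up F e))
noncomputable def TS.m (h : TT) (B : K.Dart → Prop) (i : ℕ) : ℕ := if h.gp i = E.outer then 3 else h.m0 B i
noncomputable def TS.s (h : TT) (B : K.Dart → Prop) (i : ℕ) : ℕ := ib (¬ B (up F (pre E (h.wi i))))
noncomputable def TS.t (h : TT) (B : K.Dart → Prop) : ℕ := ib (¬ B h.ab)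

lemma TS.m0_sum (h : TT) {B : K.Dart → Prop} {r : ℕ} (hr : h.wi r = h.swap.av) (hrd : r < h.dg) :
    ∑ e with cm v E e, ib (F.angleFace (up F e) = F.dartFace h.ab ∧ ¬ B (up F e)) = ∑ i ∈ Finset.range r, h.m0 B i := by
  unfold TS.m0
  rw [Finset.sum_comm]
  apply Finset.sum_congr rfl
  intro e he
  have he' : isH v e := (Finset.mem_filter.1 he).2.1
  rw [h.cm_side hr hrd he']
  by_cases hex : ∃ i < r, E.angleFace e = h.gp i
  · obtain ⟨i, hi, h1⟩ := hex
    rw [Finset.sum_eq_single i]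
    · congr 1
      simp only [h1, true_and, eq_iff_iff, and_iff_right_iff_imp]
      intro _; exact ⟨i, hi, rfl⟩
    · intro j hj hji
      apply ib_f
      rintro ⟨h2, _⟩
      rw [Finset.mem_range] at hj
      exact hji (h.gp_inj (by omega) (by omega) (h2.symm.trans h1))
    · intro h'; exact absurd (Finset.mem_range.2 hi) h'
  · rw [ib_f (fun h' => hex h'.1), Finset.sum_eq_zero]
    intro i hi
    exact ib_f (fun h' => hex ⟨i, Finset.mem_range.1 hi, h'.1⟩)

lemma TS.side_count (h : TT) {B : K.Dart → Prop} {r : ℕ} (hr : h.wi r = h.swap.av) (hrd : r < h.dg) :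
    ∑ x, ib (F.angleFace x = F.dartFace h.ab ∧ ¬ B x) = ∑ i ∈ Finset.range r, h.m0 B i + ∑ i ∈ Finset.range r, h.s B i + h.swap.t B := by
  rw [h.K_sum, h.m0_sum hr hrd]
  have h1 : ib (F.angleFace h.ab = F.dartFace h.ab ∧ ¬ B h.ab) = 0 := by
    apply ib_f; rintro ⟨h1, _⟩
    rw [angle_eq, h.ab_symm] at h1; exact h.F12 h1.symm
  have h2 : ib (F.angleFace h.swap.ab = F.dartFace h.ab ∧ ¬ B h.swap.ab) = h.swap.t B := by
    unfold TS.t; congr 1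
    rw [angle_eq, h.swap.ab_symm]
    exact eq_iff_iff.2 ⟨fun h' => h'.2, fun h' => ⟨rfl, h'⟩⟩
  have h3 : ∑ i ∈ Finset.range h.dg, ib (F.angleFace (up F (pre E (h.wi i))) = F.dartFace h.ab ∧ ¬ B (up F (pre E (h.wi i)))) = ∑ i ∈ Finset.range r, h.s B i := by
    rw [← Finset.sum_subset (Finset.range_subset_range.2 hrd.le)]
    · apply Finset.sum_congr rfl
      intro i hi
      rw [Finset.mem_range] at hi
      unfold TS.s; congr 1
      exact eq_iff_iff.2 ⟨fun h' => h'.2, fun h' => ⟨(h.pre_side hr hrd (by omega)).2 hi, h'⟩⟩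
    · intro i hi hi'
      apply ib_f
      rintro ⟨h', _⟩
      exact hi' (Finset.mem_range.2 ((h.pre_side hr hrd (Finset.mem_range.1 hi)).1 h'))
  rw [h1, h2, h3]; ring

lemma TS.side_eq (h : TT) {B : K.Dart → Prop} (hc : IsCPTLabelling F B) {r : ℕ} (hr : h.wi r = h.swap.av) (hrd : r < h.dg) :
    ∑ i ∈ Finset.range r, h.m B i + ∑ i ∈ Finset.range r, h.s B i + h.swap.t B = 3 := by
  have h1 := h.side_count (B := B) hr hrd
  by_cases ho : F.dartFace h.ab = F.outer
  · have h0 : ∑ x, ib (F.angleFace x = F.dartFace h.ab ∧ ¬ B x) = 0 :=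
      Finset.sum_eq_zero (fun x _ => ib_f (fun h' => h'.2 (hc.outer_big x (h'.1.trans ho))))
    rw [h0] at h1
    obtain ⟨i, hi, h2⟩ := (h.outer_side hr hrd).1 ho
    have h3 : ∑ i ∈ Finset.range r, h.m0 B i = 0 := by omega
    rw [Finset.sum_eq_zero_iff] at h3
    rw [Finset.sum_eq_single i]
    · have : h.m B i = 3 := if_pos h2
      omega
    · intro j hj hji
      have : ¬ h.gp j = E.outer := by
        intro h4; rw [Finset.mem_range] at hj
        exact hji (h.gp_inj (by omega) (by omega) (h4.trans h2.symm))
      rw [TS.m, if_neg this]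
      exact h3 j hj
    · intro h'; exact absurd (Finset.mem_range.2 hi) h'
  · have h0 := hc.bounded_small _ ho
    rw [card_ib, h1] at h0
    rw [← h0]; congr 2
    apply Finset.sum_congr rfl
    intro i hi
    apply if_neg
    intro h'
    exact ho ((h.outer_side hr hrd).2 ⟨i, Finset.mem_range.1 hi, h'⟩)

lemma TS.m_swap (h : TT) {B : K.Dart → Prop} {r : ℕ} (hr : h.wi r = h.swap.av) (i : ℕ) : h.swap.m B i = h.m B (i + r) := by
  unfold TS.m TS.m0 TS.gp; rw [h.wi_swap hr]
lemma TS.s_swap (h : TT) {B : K.Dart → Prop} {r : ℕ} (hr : h.wi r = h.swap.av) (i : ℕ) : h.swap.s B i = h.s B (i + r) := by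
  unfold TS.s; rw [h.wi_swap hr]

lemma TS.r_swap (h : TT) {r : ℕ} (hr : h.wi r = h.swap.av) (hrd : r < h.dg) : h.swap.wi (h.dg - r) = h.av := by
  rw [h.wi_swap hr, show h.dg - r + r = 0 + h.dg by omega, h.wi_add]; rfl

lemma TS.r_pos (h : TT) {r : ℕ} (hr : h.wi r = h.swap.av) : 0 < r := by
  apply Nat.pos_of_ne_zero
  rintro rfl
  exact h.hab (Subtype.ext (congrArg (fun d => d.snd) hr))

lemma TS.side_eq2 (h : TT) {B : K.Dart → Prop} (hc : IsCPTLabelling F B) {r : ℕ} (hr : h.wi r = h.swap.av) (hrd : r < h.dg) :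
    ∑ i ∈ Finset.range (h.dg - r), h.m B (i + r) + ∑ i ∈ Finset.range (h.dg - r), h.s B (i + r) + h.t B = 3 := by
  have := h.swap.side_eq hc (r := h.dg - r) (h.r_swap hr hrd) (by rw [h.dg_swap]; have := h.r_pos hr; omega)
  simpa only [h.m_swap hr, h.s_swap hr] using this

lemma TS.end_a (h : TT) {B : K.Dart → Prop} (hc : IsCPTLabelling F B) : 1 ≤ h.s B 0 + h.t B := by
  by_contra h1
  have h2 : h.s B 0 = 0 := by omega
  have h3 : h.t B = 0 := by omega
  unfold TS.s at h2; unfold TS.t at h3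
  rw [ib_zero, not_not] at h2 h3
  have hH := h.isH_pre (h.wi_fst 0)
  refine h.up_ne hH (hc.one_big _ _ h2 h3 (Subtype.ext ?_))
  rw [(h.up_spec hH).1, pre_fst]; rfl

lemma TS.s_le (h : TT) (B : K.Dart → Prop) (i : ℕ) : h.s B i ≤ 1 := ib_le _
lemma TS.t_le (h : TT) (B : K.Dart → Prop) : h.t B ≤ 1 := ib_le _
end counting

section labelling
open scoped Classical
variable {V : Type} [Fintype V] {G : SimpleGraph V} {E : PlaneEmb G} {v : V} {a b : ↥({v}ᶜ : Set V)}
    {K : SimpleGraph ↥({v}ᶜ : Set V)} {F : PlaneEmb K}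
local notation "Vc" => (compl (Singleton.singleton v) : Set V)
local notation "TT" => TS G E v a b K F

def bi (d i : ℕ) : ℕ := if i = 0 then d else i

def TS.avl (h : TT) (B : K.Dart → Prop) (r i : ℕ) : Prop :=
  h.s B i = 0 ∨ (i = 0 ∧ h.t B = 0) ∨ (i = r ∧ h.swap.t B = 0)

def usd (d : ℕ) (aft bef : ℕ → Prop) (i : ℕ) : Prop := aft i ∨ bef (bi d i)

def TS.nu (h : TT) (B : K.Dart → Prop) (r : ℕ) (aft bef : ℕ → Prop) (i : ℕ) : Prop :=
  ¬ h.avl B r i ∨ usd h.dg aft bef i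

structure Sol (h : TT) (B : K.Dart → Prop) (r : ℕ) (aft vg bef : ℕ → Prop) : Prop where
  cnt : ∀ i < h.dg, ib (aft i) + ib (vg i) + ib (bef (i + 1)) = h.m B i
  av : ∀ i < h.dg, usd h.dg aft bef i → h.avl B r i
  ex : ∀ i < h.dg, ¬ (aft i ∧ bef (bi h.dg i))
  vu : ∀ i < h.dg, ∀ j < h.dg, vg i → vg j → i = j

def TS.lb (h : TT) (B : K.Dart → Prop) (aft vg bef : ℕ → Prop) (e : G.Dart) : Prop :=
  (cm v E e ∧ B (up F e)) ∨ (∃ i < h.dg, e = h.wi i ∧ vg i) ∨ (∃ i < h.dg, e = pre E (h.wi i) ∧ aft i) ∨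
    (∃ i < h.dg, e = (h.wi i).symm ∧ bef (bi h.dg i))

lemma TS.wi_not (h : TT) (i : ℕ) : ¬ isH v (h.wi i) := fun h' => h'.1 (h.wi_fst i)
lemma TS.wis_not (h : TT) (i : ℕ) : ¬ isH v (h.wi i).symm := fun h' => h'.2 (h.wi_fst i)
lemma TS.wi_wis (h : TT) (i j : ℕ) : h.wi i ≠ (h.wi j).symm := by
  intro h'
  have h1 := congrArg (fun d => d.fst) h'
  have h2 : (h.wi i).fst = (h.wi j).snd := h1
  rw [h.wi_fst] at h2
  exact (h.wi j).adj.ne ((h.wi_fst j).trans h2)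

variable {aft vg bef : ℕ → Prop} {B : K.Dart → Prop} {r : ℕ}

lemma TS.lb_cm (h : TT) {e : G.Dart} (he : cm v E e) : h.lb B aft vg bef e ↔ B (up F e) := by
  unfold TS.lb
  constructor
  · rintro (h1 | ⟨i, _, rfl, _⟩ | ⟨i, _, rfl, _⟩ | ⟨i, _, rfl, _⟩)
    · exact h1.2
    · exact absurd he.1 (h.wi_not i)
    · exact absurd he (h.not_cm_pre i)
    · exact absurd he.1 (h.wis_not i)
  · intro h1; exact Or.inl ⟨he, h1⟩

lemma TS.lb_wi (h : TT) {i : ℕ} (hi : i < h.dg) : h.lb B aft vg bef (h.wi i) ↔ vg i := by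
  unfold TS.lb
  constructor
  · rintro (h1 | ⟨j, hj, h1, h2⟩ | ⟨j, _, h1, _⟩ | ⟨j, _, h1, _⟩)
    · exact absurd h1.1.1 (h.wi_not i)
    · rwa [h.wi_inj hi hj h1]
    · exact absurd (h1 ▸ h.isH_pre (h.wi_fst j)) (h.wi_not i)
    · exact absurd h1 (h.wi_wis i j)
  · intro h1; exact Or.inr (Or.inl ⟨i, hi, rfl, h1⟩)

lemma TS.lb_pre (h : TT) {i : ℕ} (hi : i < h.dg) : h.lb B aft vg bef (pre E (h.wi i)) ↔ aft i := by
  unfold TS.lb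
  constructor
  · rintro (h1 | ⟨j, hj, h1, h2⟩ | ⟨j, hj, h1, h2⟩ | ⟨j, _, h1, _⟩)
    · exact absurd h1.1 (h.not_cm_pre i)
    · exact absurd (h1 ▸ h.isH_pre (h.wi_fst i)) (h.wi_not j)
    · rwa [h.pre_inj hi hj h1]
    · exact absurd (h1 ▸ h.isH_pre (h.wi_fst i)) (h.wis_not j)
  · intro h1; exact Or.inr (Or.inr (Or.inl ⟨i, hi, rfl, h1⟩))

lemma TS.lb_wis (h : TT) {i : ℕ} (hi : i < h.dg) : h.lb B aft vg bef (h.wi i).symm ↔ bef (bi h.dg i) := by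
  unfold TS.lb
  constructor
  · rintro (h1 | ⟨j, hj, h1, h2⟩ | ⟨j, hj, h1, h2⟩ | ⟨j, hj, h1, h2⟩)
    · exact absurd h1.1.1 (h.wis_not i)
    · exact absurd h1.symm (h.wi_wis j i)
    · exact absurd (h1 ▸ h.isH_pre (h.wi_fst j)) (h.wis_not i)
    · rwa [h.wi_inj hi hj (SimpleGraph.Dart.symm_involutive.injective h1)]
  · intro h1; exact Or.inr (Or.inr (Or.inr ⟨i, hi, rfl, h1⟩))

lemma TS.lb_wis' (h : TT) {i : ℕ} (hi : i < h.dg) : h.lb B aft vg bef (h.wi (i + 1)).symm ↔ bef (i + 1) := by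
  by_cases h1 : i + 1 < h.dg
  · rw [h.lb_wis h1, bi, if_neg (by omega)]
  · have h2 : i + 1 = 0 + h.dg := by omega
    rw [h2, h.wi_add, h.lb_wis h.dg_pos, bi, if_pos rfl, zero_add]

lemma TS.shift (h : TT) (f : G.Dart → ℕ) : ∑ i ∈ Finset.range h.dg, f (h.wi i).symm = ∑ i ∈ Finset.range h.dg, f (h.wi (i + 1)).symm := by
  have h1 := Finset.sum_range_succ (fun i => f (h.wi i).symm) h.dg
  have h2 := Finset.sum_range_succ' (fun i => f (h.wi i).symm) h.dg
  have h3 := h.wi_add 0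
  rw [zero_add] at h3
  rw [h3] at h1
  omega

lemma TS.kinds (h : TT) (e : G.Dart) : cm v E e ∨ (∃ i < h.dg, e = h.wi i) ∨ (∃ i < h.dg, e = pre E (h.wi i)) ∨ (∃ i < h.dg, e = (h.wi i).symm) := by
  by_cases h1 : e.fst = v
  · obtain ⟨i, hi, h2⟩ := h.wi_surj h1
    exact Or.inr (Or.inl ⟨i, hi, h2.symm⟩)
  by_cases h2 : e.snd = v
  · obtain ⟨i, hi, h3⟩ := h.wi_surj (w := e.symm) h2
    exact Or.inr (Or.inr (Or.inr ⟨i, hi, by rw [h3]; simp⟩))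
  have h3 : isH v e := ⟨h1, h2⟩
  by_cases h4 : isH v (E.rot e)
  · exact Or.inl ⟨h3, h4⟩
  · obtain ⟨i, hi, h5⟩ := h.pre_of h3 h4
    exact Or.inr (Or.inr (Or.inl ⟨i, hi, h5.symm⟩))

lemma TS.avl_no (h : TT) (hc : IsCPTLabelling F B) (hr : h.wi r = h.swap.av) {i : ℕ} (hi : h.avl B r i) {e : G.Dart} (he : cm v E e)
    (hf : e.fst = (h.wi i).snd) (hB : B (up F e)) : False := by
  have hH := h.isH_pre (h.wi_fst i)
  rcases hi with h1 | ⟨rfl, h1⟩ | ⟨rfl, h1⟩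
  · rw [TS.s, ib_zero, not_not] at h1
    have := hc.one_big _ _ hB h1 (Subtype.ext (by rw [(h.up_spec he.1).1, (h.up_spec hH).1, pre_fst, hf]))
    have := h.up_inj he.1 hH this
    exact h.not_cm_pre i (this ▸ he)
  · rw [TS.t, ib_zero, not_not] at h1
    exact h.up_ne he.1 (hc.one_big _ _ hB h1 (Subtype.ext (by rw [(h.up_spec he.1).1, hf]; rfl)))
  · rw [TS.t, ib_zero, not_not] at h1
    refine h.swap.up_ne he.1 (hc.one_big _ _ hB h1 (Subtype.ext (by rw [(h.up_spec he.1).1, hf, hr]; rfl)))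

lemma TS.snd_inj (h : TT) {i j : ℕ} (hi : i < h.dg) (hj : j < h.dg) (hij : (h.wi i).snd = (h.wi j).snd) : i = j :=
  h.wi_inj hi hj (dext ((h.wi_fst i).trans (h.wi_fst j).symm) hij)

lemma Sol.one_big {h : TT} (hs : Sol h B r aft vg bef) (hc : IsCPTLabelling F B) (hr : h.wi r = h.swap.av) (e e' : G.Dart)
    (he : h.lb B aft vg bef e) (he' : h.lb B aft vg bef e') (hf : e.fst = e'.fst) : e = e' := by
  have hne : ∀ i, (h.wi i).snd ≠ v := fun i h' => (h.wi i).adj.ne ((h.wi_fst i).trans h'.symm)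
  have hav : ∀ i < h.dg, (aft i ∨ bef (bi h.dg i)) → h.avl B r i := hs.av
  rcases h.kinds e with k | ⟨i, hi, rfl⟩ | ⟨i, hi, rfl⟩ | ⟨i, hi, rfl⟩ <;> rcases h.kinds e' with k' | ⟨j, hj, rfl⟩ | ⟨j, hj, rfl⟩ | ⟨j, hj, rfl⟩
  · rw [h.lb_cm k] at he; rw [h.lb_cm k'] at he'
    exact h.up_inj k.1 k'.1 (hc.one_big _ _ he he' (Subtype.ext (by rw [(h.up_spec k.1).1, (h.up_spec k'.1).1, hf])))
  · rw [h.wi_fst] at hf; exact absurd hf k.1.1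
  · rw [h.lb_cm k] at he; rw [h.lb_pre hj] at he'; rw [pre_fst] at hf
    exact (h.avl_no hc hr (hav j hj (Or.inl he')) k hf he).elim
  · rw [h.lb_cm k] at he; rw [h.lb_wis hj] at he'
    exact (h.avl_no hc hr (hav j hj (Or.inr he')) k hf he).elim
  · rw [h.wi_fst] at hf; exact absurd hf.symm k'.1.1
  · rw [h.lb_wi hi] at he; rw [h.lb_wi hj] at he'; rw [hs.vu i hi j hj he he']
  · rw [h.wi_fst, pre_fst] at hf; exact absurd hf.symm (hne j)
  · rw [h.wi_fst] at hf; exact absurd hf.symm (hne j)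
  · rw [h.lb_cm k'] at he'; rw [h.lb_pre hi] at he; rw [pre_fst] at hf
    exact (h.avl_no hc hr (hav i hi (Or.inl he)) k' hf.symm he').elim
  · rw [h.wi_fst, pre_fst] at hf; exact absurd hf (hne i)
  · rw [pre_fst, pre_fst] at hf; rw [h.snd_inj hi hj hf]
  · rw [pre_fst] at hf
    have := h.snd_inj hi hj hf; subst this
    rw [h.lb_pre hi] at he; rw [h.lb_wis hj] at he'
    exact absurd ⟨he, he'⟩ (hs.ex i hi)
  · rw [h.lb_cm k'] at he'; rw [h.lb_wis hi] at he
    exact (h.avl_no hc hr (hav i hi (Or.inr he)) k' hf.symm he').elim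
  · rw [h.wi_fst] at hf; exact absurd hf (hne i)
  · rw [pre_fst] at hf
    have := h.snd_inj hi hj hf; subst this
    rw [h.lb_pre hi] at he'; rw [h.lb_wis hj] at he
    exact absurd ⟨he', he⟩ (hs.ex i hi)
  · rw [h.snd_inj hi hj hf]

lemma Sol.outer_big {h : TT} (hs : Sol h B r aft vg bef) (hc : IsCPTLabelling F B) (e : G.Dart)
    (he : E.angleFace e = E.outer) : h.lb B aft vg bef e := by
  have h3 : ∀ i < h.dg, h.gp i = E.outer → aft i ∧ vg i ∧ bef (i + 1) := by
    intro i hi h1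
    have h2 := hs.cnt i hi
    rw [TS.m, if_pos h1] at h2
    have := ib_le (aft i)
    have := ib_le (vg i)
    have := ib_le (bef (i + 1))
    exact ⟨ib_one.1 (by omega), ib_one.1 (by omega), ib_one.1 (by omega)⟩
  rcases h.kinds e with k | ⟨i, hi, rfl⟩ | ⟨i, hi, rfl⟩ | ⟨i, hi, rfl⟩
  · rw [h.lb_cm k]
    apply hc.outer_big
    rw [h.cm_face k.1]; exact h.outer_lam he
  · rw [h.lb_wi hi]; exact (h3 i hi he).2.1
  · rw [h.lb_pre hi]; rw [h.gp_pre] at he; exact (h3 i hi he).1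
  · rcases Nat.eq_zero_or_pos i with rfl | hi0
    · have h4 : h.wi 0 = h.wi (h.dg - 1 + 1) := by
        rw [show h.dg - 1 + 1 = 0 + h.dg by omega, h.wi_add]
      rw [h4, h.gp_bef] at he
      rw [h4, h.lb_wis' (by omega)]
      exact (h3 _ (by omega) he).2.2
    · obtain ⟨j, rfl⟩ : ∃ j, i = j + 1 := ⟨i - 1, by omega⟩
      rw [h.gp_bef] at he
      rw [h.lb_wis' (by omega)]
      exact (h3 _ (by omega) he).2.2

lemma ib_not (p : Prop) : ib (¬ p) + ib p = 1 := by
  unfold ib; by_cases h : p <;> simp [h]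

lemma Sol.gap_count {h : TT} (hs : Sol h B r aft vg bef) {j : ℕ} (hj : j < h.dg) (ho : h.gp j ≠ E.outer) :
    ∑ e, ib (E.angleFace e = h.gp j ∧ ¬ h.lb B aft vg bef e) = 3 := by
  rw [h.G_sum, h.shift (fun e => ib (E.angleFace e = h.gp j ∧ ¬ h.lb B aft vg bef e))]
  have key : ∀ (f : ℕ → G.Dart) (P : ℕ → Prop), (∀ i, E.angleFace (f i) = h.gp i) → (∀ i < h.dg, (h.lb B aft vg bef (f i) ↔ P i)) →
      ∑ i ∈ Finset.range h.dg, ib (E.angleFace (f i) = h.gp j ∧ ¬ h.lb B aft vg bef (f i)) = ib (¬ P j) := by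
    intro f P h1 h2
    rw [Finset.sum_eq_single j]
    · rw [h1, h2 j hj]; congr 1; simp
    · intro i hi hij
      apply ib_f; rintro ⟨h3, _⟩
      rw [h1] at h3
      exact hij (h.gp_inj (Finset.mem_range.1 hi) hj h3)
    · intro h'; exact absurd (Finset.mem_range.2 hj) h'
  rw [key (fun i => pre E (h.wi i)) aft h.gp_pre (fun i hi => h.lb_pre hi),
    key (fun i => (h.wi (i+1)).symm) (fun i => bef (i + 1)) h.gp_bef (fun i hi => h.lb_wis' hi),
    key (fun i => h.wi i) vg (fun i => rfl) (fun i hi => h.lb_wi hi)]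
  have h1 : ∑ e with cm v E e, ib (E.angleFace e = h.gp j ∧ ¬ h.lb B aft vg bef e) = h.m0 B j := by
    unfold TS.m0
    apply Finset.sum_congr rfl
    intro e he
    rw [h.lb_cm (Finset.mem_filter.1 he).2]
  have h2 := hs.cnt j hj
  rw [TS.m, if_neg ho] at h2
  rw [h1]
  have := ib_not (aft j); have := ib_not (vg j); have := ib_not (bef (j + 1))
  omega

lemma TS.lam12 (h : TT) {i : ℕ} (hi : i < h.dg) : lam v E F (h.wi i).symm = F.dartFace h.ab ∨ lam v E F (h.wi i).symm = F.dartFace h.swap.ab := by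
  obtain ⟨r, h1, h2, h3⟩ := h.ex_r
  by_cases hir : i < r
  · exact Or.inl (h.lam_side h3 h2 hir)
  · exact Or.inr (h.lam_side2 h3 h2 (by omega) hi)

lemma Sol.nov_count {h : TT} (hs : Sol h B r aft vg bef) (hc : IsCPTLabelling F B) {Q : E.Face} (hQ : nov v E Q) (ho : Q ≠ E.outer) :
    ∑ e, ib (E.angleFace e = Q ∧ ¬ h.lb B aft vg bef e) = 3 := by
  obtain ⟨e0, rfl⟩ : ∃ e0, E.dartFace e0 = Q := Quotient.exists_rep Q
  have hne : ∀ i < h.dg, lam v E F (h.wi i).symm ≠ F.dartFace (up F e0) := by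
    intro i hi h'
    rcases h.lam12 hi with h1 | h1
    · exact h.nov_ne hQ (h'.symm.trans h1)
    · exact h.swap.nov_ne hQ (h'.symm.trans h1)
  have hout : F.dartFace (up F e0) ≠ F.outer := by
    intro h'
    obtain ⟨x, d, _, _, h4⟩ := h.ind.2
    have h5 := h.outer_lam h4
    by_cases hn : nov v E E.outer
    · have hd := hn d h4
      rw [lam_isH hd, ← h'] at h5
      obtain ⟨e', h6, h7, h8⟩ := h.nov_face hQ h5.symm
      have := h.up_inj hd h6 h7
      subst this
      exact ho (h8.symm.trans h4)
    · obtain ⟨i, hi, h6⟩ := h.gp_touch hn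
      exact hne i hi ((h.outer_lam (e := (h.wi i).symm) h6.symm).trans h'.symm)
  have h0 := hc.bounded_small _ hout
  rw [card_ib, h.K_sum] at h0
  rw [h.G_sum]
  have hz : ∀ i, E.dartFace e0 ≠ h.gp i := fun i h' => h.gp_not_nov i (h' ▸ hQ)
  rw [Finset.sum_eq_zero (s := Finset.range h.dg) (f := fun i => ib (F.angleFace (up F (pre E (h.wi i))) = F.dartFace (up F e0) ∧ ¬ B (up F (pre E (h.wi i))))), ib_f, ib_f] at h0
  · rw [h.shift (fun e => ib (E.angleFace e = E.dartFace e0 ∧ ¬ h.lb B aft vg bef e))]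
    rw [Finset.sum_eq_zero (s := Finset.range h.dg), Finset.sum_eq_zero (s := Finset.range h.dg), Finset.sum_eq_zero (s := Finset.range h.dg)]
    · rw [← h0]
      simp only [add_zero]
      apply Finset.sum_congr rfl
      intro e he
      have he' := (Finset.mem_filter.1 he).2
      rw [h.lb_cm he']
      congr 1
      have : E.angleFace e = E.dartFace e0 ↔ F.angleFace (up F e) = F.dartFace (up F e0) := by
        rw [h.cm_face he'.1]
        constructor
        · intro h1
          rw [h.lam_face h1, lam_isH (hQ e0 rfl)]
        · intro h1
          rw [lam_isH he'.1.symm] at h1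
          obtain ⟨e', h6, h7, h8⟩ := h.nov_face hQ h1.symm
          rw [← h.up_inj he'.1.symm h6 h7] at h8
          exact h8
      rw [this]
    · intro i hi; apply ib_f; rintro ⟨h1, _⟩; exact hz i h1.symm
    · intro i hi; apply ib_f; rintro ⟨h1, _⟩; rw [h.gp_bef] at h1; exact hz i h1.symm
    · intro i hi; apply ib_f; rintro ⟨h1, _⟩; rw [h.gp_pre] at h1; exact hz i h1.symm
  · rintro ⟨h1, _⟩; exact h.nov_ne hQ h1.symm
  · rintro ⟨h1, _⟩; exact h.swap.nov_ne hQ h1.symm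
  · intro i hi; apply ib_f; rintro ⟨h1, _⟩; rw [h.pre_face] at h1; exact hne i (Finset.mem_range.1 hi) h1

lemma Sol.cpt {h : TT} (hs : Sol h B r aft vg bef) (hc : IsCPTLabelling F B) (hr : h.wi r = h.swap.av) :
    IsCPTLabelling E (h.lb B aft vg bef) where
  bounded_small Q hQ := by
    rw [card_ib]
    by_cases hn : nov v E Q
    · exact hs.nov_count hc hn hQ
    · obtain ⟨j, hj, rfl⟩ := h.gp_touch hn
      exact hs.gap_count hj hQ
  outer_big := hs.outer_big hc
  one_big := hs.one_big hc hr

lemma TS.ext_lb (h : TT) : ExtendsAddLabel G v a b K E F (h.lb B aft vg bef) B := by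
  intro x e h1 h2 h3 h4
  have key : ∀ (x : K.Dart) (e : G.Dart), AddCorr G v a b K x e → x.fst ≠ a → x.fst ≠ b → isH v e := by
    rintro x e (h1 | h1 | h1) h3 h4
    · have e1 : e.fst = x.fst := congrArg Prod.fst h1
      have e2 : e.snd = x.snd := congrArg Prod.snd h1
      exact ⟨e1 ▸ x.fst.2, e2 ▸ x.snd.2⟩
    · exact absurd h1.1 h3
    · exact absurd h1.1 h4
  have hH := key x e h1 h3 h4
  have hc : cm v E e := ⟨hH, key _ _ h2 (by rwa [F.rot_fst]) (by rwa [F.rot_fst])⟩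
  rw [h.lb_cm hc, h.corr hH h1]
end labelling

section slackG
open scoped Classical
variable {V : Type} [Fintype V] {G : SimpleGraph V} {E : PlaneEmb G} {v : V} {a b : ↥({v}ᶜ : Set V)}
    {K : SimpleGraph ↥({v}ᶜ : Set V)} {F : PlaneEmb K}
local notation "Vc" => (compl (Singleton.singleton v) : Set V)
local notation "TT" => TS G E v a b K F
variable {aft vg bef : ℕ → Prop} {B : K.Dart → Prop} {r : ℕ}

def TS.yi (h : TT) (i : ℕ) : ↥Vc := ⟨(h.wi i).snd, fun h' => (h.wi i).adj.ne ((h.wi_fst i).trans (Eq.symm h'))⟩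

lemma TS.yi_inj (h : TT) {i j : ℕ} (hi : i < h.dg) (hj : j < h.dg) (hij : h.yi i = h.yi j) : i = j :=
  h.snd_inj hi hj (congrArg Subtype.val hij)

lemma TS.yi_zero (h : TT) : h.yi 0 = a := rfl
lemma TS.yi_r (h : TT) (hr : h.wi r = h.swap.av) : h.yi r = b := by
  apply Subtype.ext; change (h.wi r).snd = b; rw [hr]; rfl

lemma TS.pt_lb (h : TT) (z : ↥Vc) :
    PointedVx (h.lb B aft vg bef) (z : V) ↔ (∃ e, cm v E e ∧ B (up F e) ∧ e.fst = z) ∨ ∃ i < h.dg, h.yi i = z ∧ usd h.dg aft bef i := by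
  constructor
  · rintro ⟨e, he, hz⟩
    rcases h.kinds e with k | ⟨i, hi, rfl⟩ | ⟨i, hi, rfl⟩ | ⟨i, hi, rfl⟩
    · exact Or.inl ⟨e, k, (h.lb_cm k).1 he, hz⟩
    · exact absurd ((h.wi_fst i).symm.trans hz) (Ne.symm z.2)
    · exact Or.inr ⟨i, hi, Subtype.ext ((pre_fst _).symm.trans hz), Or.inl ((h.lb_pre hi).1 he)⟩
    · exact Or.inr ⟨i, hi, Subtype.ext hz, Or.inr ((h.lb_wis hi).1 he)⟩
  · rintro (⟨e, k, h1, hz⟩ | ⟨i, hi, rfl, h1 | h1⟩)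
    · exact ⟨e, (h.lb_cm k).2 h1, hz⟩
    · exact ⟨_, (h.lb_pre hi).2 h1, pre_fst _⟩
    · exact ⟨_, (h.lb_wis hi).2 h1, rfl⟩

lemma TS.pt_B (h : TT) (hr : h.wi r = h.swap.av) (hrd : r < h.dg) (z : ↥Vc) :
    PointedVx B z ↔ (∃ e, cm v E e ∧ B (up F e) ∧ e.fst = z) ∨ ∃ i < h.dg, h.yi i = z ∧ h.avl B r i := by
  constructor
  · rintro ⟨x, hx, rfl⟩
    rcases h.cls x with ⟨e, he, rfl⟩ | rfl | rfl
    · by_cases h4 : isH v (E.rot e)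
      · exact Or.inl ⟨e, ⟨he, h4⟩, hx, (h.up_spec he).1.symm⟩
      · obtain ⟨i, hi, rfl⟩ := h.pre_of he h4
        refine Or.inr ⟨i, hi, Subtype.ext ?_, Or.inl ?_⟩
        · rw [(h.up_spec he).1, pre_fst]; rfl
        · rw [TS.s, ib_zero, not_not]; exact hx
    · exact Or.inr ⟨0, h.dg_pos, rfl, Or.inr (Or.inl ⟨rfl, by rw [TS.t, ib_zero, not_not]; exact hx⟩)⟩
    · exact Or.inr ⟨r, hrd, h.yi_r hr, Or.inr (Or.inr ⟨rfl, by rw [TS.t, ib_zero, not_not]; exact hx⟩)⟩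
  · rintro (⟨e, k, h1, hz⟩ | ⟨i, hi, rfl, h1 | ⟨rfl, h1⟩ | ⟨rfl, h1⟩⟩)
    · exact ⟨_, h1, Subtype.ext (by rw [(h.up_spec k.1).1, hz])⟩
    · rw [TS.s, ib_zero, not_not] at h1
      exact ⟨_, h1, Subtype.ext (by rw [(h.up_spec (h.isH_pre (h.wi_fst i))).1, pre_fst]; rfl)⟩
    · rw [TS.t, ib_zero, not_not] at h1
      exact ⟨_, h1, rfl⟩
    · rw [TS.t, ib_zero, not_not] at h1
      exact ⟨_, h1, (h.yi_r hr).symm⟩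

lemma TS.wt_lb (h : TT) (hs : Sol h B r aft vg bef) (hc : IsCPTLabelling F B) (hr : h.wi r = h.swap.av) (hrd : r < h.dg) (z : ↥Vc) :
    wt (h.lb B aft vg bef) (z : V) = wt B z + ((ib (∃ i < h.dg, h.yi i = z ∧ ¬ h.nu B r aft bef i) : ℕ) : ℤ) := by
  have hno : ∀ e, cm v E e → B (up F e) → e.fst = z → ∀ i, h.yi i = z → h.avl B r i → False := by
    rintro e k h1 hz i rfl hi
    exact h.avl_no hc hr hi k hz h1
  unfold wt
  rw [h.pt_lb, h.pt_B hr hrd]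
  by_cases h0 : ∃ e, cm v E e ∧ B (up F e) ∧ e.fst = z
  · rw [if_pos (Or.inl h0), if_pos (Or.inl h0), ib_f]; · simp
    rintro ⟨i, hi, h1, h2⟩
    obtain ⟨e, k, h3, h4⟩ := h0
    rw [TS.nu, not_or, not_not] at h2
    exact hno e k h3 h4 i h1 h2.1
  simp only [h0, false_or]
  by_cases h1 : ∃ i < h.dg, h.yi i = z
  · obtain ⟨i, hi, rfl⟩ := h1
    have key : ∀ P : ℕ → Prop, (∃ j < h.dg, h.yi j = h.yi i ∧ P j) ↔ P i := fun P =>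
      ⟨fun ⟨j, hj, h3, h4⟩ => by rwa [← h.yi_inj hj hi h3], fun h4 => ⟨i, hi, rfl, h4⟩⟩
    simp only [key]
    have := hs.av i hi
    unfold TS.nu ib
    by_cases h3 : usd h.dg aft bef i <;> by_cases h4 : h.avl B r i <;> simp_all
  · rw [if_neg, if_neg, ib_f]
    · simp
    all_goals rintro ⟨i, hi, h2, _⟩; exact h1 ⟨i, hi, h2⟩

lemma ib_sum {α : Type} (s : Finset α) (P : α → Prop) (hu : ∀ i ∈ s, ∀ j ∈ s, P i → P j → i = j) : ib (∃ i ∈ s, P i) = ∑ i ∈ s, ib (P i) := by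
  by_cases h : ∃ i ∈ s, P i
  · rw [ib_t h]
    obtain ⟨i, hi, h1⟩ := h
    rw [Finset.sum_eq_single i, ib_t h1]
    · intro j hj hji; exact ib_f fun h2 => hji (hu _ hj _ hi h2 h1)
    · intro h'; exact absurd hi h'
  · rw [ib_f h, Finset.sum_eq_zero]
    intro i hi; exact ib_f fun h2 => h ⟨i, hi, h2⟩

lemma ib_and (p q : Prop) : ib (p ∧ q) + ib (p ∧ ¬ q) = ib p := by
  unfold ib; by_cases h : p <;> by_cases h' : q <;> simp [h, h']

lemma TS.np_sum (h : TT) (P : ℕ → Prop) (S : Finset ↥Vc) :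
    ∑ z ∈ S, ib (∃ i < h.dg, h.yi i = z ∧ P i) = ∑ i ∈ Finset.range h.dg, ib (h.yi i ∈ S ∧ P i) := by
  have h1 : ∀ z ∈ S, ib (∃ i < h.dg, h.yi i = z ∧ P i) = ∑ i ∈ Finset.range h.dg, ib (h.yi i = z ∧ P i) := by
    intro z _
    rw [← ib_sum]
    · simp only [Finset.mem_range]
    · intro i hi j hj h1 h2
      exact h.yi_inj (Finset.mem_range.1 hi) (Finset.mem_range.1 hj) (h1.1.trans h2.1.symm)
  rw [Finset.sum_congr rfl h1, Finset.sum_comm]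
  apply Finset.sum_congr rfl
  intro i _
  rw [← ib_sum]
  · congr 1
    simp
  · rintro x _ y _ h1 h2; exact h1.1.symm.trans h2.1

lemma TS.nu_count (h : TT) (hs : Sol h B r aft vg bef) (hc : IsCPTLabelling F B) (hr : h.wi r = h.swap.av) (hrd : r < h.dg) :
    ∑ i ∈ Finset.range h.dg, ib (h.nu B r aft bef i) + ib (∃ i < h.dg, vg i) = 4 := by
  have h1 : ib (∃ i < h.dg, vg i) = ∑ i ∈ Finset.range h.dg, ib (vg i) := by
    rw [← ib_sum]
    · simp only [Finset.mem_range]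
    · intro i hi j hj; exact hs.vu i (Finset.mem_range.1 hi) j (Finset.mem_range.1 hj)
  have h2 : ∑ i ∈ Finset.range h.dg, ib (h.nu B r aft bef i) = ∑ i ∈ Finset.range h.dg, ib (¬ h.avl B r i) + ∑ i ∈ Finset.range h.dg, ib (aft i) + ∑ i ∈ Finset.range h.dg, ib (bef (bi h.dg i)) := by
    rw [← Finset.sum_add_distrib, ← Finset.sum_add_distrib]
    apply Finset.sum_congr rfl
    intro i hi
    have := hs.av i (Finset.mem_range.1 hi)
    have := hs.ex i (Finset.mem_range.1 hi)
    unfold TS.nu usd ib at *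
    by_cases h3 : aft i <;> by_cases h4 : h.avl B r i <;> by_cases h5 : bef (bi h.dg i) <;> simp_all
  have h3 : ∑ i ∈ Finset.range h.dg, ib (bef (bi h.dg i)) = ∑ i ∈ Finset.range h.dg, ib (bef (i + 1)) := by
    have h4 := h.shift (fun e => ib (h.lb (fun _ => True) aft vg bef e))
    rw [Finset.sum_congr rfl (g := fun i => ib (bef (bi h.dg i))), Finset.sum_congr rfl (s₁ := Finset.range h.dg) (f := fun i => ib (h.lb (fun _ => True) aft vg bef (h.wi (i+1)).symm)) (g := fun i => ib (bef (i + 1)))] at h4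
    · exact h4
    · intro i hi; beta_reduce; rw [h.lb_wis' (Finset.mem_range.1 hi)]
    · intro i hi; beta_reduce; rw [h.lb_wis (Finset.mem_range.1 hi)]
  have h4 := Finset.sum_congr rfl (fun i hi => hs.cnt i (Finset.mem_range.1 hi))
  rw [Finset.sum_add_distrib, Finset.sum_add_distrib] at h4
  have hr0 := h.r_pos hr
  have h5 : ∀ i ∈ Finset.range h.dg, ib (¬ h.avl B r i) + (if i = 0 then 1 else 0) + (if i = r then 1 else 0) = h.s B i + (if i = 0 then h.t B else 0) + (if i = r then h.swap.t B else 0) := by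
    intro i hi
    have e1 := h.end_a hc
    have e2 := h.swap.end_a hc
    rw [h.s_swap hr, zero_add] at e2
    have e3 := h.s_le B i
    have e4 := h.t_le B
    have e5 := h.swap.t_le B
    have e6 := h.s_le B 0
    have e7 := h.s_le B r
    unfold TS.avl ib
    by_cases hi0 : i = 0
    · subst hi0
      have : ¬ (0 = r) := by omega
      simp only [this, false_and, or_false, true_and, if_true, if_false]
      split_ifs with g <;> omega
    · by_cases hir : i = r
      · subst hir
        simp only [hi0, false_and, false_or, true_and, if_true, if_false]
        split_ifs with g <;> omega
      · simp only [hi0, hir, false_and, or_false, if_false]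
        split_ifs with g <;> omega
  have h6 := Finset.sum_congr rfl h5
  simp only [Finset.sum_add_distrib] at h6
  rw [Finset.sum_ite_eq' , Finset.sum_ite_eq', Finset.sum_ite_eq', Finset.sum_ite_eq', if_pos (Finset.mem_range.2 h.dg_pos), if_pos (Finset.mem_range.2 hrd), if_pos (Finset.mem_range.2 h.dg_pos), if_pos (Finset.mem_range.2 hrd)] at h6
  have h7 := h.side_eq hc hr hrd
  have h8 := h.side_eq2 hc hr hrd
  have h9 : ∀ f : ℕ → ℕ, ∑ i ∈ Finset.range h.dg, f i = ∑ i ∈ Finset.range r, f i + ∑ i ∈ Finset.range (h.dg - r), f (i + r) := by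
    intro f
    conv_lhs => rw [show h.dg = r + (h.dg - r) by omega]
    rw [Finset.sum_range_add]
    congr 1; apply Finset.sum_congr rfl; intro i _; rw [add_comm]
  rw [h9 (h.m B)] at h4
  rw [h9 (h.s B)] at h6
  omega

lemma TS.ec_map (h : TT) (S : Finset ↥Vc) :
    ec K S = ec G (S.map (Function.Embedding.subtype _)) + ib (a ∈ S ∧ b ∈ S) := by
  have h1 : K = G.comap (Subtype.val : ↥Vc → V) ⊔ SimpleGraph.fromEdgeSet {s(a, b)} := by
    ext x y
    have := h.hab
    rw [h.hK, SimpleGraph.sup_adj, SimpleGraph.comap_adj, SimpleGraph.fromEdgeSet_adj, Set.mem_singleton_iff, Sym2.eq_iff]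
    constructor
    · rintro (h1 | ⟨rfl, rfl⟩ | ⟨rfl, rfl⟩) <;> simp_all [Ne.symm]
    · tauto
  have h2 : ec (G.comap (Subtype.val : ↥Vc → V)) S = ec G (S.map (Function.Embedding.subtype _)) := by
    unfold ec
    rw [← Set.ncard_image_of_injective _ (Sym2.map.injective (Subtype.val_injective (p := (· ∈ Vc))))]
    congr 1
    ext ⟨x, y⟩
    change s(x, y) ∈ _ ↔ s(x, y) ∈ _
    rw [mem_ES]
    constructor
    · rintro ⟨⟨x', y'⟩, h3, h4⟩
      change s(x', y') ∈ _ at h3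
      rw [mem_ES] at h3
      rcases Sym2.eq_iff.1 h4 with ⟨rfl, rfl⟩ | ⟨rfl, rfl⟩
      · exact ⟨h3.1, Finset.mem_map_of_mem _ h3.2.1, Finset.mem_map_of_mem _ h3.2.2⟩
      · exact ⟨h3.1.symm, Finset.mem_map_of_mem _ h3.2.2, Finset.mem_map_of_mem _ h3.2.1⟩
    · rintro ⟨h3, h4, h5⟩
      obtain ⟨x', h6, rfl⟩ := Finset.mem_map.1 h4
      obtain ⟨y', h7, rfl⟩ := Finset.mem_map.1 h5
      exact ⟨s(x', y'), mem_ES.2 ⟨h3, h6, h7⟩, rfl⟩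
  conv_lhs => rw [h1]
  rw [ec_add_edge _ h.hab (by rw [SimpleGraph.comap_adj]; exact h.hnab), h2, ib]
  split_ifs <;> rfl

lemma TS.nb_card (h : TT) (S : Finset ↥Vc) :
    (nb G (insert v (S.map (Function.Embedding.subtype _))) v).card = ∑ i ∈ Finset.range h.dg, ib (h.yi i ∈ S) := by
  have hh : ∑ i ∈ Finset.range h.dg, ib (h.yi i ∈ S) = ((Finset.range h.dg).filter (fun i => h.yi i ∈ S)).card := by
    rw [Finset.card_filter]
    exact Finset.sum_congr rfl (fun i _ => by unfold ib; split_ifs <;> rfl)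
  rw [hh]
  symm
  apply Finset.card_bij (fun i _ => (h.yi i : V))
  · intro i hi
    rw [Finset.mem_filter] at hi
    rw [mem_nb]
    refine ⟨Finset.mem_insert_of_mem (Finset.mem_map_of_mem _ hi.2), ?_⟩
    have := (h.wi i).adj
    rwa [h.wi_fst] at this
  · intro i hi j hj hij
    rw [Finset.mem_filter, Finset.mem_range] at hi hj
    exact h.yi_inj hi.1 hj.1 (Subtype.ext hij)
  · intro y hy
    rw [mem_nb] at hy
    obtain ⟨i, hi, h1⟩ := h.wi_surj (w := ⟨(v, y), hy.2⟩) rfl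
    have h2 : (h.yi i : V) = y := congrArg (fun d => d.snd) h1
    refine ⟨i, ?_, h2⟩
    rw [Finset.mem_filter, Finset.mem_range]
    refine ⟨hi, ?_⟩
    rcases Finset.mem_insert.1 hy.1 with h3 | h3
    · exact absurd h3.symm hy.2.ne
    · obtain ⟨z, hz, h4⟩ := Finset.mem_map.1 h3
      rwa [show h.yi i = z from Subtype.ext (h2.trans h4.symm)]

lemma TS.genLaman (h : TT) (hs : Sol h B r aft vg bef) (hc : IsCPTLabelling F B) (hL : Spr K (wt B)) (hr : h.wi r = h.swap.av) (hrd : r < h.dg)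
    (hS : ∀ S : Finset ↥Vc, 2 ≤ S.card → slk K (wt B) S = 0 → (∀ i < h.dg, h.nu B r aft bef i → h.yi i ∈ S) → a ∈ S ∧ b ∈ S) :
    GenLaman G (h.lb B aft vg bef) := by
  rw [genLaman_iff]
  intro S hS2
  let S' : Finset ↥Vc := Finset.univ.filter (fun x => (x : V) ∈ S)
  have hmem : ∀ x, x ∈ S.erase v ↔ x ∈ S'.map (Function.Embedding.subtype _) := by
    intro x
    simp only [Finset.mem_erase, Finset.mem_map, Function.Embedding.subtype_apply]
    constructor
    · rintro ⟨h1, h2⟩; exact ⟨⟨x, h1⟩, Finset.mem_filter.2 ⟨Finset.mem_univ _, h2⟩, rfl⟩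
    · rintro ⟨z, hz, rfl⟩; exact ⟨z.2, (Finset.mem_filter.1 hz).2⟩
  have he : S.erase v = S'.map (Function.Embedding.subtype _) := Finset.ext hmem
  have hsl : slk G (wt (h.lb B aft vg bef)) (S'.map (Function.Embedding.subtype _)) = slk K (wt B) S' + ((∑ i ∈ Finset.range h.dg, ib (h.yi i ∈ S' ∧ ¬ h.nu B r aft bef i) : ℕ) : ℤ) + (ib (a ∈ S' ∧ b ∈ S') : ℤ) := by
    unfold slk
    rw [h.ec_map, Finset.sum_map, ← h.np_sum]
    have hw : ∑ x ∈ S', wt (h.lb B aft vg bef) ((Function.Embedding.subtype fun x => x ∈ Vc) x) = _ := Finset.sum_congr rfl (fun z _ => h.wt_lb hs hc hr hrd z)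
    rw [hw, Finset.sum_add_distrib]
    push_cast; ring
  by_cases hv : v ∈ S
  · rw [slk_erase G _ hv, he, hsl]
    have h1 : (nb G S v).card = ∑ i ∈ Finset.range h.dg, ib (h.yi i ∈ S') := by
      rw [← h.nb_card, ← he, Finset.insert_erase hv]
    have h2 : ∑ i ∈ Finset.range h.dg, ib (h.yi i ∈ S') = ∑ i ∈ Finset.range h.dg, ib (h.yi i ∈ S' ∧ h.nu B r aft bef i) + ∑ i ∈ Finset.range h.dg, ib (h.yi i ∈ S' ∧ ¬ h.nu B r aft bef i) := by
      rw [← Finset.sum_add_distrib]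
      exact Finset.sum_congr rfl fun i _ => (ib_and _ _).symm
    have h3 : ∑ i ∈ Finset.range h.dg, ib (h.yi i ∈ S' ∧ h.nu B r aft bef i) + ∑ i ∈ Finset.range h.dg, ib (h.nu B r aft bef i ∧ ¬ h.yi i ∈ S') = ∑ i ∈ Finset.range h.dg, ib (h.nu B r aft bef i) := by
      rw [← Finset.sum_add_distrib]
      refine Finset.sum_congr rfl fun i _ => ?_
      rw [and_comm]; exact ib_and _ _
    have h4 := h.nu_count hs hc hr hrd
    have h5 : wt (h.lb B aft vg bef) v = 3 - (ib (∃ i < h.dg, vg i) : ℤ) := by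
      have : PointedVx (h.lb B aft vg bef) v ↔ ∃ i < h.dg, vg i := by
        constructor
        · rintro ⟨e, he, hz⟩
          obtain ⟨i, hi, rfl⟩ := h.wi_surj hz
          exact ⟨i, hi, (h.lb_wi hi).1 he⟩
        · rintro ⟨i, hi, h1⟩
          exact ⟨_, (h.lb_wi hi).2 h1, h.wi_fst i⟩
      unfold wt ib; rw [this]; split_ifs <;> simp
    have h6 : S'.card + 1 = S.card := by
      rw [← Finset.card_map (Function.Embedding.subtype _), ← he, Finset.card_erase_add_one hv]
    rw [h1, h2, h5]
    by_cases h7 : 2 ≤ S'.card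
    · have h8 := hL S' h7
      by_contra h9
      push Not at h9
      rw [← h3] at h4
      generalize ∑ i ∈ Finset.range h.dg, ib (h.yi i ∈ S' ∧ ¬ h.nu B r aft bef i) = N1 at *
      have e0 : slk K (wt B) S' = 0 ∧ ib (a ∈ S' ∧ b ∈ S') = 0 ∧ ∑ i ∈ Finset.range h.dg, ib (h.nu B r aft bef i ∧ ¬ h.yi i ∈ S') = 0 := by
        generalize ∑ i ∈ Finset.range h.dg, ib (h.yi i ∈ S' ∧ h.nu B r aft bef i) = N2 at *
        generalize ∑ i ∈ Finset.range h.dg, ib (h.nu B r aft bef i ∧ ¬ h.yi i ∈ S') = N3 at *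
        generalize slk K (wt B) S' = N4 at *
        omega
      obtain ⟨e1, e2, e3⟩ := e0
      refine ib_zero.1 e2 (hS S' h7 e1 fun i hi hn => ?_)
      have := Finset.sum_eq_zero_iff.1 e3 i (Finset.mem_range.2 hi)
      rw [ib_zero] at this
      by_contra h'; exact this ⟨hn, h'⟩
    · obtain ⟨x, hx⟩ := Finset.card_eq_one.1 (show S'.card = 1 by omega)
      have e1 : -1 ≤ slk K (wt B) S' := by
        rw [hx, slk, Finset.sum_singleton, ec_singleton]; unfold wt; split_ifs <;> norm_num
      have e2 : ∑ i ∈ Finset.range h.dg, ib (h.yi i ∈ S' ∧ h.nu B r aft bef i) ≤ 1 := by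
        rw [← ib_sum]
        · exact ib_le _
        · intro i hi j hj h1 h2
          rw [hx, Finset.mem_singleton] at h1 h2
          exact h.yi_inj (Finset.mem_range.1 hi) (Finset.mem_range.1 hj) (h1.1.trans h2.1.symm)
      have e3 := ib_le (∃ i < h.dg, vg i)
      generalize ∑ i ∈ Finset.range h.dg, ib (h.yi i ∈ S' ∧ ¬ h.nu B r aft bef i) = N1 at *
      generalize ∑ i ∈ Finset.range h.dg, ib (h.yi i ∈ S' ∧ h.nu B r aft bef i) = N2 at *
      generalize slk K (wt B) S' = N4 at *
      omega
  · rw [Finset.erase_eq_of_notMem hv] at he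
    rw [he, hsl]
    have := hL S' (by rw [← Finset.card_map (Function.Embedding.subtype _), ← he]; exact hS2)
    positivity
end slackG

section matching
open scoped Classical

def cn (j x y z : ℕ) : ℕ := (if j = x then 1 else 0) + (if j = y then 1 else 0) + (if j = z then 1 else 0)

lemma peel {n k : ℕ} {P : ℕ → ℕ} (h : ∑ j ∈ Finset.range n, P j = k + 1) :
    ∃ p < n, (∀ j < p, P j = 0) ∧ ∃ P' : ℕ → ℕ, (∀ j, P j = (if j = p then 1 else 0) + P' j) ∧ ∑ j ∈ Finset.range n, P' j = k := by
  have hex : ∃ p, p < n ∧ P p ≠ 0 := by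
    by_contra h'
    push Not at h'
    rw [Finset.sum_eq_zero] at h
    · omega
    · intro j hj; exact h' j (Finset.mem_range.1 hj)
  have hm := Nat.find_spec hex
  have hl := fun j hj => Nat.find_min hex (m := j) hj
  generalize Nat.find hex = p at hm hl
  have hP : ∀ j, P j = (if j = p then 1 else 0) + (P j - if j = p then 1 else 0) := by
    intro j; split_ifs with h1
    · subst h1; omega
    · omega
  refine ⟨p, hm.1, ?_, fun j => P j - (if j = p then 1 else 0), hP, ?_⟩
  · intro j hj
    have := hl j hj
    by_contra h'; exact this ⟨by omega, h'⟩
  · have h5 := Finset.sum_congr (rfl : Finset.range n = _) (fun j _ => hP j)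
    rw [Finset.sum_add_distrib, Finset.sum_ite_eq', if_pos (Finset.mem_range.2 hm.1), h] at h5
    beta_reduce
    omega

lemma tokens {n : ℕ} {P : ℕ → ℕ} (h : ∑ j ∈ Finset.range n, P j = 3) :
    ∃ p1 p2 p3, p1 ≤ p2 ∧ p2 ≤ p3 ∧ p3 < n ∧ ∀ j < n, P j = cn j p1 p2 p3 := by
  obtain ⟨p1, h1, h2, P1, h3, h4⟩ := peel h
  obtain ⟨p2, h5, h6, P2, h7, h8⟩ := peel h4
  obtain ⟨p3, h9, h10, P3, h11, h12⟩ := peel h8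
  refine ⟨p1, p2, p3, ?_, ?_, h9, ?_⟩
  · by_contra h'
    have e1 := h2 p2 (by omega); have e2 := h3 p2; have e3 := h7 p2
    rw [if_pos rfl] at e3; omega
  · by_contra h'
    have e1 := h6 p3 (by omega); have e2 := h7 p3; have e3 := h11 p3
    rw [if_pos rfl] at e3; omega
  · intro j hj
    have := Finset.sum_eq_zero_iff.1 h12 j (Finset.mem_range.2 hj)
    rw [h3, h7, h11, this, cn]; omega

lemma tokens2 {r : ℕ} {M x : ℕ → ℕ} {t : ℕ} (h : ∑ i ∈ Finset.range r, M i + ∑ i ∈ Finset.range r, x i + t = 3) :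
    ∃ p1 p2 p3, p1 ≤ p2 ∧ p2 ≤ p3 ∧ p3 ≤ 2 * r ∧ (∀ i < r, M i = cn (2 * i + 1) p1 p2 p3) ∧ (∀ i < r, x i = cn (2 * i) p1 p2 p3) ∧ t = cn (2 * r) p1 p2 p3 := by
  let P : ℕ → ℕ := fun j => if j = 2 * r then t else if j % 2 = 1 then M (j / 2) else x (j / 2)
  have key : ∀ n ≤ r, ∑ j ∈ Finset.range (2 * n), P j = ∑ i ∈ Finset.range n, M i + ∑ i ∈ Finset.range n, x i := by
    intro n
    induction n with
    | zero => simp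
    | succ n ih =>
      intro hn
      rw [show 2 * (n + 1) = 2 * n + 1 + 1 by ring, Finset.sum_range_succ, Finset.sum_range_succ, ih (by omega), Finset.sum_range_succ, Finset.sum_range_succ]
      have e1 : P (2 * n) = x n := by
        change (if _ then _ else _) = _
        rw [if_neg (by omega), if_neg (by omega), show 2 * n / 2 = n by omega]
      have e2 : P (2 * n + 1) = M n := by
        change (if _ then _ else _) = _
        rw [if_neg (by omega), if_pos (by omega), show (2 * n + 1) / 2 = n by omega]
      rw [e1, e2]; ring
  have h0 : P (2 * r) = t := if_pos rfl
  obtain ⟨p1, p2, p3, h1, h2, h3, h4⟩ := tokens (n := 2 * r + 1) (P := P) (by rw [Finset.sum_range_succ, key r le_rfl, h0, h])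
  refine ⟨p1, p2, p3, h1, h2, by omega, fun i hi => ?_, fun i hi => ?_, ?_⟩
  · rw [← h4 _ (by omega)]
    change _ = (if _ then _ else _)
    rw [if_neg (by omega), if_pos (by omega), show (2 * i + 1) / 2 = i by omega]
  · rw [← h4 _ (by omega)]
    change _ = (if _ then _ else _)
    rw [if_neg (by omega), if_neg (by omega), show 2 * i / 2 = i by omega]
  · rw [← h4 _ (by omega), h0]

structure TD (d r : ℕ) (m s : ℕ → ℕ) (t t' p1 p2 p3 q1 q2 q3 : ℕ) : Prop where
  m1 : ∀ i < r, m i = cn (2 * i + 1) p1 p2 p3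
  s1 : ∀ i < r, s i = cn (2 * i) p1 p2 p3
  t1 : t' = cn (2 * r) p1 p2 p3
  m2 : ∀ i, r ≤ i → i < d → m i = cn (2 * i + 1) q1 q2 q3
  s2 : ∀ i, r ≤ i → i < d → s i = cn (2 * i) q1 q2 q3
  t2 : t = cn (2 * d) q1 q2 q3
  ord : p1 ≤ p2 ∧ p2 ≤ p3 ∧ p3 ≤ 2 * r ∧ 2 * r ≤ q1 ∧ q1 ≤ q2 ∧ q2 ≤ q3 ∧ q3 ≤ 2 * d
  rd : 0 < r ∧ r < d
  sle : ∀ i, s i ≤ 1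
  ea : 1 ≤ s 0 + t
  eb : 1 ≤ s r + t'
  tle : t ≤ 1 ∧ t' ≤ 1

def aav (s : ℕ → ℕ) (t t' r i : ℕ) : Prop := s i = 0 ∨ (i = 0 ∧ t = 0) ∨ (i = r ∧ t' = 0)

structure ASol (d r : ℕ) (m s : ℕ → ℕ) (t t' : ℕ) (aft vg bef : ℕ → Prop) : Prop where
  cnt : ∀ i < d, ib (aft i) + ib (vg i) + ib (bef (i + 1)) = m i
  av : ∀ i < d, usd d aft bef i → aav s t t' r i
  ex : ∀ i < d, ¬ (aft i ∧ bef (bi d i))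
  vu : ∀ i < d, ∀ j < d, vg i → vg j → i = j

variable {d r : ℕ} {m s : ℕ → ℕ} {t t' p1 p2 p3 q1 q2 q3 : ℕ}

def fA (pa qa qv k : ℕ) (i : ℕ) : Prop := 2 * i + 1 = pa ∨ 2 * i + 1 = qa ∨ (k = 1 ∧ 2 * i + 1 = qv)
def fV (pv qv k : ℕ) (i : ℕ) : Prop := 2 * i + 1 = pv ∨ (k = 0 ∧ 2 * i + 1 = qv)
def fB (pb qb qv k : ℕ) (i : ℕ) : Prop := 2 * i = pb + 1 ∨ 2 * i = qb + 1 ∨ (k = 2 ∧ 2 * i = qv + 1)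

lemma cn_zero {j x y z : ℕ} : cn j x y z = 0 ↔ j ≠ x ∧ j ≠ y ∧ j ≠ z := by
  unfold cn
  by_cases h1 : j = x <;> by_cases h2 : j = y <;> by_cases h3 : j = z <;> simp [h1, h2, h3]

lemma cnle {j x y z : ℕ} (h : cn j x y z ≤ 1) : (j = x → j ≠ y ∧ j ≠ z) ∧ (j = y → j ≠ z) := by
  unfold cn at h; split_ifs at h <;> omega

lemma mkSol (T : TD d r m s t t' p1 p2 p3 q1 q2 q3) (pa pv pb qa qv qb k : ℕ)
    (hp : ∀ j, cn j p1 p2 p3 = cn j pa pv pb := by intro j; unfold cn; omega) (hq : ∀ j, cn j q1 q2 q3 = cn j qa qv qb := by intro j; unfold cn; omega)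
    (hb : pa ≤ 2 * r ∧ pv ≤ 2 * r ∧ pb ≤ 2 * r ∧ 2 * r ≤ qa ∧ 2 * r ≤ qv ∧ 2 * r ≤ qb ∧ qa ≤ 2 * d ∧ qv ≤ 2 * d ∧ qb ≤ 2 * d := by intros; omega)
    (hA1 : pa = 1 → 0 ≠ p1 ∨ 2 * d ≠ q3 := by intros; omega) (hA2 : pa % 2 = 1 → 1 < pa → pa ≠ p1 + 1 ∧ pa ≠ p2 + 1 ∧ pa ≠ p3 + 1 := by intros; omega)
    (hB1 : pb + 1 = 2 * r → 2 * r ≠ p3 ∨ 2 * r ≠ q1 := by intros; omega) (hB2 : pb % 2 = 1 → pb + 1 < 2 * r → pb + 1 ≠ p1 ∧ pb + 1 ≠ p2 ∧ pb + 1 ≠ p3 := by intros; omega)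
    (hC1 : (qa = 2 * r + 1 ∨ (k = 1 ∧ qv = 2 * r + 1)) → 2 * r ≠ p3 ∨ 2 * r ≠ q1 := by intros; omega)
    (hC2 : ∀ x, x % 2 = 1 → (qa = x ∨ (k = 1 ∧ qv = x)) → 2 * r + 1 < x → x ≠ q1 + 1 ∧ x ≠ q2 + 1 ∧ x ≠ q3 + 1 := by intros; omega)
    (hD1 : (qb + 1 = 2 * d ∨ (k = 2 ∧ qv + 1 = 2 * d)) → 0 ≠ p1 ∨ 2 * d ≠ q3 := by intros; omega)
    (hD2 : ∀ x, x % 2 = 1 → (qb = x ∨ (k = 2 ∧ qv = x)) → x + 1 < 2 * d → x + 1 ≠ q1 ∧ x + 1 ≠ q2 ∧ x + 1 ≠ q3 := by intros; omega)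
    (hE : pb % 2 = 1 → pa ≠ pb + 2 := by intros; omega)
    (hE2 : ∀ x y, x % 2 = 1 → (qb = x ∨ (k = 2 ∧ qv = x)) → (qa = y ∨ (k = 1 ∧ qv = y)) → y ≠ x + 2 := by intros; omega)
    (hE3 : pb + 1 = 2 * r → qa ≠ 2 * r + 1 ∧ (k = 1 → qv ≠ 2 * r + 1) := by intros; omega)
    (hE4 : pa = 1 → qb + 1 ≠ 2 * d ∧ (k = 2 → qv + 1 ≠ 2 * d) := by intros; omega)
    (hV : k = 0 → pv % 2 = 1 → qv % 2 = 0 := by intros; omega)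
    (hk : k ≤ 2 ∧ (k = 1 → qv % 2 = 1 → qv ≠ qa) ∧ (k = 2 → qv % 2 = 1 → qv ≠ qb) := by intros; omega) :
    ASol d r m s t t' (fA pa qa qv k) (fV pv qv k) (fB pb qb qv k) := by
  have ho := T.ord
  have hrd := T.rd
  constructor
  · intro i hi
    by_cases hir : i < r
    · rw [T.m1 i hir, hp]
      have e1 : fA pa qa qv k i ↔ 2 * i + 1 = pa := by unfold fA; omega
      have e2 : fV pv qv k i ↔ 2 * i + 1 = pv := by unfold fV; omega
      have e3 : fB pb qb qv k (i + 1) ↔ 2 * i + 1 = pb := by unfold fB; omega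
      rw [e1, e2, e3]; unfold ib cn; split_ifs <;> rfl
    · rw [T.m2 i (by omega) hi, hq]
      have e1 : fA pa qa qv k i ↔ 2 * i + 1 = qa ∨ (k = 1 ∧ 2 * i + 1 = qv) := by unfold fA; omega
      have e2 : fV pv qv k i ↔ k = 0 ∧ 2 * i + 1 = qv := by unfold fV; omega
      have e3 : fB pb qb qv k (i + 1) ↔ 2 * i + 1 = qb ∨ (k = 2 ∧ 2 * i + 1 = qv) := by unfold fB; omega
      rw [e1, e2, e3]; unfold ib cn; split_ifs <;> omega
  · intro i hi hu
    by_contra hn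
    unfold aav at hn
    push Not at hn
    obtain ⟨n1, n2, n3⟩ := hn
    have nt : i = 0 → 2 * d = q3 := by
      intro h0
      have := n2 h0
      rw [T.t2, Ne, cn_zero] at this; omega
    have nt' : i = r → 2 * r = p3 := by
      intro h0
      have := n3 h0
      rw [T.t1, Ne, cn_zero] at this; omega
    have ns1 : i < r → (2 * i = p1 ∨ 2 * i = p2 ∨ 2 * i = p3) := by
      intro h0
      have := n1; rw [T.s1 i h0, Ne, cn_zero] at this; omega
    have ns2 : r ≤ i → (2 * i = q1 ∨ 2 * i = q2 ∨ 2 * i = q3) := by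
      intro h0
      have := n1; rw [T.s2 i h0 hi, Ne, cn_zero] at this; omega
    clear n1 n2 n3 hV hE hE2 hE3 hE4 hp hq
    have hC := hC2 (2 * i + 1) (by omega)
    have hD := hD2 (2 * i - 1)
    clear hC2 hD2
    rcases hu with hu | hu
    · clear hB1 hB2 hD1 hD
      unfold fA at hu
      rcases hu with hu | hu
      · clear hC1 hC
        by_cases h0 : i = 0
        · have := nt h0
          have := ns1 (by omega)
          clear hA2 hk ns1 ns2 nt nt'
          omega
        · have := ns1 (by omega)
          clear hA1 hk ns1 ns2 nt nt'
          omega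
      · clear hA1 hA2
        have : r ≤ i := by omega
        have h3 := ns2 this
        by_cases h1 : 2 * r + 1 < 2 * i + 1
        · have := hC (by omega) h1
          clear hC1 hC nt nt' ns1 ns2 hk
          omega
        · have : i = r := by omega
          have := nt' this
          have := hC1 (by omega)
          clear hC1 hC nt nt' ns1 ns2 hk
          omega
    · clear hA1 hA2 hC1 hC
      unfold bi at hu
      unfold fB at hu
      split_ifs at hu with h0
      · have h3 := nt h0
        have h4 := ns1 (by omega)
        have h5 := hD1 (by clear hD1 hD hB1 hB2 hk ns1 ns2 nt nt'; omega)
        clear hD1 hD hB1 hB2 hk ns1 ns2 nt nt'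
        omega
      · rcases hu with hu | hu
        · clear hD1 hD hk nt
          by_cases hir : i = r
          · have := nt' hir
            have := ns2 (by omega)
            clear hB2 nt' ns1 ns2
            omega
          · have := ns1 (by omega)
            clear hB1 nt' ns1 ns2
            omega
        · clear hB1 hB2 hD1 nt nt' ns1
          have := hD (by omega) (by omega) (by omega)
          have := ns2 (by omega)
          clear hD ns2 hk
          omega
  · rintro i hi ⟨h1, h2⟩
    clear hA1 hA2 hB1 hB2 hC1 hC2 hD1 hD2 hV hp hq
    unfold bi at h2
    unfold fA at h1
    unfold fB at h2
    split_ifs at h2 with h0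
    · clear hE hE2 hE3; omega
    · clear hE4
      rcases h1 with h1 | h1 <;> rcases h2 with h2 | h2
      · clear hE2 hE3; omega
      · clear hE hE2 hE3; omega
      · clear hE hE2; omega
      · have := hE2 (2 * i - 1) (2 * i + 1) (by omega) (by omega) (by omega)
        omega
  · intro i hi j hj h1 h2
    clear hA1 hA2 hB1 hB2 hC1 hC2 hD1 hD2 hE hE2 hE3 hE4 hp hq
    unfold fV at h1 h2
    omega

end matching

section matching
open scoped Classical

def anu (d r : ℕ) (s : ℕ → ℕ) (t t' : ℕ) (aft bef : ℕ → Prop) (i : ℕ) : Prop := ¬ aav s t t' r i ∨ usd d aft bef i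

variable {d r : ℕ} {m s : ℕ → ℕ} {t t' p1 p2 p3 q1 q2 q3 : ℕ} {aft bef : ℕ → Prop}

lemma TD.nu0 (T : TD d r m s t t' p1 p2 p3 q1 q2 q3) (h1 : p1 = 0) (h2 : q3 = 2 * d) : anu d r s t t' aft bef 0 := by
  refine Or.inl ?_
  have hrd := T.rd
  have e1 : s 0 ≠ 0 := by rw [T.s1 0 hrd.1, Ne, cn_zero]; omega
  have e2 : t ≠ 0 := by rw [T.t2, Ne, cn_zero]; omega
  unfold aav; omega

lemma TD.nur (T : TD d r m s t t' p1 p2 p3 q1 q2 q3) (h1 : p3 = 2 * r) (h2 : q1 = 2 * r) : anu d r s t t' aft bef r := by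
  refine Or.inl ?_
  have hrd := T.rd
  have e1 : s r ≠ 0 := by rw [T.s2 r le_rfl hrd.2, Ne, cn_zero]; omega
  have e2 : t' ≠ 0 := by rw [T.t1, Ne, cn_zero]; omega
  unfold aav; omega

lemma TD.nup (T : TD d r m s t t' p1 p2 p3 q1 q2 q3) {i : ℕ} (h0 : 0 < i := by omega) (h1 : i < r := by omega) (h2 : 2 * i = p1 ∨ 2 * i = p2 ∨ 2 * i = p3 := by omega) : anu d r s t t' aft bef i := by
  refine Or.inl ?_
  have e1 : s i ≠ 0 := by rw [T.s1 i h1, Ne, cn_zero]; omega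
  unfold aav; omega

lemma TD.nuq (T : TD d r m s t t' p1 p2 p3 q1 q2 q3) {i : ℕ} (h0 : r < i := by omega) (h1 : i < d := by omega) (h2 : 2 * i = q1 ∨ 2 * i = q2 ∨ 2 * i = q3 := by omega) : anu d r s t t' aft bef i := by
  refine Or.inl ?_
  have e1 : s i ≠ 0 := by rw [T.s2 i h0.le h1, Ne, cn_zero]; omega
  unfold aav; omega

variable {pa pv pb qa qv qb k : ℕ}

lemma nuA {i : ℕ} (h : 2 * i + 1 = pa ∨ 2 * i + 1 = qa ∨ (k = 1 ∧ 2 * i + 1 = qv) := by omega) : anu d r s t t' (fA pa qa qv k) bef i := Or.inr (Or.inl h)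
lemma nuB {i : ℕ} (h0 : 0 < i := by omega) (h : 2 * i = pb + 1 ∨ 2 * i = qb + 1 ∨ (k = 2 ∧ 2 * i = qv + 1) := by omega) : anu d r s t t' aft (fB pb qb qv k) i :=
  Or.inr (Or.inr (by unfold bi; rw [if_neg (by omega)]; exact h))
lemma nuB0 (h : 2 * d = pb + 1 ∨ 2 * d = qb + 1 ∨ (k = 2 ∧ 2 * d = qv + 1) := by omega) : anu d r s t t' aft (fB pb qb qv k) 0 :=
  Or.inr (Or.inr (by unfold bi; rw [if_pos rfl]; exact h))

lemma TD.dis (T : TD d r m s t t' p1 p2 p3 q1 q2 q3) : (p1 % 2 = 0 → p1 < p2) ∧ (p2 % 2 = 0 → p2 < p3) ∧ (q1 % 2 = 0 → q1 < q2) ∧ (q2 % 2 = 0 → q2 < q3) := by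
  have ho := T.ord
  have hrd := T.rd
  have hp : ∀ x, x % 2 = 0 → x ≤ 2 * r → cn x p1 p2 p3 ≤ 1 := by
    intro x h1 h2
    by_cases h : x = 2 * r
    · rw [h, ← T.t1]; exact T.tle.2
    · have := T.s1 (x / 2) (by omega)
      rw [show 2 * (x / 2) = x by omega] at this
      rw [← this]; exact T.sle _
  have hq : ∀ x, x % 2 = 0 → 2 * r ≤ x → x ≤ 2 * d → cn x q1 q2 q3 ≤ 1 := by
    intro x h1 h2 h3
    by_cases h : x = 2 * d
    · rw [h, ← T.t2]; exact T.tle.1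
    · have := T.s2 (x / 2) (by omega) (by omega)
      rw [show 2 * (x / 2) = x by omega] at this
      rw [← this]; exact T.sle _
  refine ⟨fun h => ?_, fun h => ?_, fun h => ?_, fun h => ?_⟩
  · have := cnle (hp p1 h (by omega)); omega
  · have := cnle (hp p2 h (by omega)); omega
  · have := cnle (hq q1 h (by omega) (by omega)); omega
  · have := cnle (hq q2 h (by omega) (by omega)); omega

lemma TD.ends (T : TD d r m s t t' p1 p2 p3 q1 q2 q3) : (p1 = 0 ∨ q3 = 2 * d) ∧ (p3 = 2 * r ∨ q1 = 2 * r) := by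
  have ho := T.ord
  have hrd := T.rd
  constructor
  · by_contra h
    have := T.ea
    have e1 : s 0 = 0 := by rw [T.s1 0 hrd.1, cn_zero]; omega
    have e2 : t = 0 := by rw [T.t2, cn_zero]; omega
    omega
  · by_contra h
    have := T.eb
    have e1 : s r = 0 := by rw [T.s2 r le_rfl hrd.2, cn_zero]; omega
    have e2 : t' = 0 := by rw [T.t1, cn_zero]; omega
    omega

def OutA (d r : ℕ) (m s : ℕ → ℕ) (t t' : ℕ) : Prop :=
  ∃ aft vg bef, ASol d r m s t t' aft vg bef ∧ anu d r s t t' aft bef 0 ∧ anu d r s t t' aft bef r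

def OutB (d r : ℕ) (m s : ℕ → ℕ) (t t' : ℕ) : Prop :=
  ∃ aft vg bef aft' vg' bef' L R, ASol d r m s t t' aft vg bef ∧ ASol d r m s t t' aft' vg' bef' ∧ L < R ∧ R < r ∧
    anu d r s t t' aft bef 0 ∧ anu d r s t t' aft bef L ∧ anu d r s t t' aft bef R ∧
    anu d r s t t' aft' bef' r ∧ anu d r s t t' aft' bef' L ∧ anu d r s t t' aft' bef' R

lemma case0a (T : TD d r m s t t' p1 p2 p3 q1 q2 q3) (hr : 2 ≤ r) (hd : d = r + 1) (h1 : p1 = 0) (h2 : p3 = 2 * r) : OutA d r m s t t' := by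
  have ho := T.ord
  have hdis := T.dis
  obtain ⟨g1, g2, g3, g4, g5, g6, g7⟩ := ho
  have e1 : 0 < p2 ∧ p2 < 2 * r := by omega
  have e2 : q2 = 2 * r + 1 ∧ (q1 = 2 * r ∨ q1 = 2 * r + 1) ∧ (q3 = 2 * d ∨ q3 = 2 * r + 1) := by omega
  clear hdis g1 g2 g3 g4 g5 g6 g7
  have hnu : ∀ pa pb aft bef, aft = fA pa q1 q2 0 → bef = fB pb q3 q2 0 → anu d r s t t' aft bef 0 ∧ anu d r s t t' aft bef r := by
    rintro pa pb aft bef rfl rfl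
    refine ⟨?_, ?_⟩
    · by_cases h : q3 = 2 * d
      · exact T.nu0 h1 h
      · exact nuB0
    · by_cases h : q1 = 2 * r
      · exact T.nur h2 h
      · exact nuA
  by_cases h : p2 = 1
  · refine ⟨_, _, _, mkSol T p1 p3 p2 q1 q2 q3 0, hnu _ _ _ _ rfl rfl⟩
  · refine ⟨_, _, _, mkSol T p2 p1 p3 q1 q2 q3 0, hnu _ _ _ _ rfl rfl⟩

lemma case0b (T : TD d r m s t t' p1 p2 p3 q1 q2 q3) (hr : 2 ≤ r) (hd : d = r + 1) (h1 : p1 = 0) (h2 : p3 < 2 * r) : OutA d r m s t t' := by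
  have ho := T.ord
  have hdis := T.dis
  have h3 : q1 = 2 * r := by have := T.ends; omega
  have e2 : q2 = 2 * r + 1 ∧ (q3 = 2 * d ∨ q3 = 2 * r + 1) := by omega
  obtain ⟨g1, g2, g3, g4, g5, g6, g7⟩ := ho
  have e1 : 0 < p2 ∧ (p2 % 2 = 0 → p2 < p3) := by omega
  clear hdis g1 g3 g4 g5 g6 g7
  have hnu : ∀ pa pb aft bef, aft = fA pa q2 q1 0 → bef = fB pb q3 q1 0 → anu d r s t t' aft bef 0 ∧ anu d r s t t' aft bef r := by
    rintro pa pb aft bef rfl rfl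
    refine ⟨?_, ?_⟩
    · by_cases h : q3 = 2 * d
      · exact T.nu0 h1 h
      · exact nuB0
    · exact nuA
  by_cases h : p2 % 2 = 0
  · have e3 : p2 < p3 := e1.2 h
    clear g2 e1
    refine ⟨_, _, _, mkSol T p2 p3 p1 q2 q1 q3 0, hnu _ _ _ _ rfl rfl⟩
  by_cases h' : 2 ≤ p3
  · refine ⟨_, _, _, mkSol T p3 p2 p1 q2 q1 q3 0, hnu _ _ _ _ rfl rfl⟩
  · refine ⟨_, _, _, mkSol T p1 p2 p3 q2 q1 q3 0, hnu _ _ _ _ rfl rfl⟩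

lemma case0c (T : TD d r m s t t' p1 p2 p3 q1 q2 q3) (hr : 2 ≤ r) (hd : d = r + 1) (h1 : 0 < p1) (h2 : p3 = 2 * r) : OutA d r m s t t' := by
  have ho := T.ord
  have hdis := T.dis
  have h3 : q3 = 2 * d := by have := T.ends; omega
  have e2 : q2 = 2 * r + 1 ∧ (q1 = 2 * r ∨ q1 = 2 * r + 1) := by omega
  obtain ⟨g1, g2, g3, g4, g5, g6, g7⟩ := ho
  have e1 : p2 < 2 * r ∧ (p1 % 2 = 0 → p1 < p2) := by omega
  clear hdis g2 g3 g4 g5 g6 g7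
  have hnu : ∀ pa pb aft bef, aft = fA pa q1 q3 0 → bef = fB pb q2 q3 0 → anu d r s t t' aft bef 0 ∧ anu d r s t t' aft bef r := by
    rintro pa pb aft bef rfl rfl
    refine ⟨?_, ?_⟩
    · exact nuB0
    · by_cases h : q1 = 2 * r
      · exact T.nur h2 h
      · exact nuA
  by_cases h : p2 % 2 = 0
  · refine ⟨_, _, _, mkSol T p3 p1 p2 q1 q3 q2 0, hnu _ _ _ _ rfl rfl⟩
  by_cases h' : p1 + 1 < 2 * r
  · refine ⟨_, _, _, mkSol T p3 p2 p1 q1 q3 q2 0, hnu _ _ _ _ rfl rfl⟩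
  · refine ⟨_, _, _, mkSol T p1 p2 p3 q1 q3 q2 0, hnu _ _ _ _ rfl rfl⟩

lemma case0d (T : TD d r m s t t' p1 p2 p3 q1 q2 q3) (hr : 2 ≤ r) (hd : d = r + 1) (h1 : 0 < p1) (h2 : p3 < 2 * r) : OutA d r m s t t' ∨ OutB d r m s t t' := by
  have ho := T.ord
  have hdis := T.dis
  have h3 : q3 = 2 * d ∧ q1 = 2 * r := by have := T.ends; omega
  have e2 : q2 = 2 * r + 1 := by omega
  obtain ⟨g1, g2, g3, g4, g5, g6, g7⟩ := ho
  have e1 : (p1 % 2 = 0 → p1 < p3) := by omega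
  clear hdis g3 g4 g5 g6 g7
  by_cases hA : p1 = 1
  · refine Or.inl ?_
    clear e1
    by_cases hB : p3 + 1 = 2 * r
    · by_cases h : p2 % 2 = 0
      · refine ⟨_, _, _, mkSol T p1 p2 p3 q1 q2 q3 0, nuA, nuB⟩
      by_cases h' : p2 = 1
      · refine ⟨_, _, _, mkSol T p1 p3 p2 q2 q1 q3 0, nuA, nuA⟩
      · refine ⟨_, _, _, mkSol T p2 p1 p3 q1 q3 q2 0, nuB0, nuB⟩
    · refine ⟨_, _, _, mkSol T p1 p2 p3 q2 q1 q3 0, nuA, nuA⟩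
  by_cases hB : p3 + 1 = 2 * r
  · refine Or.inl ?_
    refine ⟨_, _, _, mkSol T p1 p2 p3 q1 q3 q2 0, nuB0, nuB⟩
  refine Or.inr ?_
  have hnu : ∀ qa qb qv aft bef, aft = fA p1 qa qv 0 → bef = fB p3 qb qv 0 → anu d r s t t' aft bef (p1 / 2) ∧ anu d r s t t' aft bef ((p3 + 1) / 2) := by
    rintro qa qb qv aft bef rfl rfl
    refine ⟨?_, ?_⟩
    · by_cases h : p1 % 2 = 0
      · exact T.nup
      · exact nuA
    · by_cases h : p3 % 2 = 0
      · exact T.nup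
      · exact nuB
  refine ⟨fA p1 q1 q3 0, fV p2 q3 0, fB p3 q2 q3 0, fA p1 q2 q3 0, fV p2 q3 0, fB p3 q1 q3 0, p1 / 2, (p3 + 1) / 2, ?_, ?_, by omega, by omega, nuB0, (hnu _ _ _ _ _ rfl rfl).1, (hnu _ _ _ _ _ rfl rfl).2, nuA, (hnu _ _ _ _ _ rfl rfl).1, (hnu _ _ _ _ _ rfl rfl).2⟩
  · exact mkSol T p1 p2 p3 q1 q3 q2 0
  · exact mkSol T p1 p2 p3 q2 q3 q1 0

lemma case0 (T : TD d r m s t t' p1 p2 p3 q1 q2 q3) (hr : 2 ≤ r) (hd : d = r + 1) : OutA d r m s t t' ∨ OutB d r m s t t' := by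
  have ho := T.ord
  by_cases h1 : p1 = 0 <;> by_cases h2 : p3 = 2 * r
  · exact Or.inl (case0a T hr hd h1 h2)
  · exact Or.inl (case0b T hr hd h1 (by omega))
  · exact Or.inl (case0c T hr hd (by omega) h2)
  · exact case0d T hr hd (by omega) (by omega)

end matching

section matching
open scoped Classical
variable {d r : ℕ} {m s : ℕ → ℕ} {t t' p1 p2 p3 q1 q2 q3 : ℕ} {aft bef : ℕ → Prop}

def mid (m s : ℕ → ℕ) (L R : ℕ) : Prop := (∃ i, L ≤ i ∧ i < R ∧ 1 ≤ m i) ∨ (∃ i, L < i ∧ i < R ∧ s i = 1)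

def OutC (d r : ℕ) (m s : ℕ → ℕ) (t t' : ℕ) (aft vg bef : ℕ → Prop) : Prop :=
  (anu d r s t t' aft bef 0 ∧ anu d r s t t' aft bef r) ∨
  (anu d r s t t' aft bef (r + 1) ∧
    ((∃ L R, L < R ∧ R ≤ r ∧ anu d r s t t' aft bef L ∧ anu d r s t t' aft bef R ∧ mid m s L R ∧ ∀ i < r, m i = 3 → anu d r s t t' aft bef i ∧ anu d r s t t' aft bef (i + 1)) ∨
    (anu d r s t t' aft bef r ∧ 1 ≤ m r) ∨ (anu d r s t t' aft bef 0 ∧ 1 ≤ m (r + 1))))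

lemma TD.mid (T : TD d r m s t t' p1 p2 p3 q1 q2 q3) (x : ℕ) {L R : ℕ} (hx : x = p1 ∨ x = p2 ∨ x = p3 := by omega) (h1 : 2 * L < x := by omega) (h2 : x < 2 * R := by omega) (hR : R ≤ r := by omega) : mid m s L R := by
  by_cases h : x % 2 = 0
  · refine Or.inr ⟨x / 2, by omega, by omega, ?_⟩
    have h3 : s (x / 2) ≠ 0 := by rw [T.s1 _ (by omega), Ne, cn_zero]; omega
    have := T.sle (x / 2); omega
  · refine Or.inl ⟨x / 2, by omega, by omega, ?_⟩
    have h3 : m (x / 2) ≠ 0 := by rw [T.m1 _ (by omega), Ne, cn_zero]; omega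
    omega

lemma cn3 {j x y z : ℕ} (h : cn j x y z = 3) : j = x ∧ j = y ∧ j = z := by
  unfold cn at h; split_ifs at h <;> omega

lemma TD.m2pos (T : TD d r m s t t' p1 p2 p3 q1 q2 q3) {i : ℕ} (h1 : r ≤ i := by omega) (h2 : i < d := by omega) (h : 2 * i + 1 = q2 := by omega) : 1 ≤ m i := by
  have h3 : m i ≠ 0 := by rw [T.m2 _ h1 h2, Ne, cn_zero]; omega
  omega

lemma TD.m3 (T : TD d r m s t t' p1 p2 p3 q1 q2 q3) {i : ℕ} (h1 : i < r) (h : m i = 3) : 2 * i + 1 = p1 ∧ 2 * i + 1 = p2 ∧ 2 * i + 1 = p3 := by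
  rw [T.m1 i h1] at h; exact cn3 h

lemma case1a (T : TD d r m s t t' p1 p2 p3 q1 q2 q3) (hr : 2 ≤ r) (hd : d = r + 2) (h1 : q1 = 2 * r) (h2 : q3 = 2 * d) :
    ∃ aft vg bef, ASol d r m s t t' aft vg bef ∧ OutC d r m s t t' aft vg bef := by
  have ho := T.ord
  have hdis := T.dis
  have e2 : q2 = 2 * r + 1 ∨ q2 = 2 * r + 2 ∨ q2 = 2 * r + 3 := by omega
  obtain ⟨g1, g2, g3, g4, g5, g6, g7⟩ := ho
  obtain ⟨d1, d2, -, -⟩ := hdis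
  clear g4 g5 g6 g7
  have hnu : ∀ qa qb qv k aft bef, aft = fA p1 qa qv k → bef = fB p3 qb qv k → anu d r s t t' aft bef (r + 1) → ∀ vg, OutC d r m s t t' aft vg bef := by
    rintro qa qb qv k aft bef rfl rfl hc vg
    have hL : anu d r s t t' (fA p1 qa qv k) (fB p3 qb qv k) (p1 / 2) := by
      by_cases h : p1 % 2 = 0
      · by_cases h0 : p1 = 0
        · rw [h0]; exact T.nu0 h0 h2
        · exact T.nup
      · exact nuA
    have hR : anu d r s t t' (fA p1 qa qv k) (fB p3 qb qv k) ((p3 + 1) / 2) := by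
      by_cases h : p3 % 2 = 0
      · by_cases h0 : p3 = 2 * r
        · rw [show (p3 + 1) / 2 = r by omega]; exact T.nur h0 h1
        · exact T.nup
      · exact nuB
    refine Or.inr ⟨hc, Or.inl ⟨p1 / 2, (p3 + 1) / 2, by omega, by omega, hL, hR, T.mid p2, fun i hi hm => ?_⟩⟩
    have := T.m3 hi hm
    rw [show i + 1 = (p3 + 1) / 2 by omega, show i = p1 / 2 by omega]
    exact ⟨hL, hR⟩
  clear d2
  rcases e2 with h | h | h
  · refine ⟨_, _, _, mkSol T p1 p2 p3 q1 q3 q2 0, hnu _ _ _ _ _ _ rfl rfl nuB _⟩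
  · refine ⟨_, _, _, mkSol T p1 p2 p3 q1 q2 q3 0, hnu _ _ _ _ _ _ rfl rfl T.nuq _⟩
  · refine ⟨_, _, _, mkSol T p1 p2 p3 q2 q1 q3 0, hnu _ _ _ _ _ _ rfl rfl nuA _⟩

lemma case1b (T : TD d r m s t t' p1 p2 p3 q1 q2 q3) (hr : 2 ≤ r) (hd : d = r + 2) (h1 : p1 = 0) (h2 : p3 = 2 * r) (h3 : ¬ (q1 = 2 * r ∧ q3 = 2 * d)) :
    ∃ aft vg bef, ASol d r m s t t' aft vg bef ∧ OutC d r m s t t' aft vg bef := by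
  have ho := T.ord
  have hdis := T.dis
  have e1 : 0 < p2 ∧ p2 < 2 * r := by omega
  obtain ⟨g1, g2, g3, g4, g5, g6, g7⟩ := ho
  obtain ⟨-, -, d1, d2⟩ := hdis
  clear g1 g2 g3
  have hnu : ∀ pa pb aft bef, aft = fA pa q1 q2 0 → bef = fB pb q3 q2 0 → ∀ vg, OutC d r m s t t' aft vg bef := by
    rintro pa pb aft bef rfl rfl vg
    have n0 : 2 * r + 3 ≤ q3 → anu d r s t t' (fA pa q1 q2 0) (fB pb q3 q2 0) 0 := by
      intro h
      by_cases h : q3 = 2 * d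
      · exact T.nu0 h1 h
      · exact nuB0
    have nr : q1 ≤ 2 * r + 1 → anu d r s t t' (fA pa q1 q2 0) (fB pb q3 q2 0) r := by
      intro h
      by_cases h : q1 = 2 * r
      · exact T.nur h2 h
      · exact nuA
    by_cases ha : 2 * r + 2 ≤ q1
    · refine Or.inr ⟨?_, Or.inr (Or.inr ⟨n0 (by omega), T.m2pos⟩)⟩
      by_cases h : q1 = 2 * r + 2
      · exact T.nuq
      · exact nuA
    by_cases hb : q3 ≤ 2 * r + 2
    · refine Or.inr ⟨?_, Or.inr (Or.inl ⟨nr (by omega), T.m2pos⟩)⟩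
      by_cases h : q3 = 2 * r + 2
      · exact T.nuq
      · exact nuB
    exact Or.inl ⟨n0 (by omega), nr (by omega)⟩
  by_cases h : p2 = 1
  · refine ⟨_, _, _, mkSol T p1 p3 p2 q1 q2 q3 0, hnu _ _ _ _ rfl rfl _⟩
  · refine ⟨_, _, _, mkSol T p2 p1 p3 q1 q2 q3 0, hnu _ _ _ _ rfl rfl _⟩

lemma case1c (T : TD d r m s t t' p1 p2 p3 q1 q2 q3) (hr : 2 ≤ r) (hd : d = r + 2) (h1 : 0 < p1) (h2 : 2 * r < q1) :
    ∃ aft vg bef, ASol d r m s t t' aft vg bef ∧ OutC d r m s t t' aft vg bef := by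
  have ho := T.ord
  have hdis := T.dis
  have hen : q3 = 2 * d ∧ p3 = 2 * r := by have := T.ends; omega
  have e1 : p2 < 2 * r ∧ p1 ≤ p2 ∧ (p1 % 2 = 0 → p1 < p2) := by omega
  by_cases hq : q1 = 2 * r + 1
  · have e2 : q2 = 2 * r + 1 ∨ q2 = 2 * r + 2 ∨ q2 = 2 * r + 3 := by omega
    clear ho hdis
    have hnu : ∀ qb qv k aft bef, aft = fA p1 q1 qv k → bef = fB p3 qb qv k → anu d r s t t' aft bef (r + 1) → ∀ vg, OutC d r m s t t' aft vg bef := by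
      rintro qb qv k aft bef rfl rfl hc vg
      refine Or.inr ⟨hc, Or.inl ⟨p1 / 2, r, by omega, le_rfl, ?_, nuA, T.mid p2, fun i hi hm => ?_⟩⟩
      · by_cases h : p1 % 2 = 0
        · exact T.nup
        · exact nuA
      · have := T.m3 hi hm; omega
    rcases e2 with h | h | h
    · refine ⟨_, _, _, mkSol T p1 p2 p3 q1 q3 q2 0, hnu _ _ _ _ _ rfl rfl nuB _⟩
    · refine ⟨_, _, _, mkSol T p1 p2 p3 q1 q2 q3 0, hnu _ _ _ _ _ rfl rfl T.nuq _⟩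
    · refine ⟨_, _, _, mkSol T p1 p2 p3 q1 q2 q3 1, hnu _ _ _ _ _ rfl rfl nuA _⟩
  · have e2 : q2 = 2 * r + 3 ∧ (q1 = 2 * r + 2 ∨ q1 = 2 * r + 3) := by omega
    clear ho hdis
    have hnu : ∀ aft bef, aft = fA p3 q1 q3 0 → bef = fB p2 q2 q3 0 → ∀ vg, OutC d r m s t t' aft vg bef := by
      rintro aft bef rfl rfl vg
      refine Or.inr ⟨?_, Or.inl ⟨0, (p2 + 1) / 2, by omega, by omega, nuB0, ?_, T.mid p1, fun i hi hm => ?_⟩⟩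
      · by_cases h : q1 = 2 * r + 2
        · exact T.nuq
        · exact nuA
      · by_cases h : p2 % 2 = 0
        · exact T.nup
        · exact nuB
      · have := T.m3 hi hm; omega
    refine ⟨_, _, _, mkSol T p3 p1 p2 q1 q3 q2 0, hnu _ _ rfl rfl _⟩

lemma case1d (T : TD d r m s t t' p1 p2 p3 q1 q2 q3) (hr : 2 ≤ r) (hd : d = r + 2) (h1 : p3 < 2 * r) (h2 : q3 < 2 * d) :
    ∃ aft vg bef, ASol d r m s t t' aft vg bef ∧ OutC d r m s t t' aft vg bef := by
  have ho := T.ord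
  have hdis := T.dis
  have hen : q1 = 2 * r ∧ p1 = 0 := by have := T.ends; omega
  have e1 : 0 < p2 ∧ p2 ≤ p3 ∧ (p2 % 2 = 0 → p2 < p3) := by omega
  by_cases hq : q3 = 2 * r + 3
  · have e2 : q2 = 2 * r + 1 ∨ q2 = 2 * r + 2 ∨ q2 = 2 * r + 3 := by omega
    clear ho hdis
    have hnu : ∀ qa qv k aft bef, aft = fA p1 qa qv k → bef = fB p3 q3 qv k → anu d r s t t' aft bef (r + 1) → ∀ vg, OutC d r m s t t' aft vg bef := by
      rintro qa qv k aft bef rfl rfl hc vg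
      refine Or.inr ⟨hc, Or.inl ⟨0, (p3 + 1) / 2, by omega, by omega, nuB0, ?_, T.mid p2, fun i hi hm => ?_⟩⟩
      · by_cases h : p3 % 2 = 0
        · exact T.nup
        · exact nuB
      · have := T.m3 hi hm; omega
    rcases e2 with h | h | h
    · refine ⟨_, _, _, mkSol T p1 p2 p3 q1 q2 q3 2, hnu _ _ _ _ _ rfl rfl nuB _⟩
    · refine ⟨_, _, _, mkSol T p1 p2 p3 q1 q2 q3 0, hnu _ _ _ _ _ rfl rfl T.nuq _⟩
    · refine ⟨_, _, _, mkSol T p1 p2 p3 q2 q1 q3 0, hnu _ _ _ _ _ rfl rfl nuA _⟩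
  · have e2 : q2 = 2 * r + 1 ∧ (q3 = 2 * r + 2 ∨ q3 = 2 * r + 1) := by omega
    clear ho hdis
    have hnu : ∀ aft bef, aft = fA p2 q2 q1 0 → bef = fB p1 q3 q1 0 → ∀ vg, OutC d r m s t t' aft vg bef := by
      rintro aft bef rfl rfl vg
      refine Or.inr ⟨?_, Or.inl ⟨p2 / 2, r, by omega, by omega, ?_, nuA, T.mid p3, fun i hi hm => ?_⟩⟩
      · by_cases h : q3 = 2 * r + 2
        · exact T.nuq
        · exact nuB
      · by_cases h : p2 % 2 = 0
        · exact T.nup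
        · exact nuA
      · have := T.m3 hi hm; omega
    refine ⟨_, _, _, mkSol T p2 p3 p1 q2 q1 q3 0, hnu _ _ rfl rfl _⟩

lemma case1 (T : TD d r m s t t' p1 p2 p3 q1 q2 q3) (hr : 2 ≤ r) (hd : d = r + 2) :
    ∃ aft vg bef, ASol d r m s t t' aft vg bef ∧ OutC d r m s t t' aft vg bef := by
  have ho := T.ord
  have he := T.ends
  by_cases h1 : q1 = 2 * r ∧ q3 = 2 * d
  · exact case1a T hr hd h1.1 h1.2
  by_cases h2 : p1 = 0 ∧ p3 = 2 * r
  · exact case1b T hr hd h2.1 h2.2 h1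
  by_cases h3 : q1 = 2 * r
  · exact case1d T hr hd (by omega) (by omega)
  · exact case1c T hr hd (by omega) (by omega)
end matching

section X1
open scoped Classical
variable {W : Type} [Fintype W] {K : SimpleGraph W}

lemma comp_data (K : SimpleGraph W) (S : Finset W) {x : W} (hx : x ∉ S) : ∃ I : Finset W, x ∈ I ∧ Disjoint S I ∧
    (∀ u ∈ I, ∀ y, K.Adj u y → y ∈ S ∪ I) ∧
    (∀ B ⊆ I, B.Nonempty → (∀ u ∈ B, ∀ y ∈ I, K.Adj u y → y ∈ B) → B = I) := by
  let R : W → W → Prop := fun u y => K.Adj u y ∧ u ∉ S ∧ y ∉ S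
  have hsym : ∀ u y, Relation.ReflTransGen R u y → Relation.ReflTransGen R y u := by
    intro u y h
    induction h with
    | refl => exact Relation.ReflTransGen.refl
    | tail _ h ih => exact Relation.ReflTransGen.head ⟨h.1.symm, h.2.2, h.2.1⟩ ih
  have hns : ∀ y, Relation.ReflTransGen R x y → y ∉ S := by
    intro y h
    induction h with
    | refl => exact hx
    | tail _ h _ => exact h.2.2
  refine ⟨Finset.univ.filter (fun y => Relation.ReflTransGen R x y), by simp [Relation.ReflTransGen.refl], ?_, ?_, ?_⟩
  · rw [Finset.disjoint_left]
    intro y hy hy'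
    rw [Finset.mem_filter] at hy'
    exact hns y hy'.2 hy
  · intro u hu y hy
    rw [Finset.mem_filter] at hu
    by_cases hyS : y ∈ S
    · exact Finset.mem_union_left _ hyS
    · apply Finset.mem_union_right
      rw [Finset.mem_filter]
      exact ⟨Finset.mem_univ _, hu.2.tail ⟨hy, hns u hu.2, hyS⟩⟩
  · intro B hB hne hcl
    apply Finset.Subset.antisymm hB
    obtain ⟨u, hu⟩ := hne
    intro y hy
    have hu' := hB hu
    rw [Finset.mem_filter] at hu' hy
    have huy := (hsym _ _ hu'.2).trans hy.2
    induction huy with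
    | refl => exact hu
    | tail h1 h2 ih =>
      rename_i c d
      have hc := ih ⟨Finset.mem_univ _, hu'.2.trans h1⟩
      refine hcl c hc d ?_ h2.1
      rw [Finset.mem_filter]
      exact hy

lemma X_tight {E : PlaneEmb K} {big : K.Dart → Prop} (hc : IsCPTLabelling E big) (hL : Spr K (wt big))
    {S I : Finset W} (hS2 : 2 ≤ S.card) (hS : slk K (wt big) S = 0) (hd : Disjoint S I)
    (hcl : ∀ u ∈ I, ∀ y, K.Adj u y → y ∈ S ∪ I) : 2 ≤ Iᶜ.card ∧ slk K (wt big) Iᶜ = 0 := by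
  have hsub : S ⊆ Iᶜ := by
    intro y hy
    rw [Finset.mem_compl]
    exact Finset.disjoint_left.1 hd hy
  have h2 : 2 ≤ Iᶜ.card := hS2.trans (Finset.card_le_card hsub)
  refine ⟨h2, ?_⟩
  have h := slk_union_inter_eq K (wt big) Iᶜ (S ∪ I) (by
    intro x y hxy hx hx' hy
    rw [Finset.mem_compl] at *
    intro hyI
    exact hx' (hcl y hyI x hxy.symm))
  have e1 : Iᶜ ∪ (S ∪ I) = Finset.univ := by
    ext y; simp; tauto
  have e2 : Iᶜ ∩ (S ∪ I) = S := by
    ext y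
    have := @hsub y
    simp at *; tauto
  rw [e1, e2, slk_univ hc, hS] at h
  have := hL _ h2
  have := hL (S ∪ I) (hS2.trans (Finset.card_le_card Finset.subset_union_left))
  omega

lemma X_conn {E : PlaneEmb K} {big : K.Dart → Prop} (hc : IsCPTLabelling E big) (hL : Spr K (wt big))
    (h2c : ∀ (z b : W) (A : Set W), A.Nonempty → z ∉ A → b ≠ z → b ∉ A → ∃ x ∈ A, ∃ y, y ∉ A ∧ y ≠ z ∧ K.Adj x y)
    {S I : Finset W} (hS2 : 2 ≤ S.card) (hS : slk K (wt big) S = 0) (hd : Disjoint S I)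
    (hcl : ∀ u ∈ I, ∀ y, K.Adj u y → y ∈ S ∪ I) :
    ∀ A ⊆ ((Iᶜ : Finset W) : Set W), A.Nonempty → (∀ x ∈ A, ∀ y ∈ ((Iᶜ : Finset W) : Set W), K.Adj x y → y ∈ A) → A = ((Iᶜ : Finset W) : Set W) := by
  intro A hA hne hAc
  have hSI : ∀ y ∈ S, y ∉ I := fun y hy => Finset.disjoint_left.1 hd hy
  have hmem : ∀ y, y ∈ ((Iᶜ : Finset W) : Set W) ↔ y ∉ I := by intro y; simp
  obtain ⟨s, hs⟩ : S.Nonempty := Finset.card_pos.1 (by omega)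
  have hno : ∀ u y, K.Adj u y → u ∉ S → u ∉ I → y ∉ I := by
    intro u y h hu hu' hy
    rcases Finset.mem_union.1 (hcl y hy u h.symm) with h | h
    · exact hu h
    · exact hu' h
  by_cases hAS : ∃ u ∈ A, u ∈ S
  · obtain ⟨M, hMK, hM0, hMs⟩ := lemP2 hc hL h2c hS2 hS
    have hSA : ∀ y ∈ S, y ∈ A := by
      by_contra hcon
      push Not at hcon
      obtain ⟨y, hy, hyA⟩ := hcon
      obtain ⟨u, hu, hu'⟩ := hAS
      obtain ⟨x, hx, z, hz, hxz⟩ := tight_conn (X := S.filter (· ∈ A)) hM0 hMs (Finset.filter_subset _ _)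
        ⟨u, Finset.mem_filter.2 ⟨hu', hu⟩⟩ ⟨y, by rw [Finset.mem_sdiff, Finset.mem_filter]; tauto⟩
      rw [Finset.mem_sdiff, Finset.mem_filter] at hz
      rw [Finset.mem_filter] at hx
      exact hz.2 ⟨hz.1, hAc x hx.2 z ((hmem z).2 (hSI z hz.1)) (hMK hxz)⟩
    apply Set.Subset.antisymm hA
    intro y hy
    by_contra hyA
    have := conn_cut E.connected (A := {u | u ∉ I ∧ u ∉ A}) ⟨y, (hmem y).1 hy, hyA⟩ (by
      rintro u z huz ⟨h1, h2⟩
      have hz : z ∉ I := hno u z huz (fun h => h2 (hSA u h)) h1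
      exact ⟨hz, fun h => h2 (hAc z h u ((hmem u).2 h1) huz.symm)⟩) s
    exact this.2 (hSA s hs)
  · push Not at hAS
    exfalso
    have := conn_cut E.connected (A := A) hne (by
      intro u z huz hu
      exact hAc u hu z ((hmem z).2 (hno u z huz (hAS u hu) ((hmem u).1 (hA hu)))) huz) s
    exact hAS s this hs

lemma X_cz {E : PlaneEmb K} {big : K.Dart → Prop} (hc : IsCPTLabelling E big) (hL : Spr K (wt big))
    (h2c : ∀ (z b : W) (A : Set W), A.Nonempty → z ∉ A → b ≠ z → b ∉ A → ∃ x ∈ A, ∃ y, y ∉ A ∧ y ≠ z ∧ K.Adj x y)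
    {S I : Finset W} (hS2 : 2 ≤ S.card) (hS : slk K (wt big) S = 0) (hd : Disjoint S I)
    (hcl : ∀ u ∈ I, ∀ y, K.Adj u y → y ∈ S ∪ I)
    (hI : ∀ B ⊆ I, B.Nonempty → (∀ u ∈ B, ∀ y ∈ I, K.Adj u y → y ∈ B) → B = I)
    {o : W} (ho : o ∈ I) (hoo : Outv E o) : ∀ z, z ∉ I → cz E big I z ≤ 0 := by
  have hcon := X_conn hc hL h2c hS2 hS hd hcl
  have hsub : S ⊆ Iᶜ := by
    intro y hy
    rw [Finset.mem_compl]
    exact Finset.disjoint_left.1 hd hy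
  have hY := lemY (E := E) hc (I := I) (A := S) ⟨o, ho⟩ (by
    intro B hB hne hBc
    rw [hI B hB hne hBc]
    obtain ⟨d, h1, h2⟩ := hoo
    exact ⟨d, h1 ▸ ho, h2⟩) (Finset.card_pos.1 (by omega)) hd hcl
  have h0 := hL (S ∪ I) (hS2.trans (Finset.card_le_card Finset.subset_union_left))
  have hnn : ∀ z ∈ Iᶜ, 0 ≤ cz E big I z := by
    intro z hz
    apply cz_nonneg hc
    intro _
    by_contra hno
    push Not at hno
    have := hcon {z} (by simpa using hz) ⟨z, rfl⟩ (by
      rintro x rfl y hy hxy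
      exact absurd hxy (hno y (by simpa using hy)))
    have h3 : Iᶜ.card ≤ 1 := by
      rw [Finset.card_le_one]
      intro u hu u' hu'
      have hu := Finset.mem_coe.2 hu
      have hu' := Finset.mem_coe.2 hu'
      rw [← this] at hu hu'
      rw [Set.mem_singleton_iff.1 hu, Set.mem_singleton_iff.1 hu']
    have := Finset.card_le_card hsub
    omega
  intro z hz
  have := Finset.single_le_sum hnn (Finset.mem_compl.2 hz)
  omega
lemma X_tight' {E : PlaneEmb K} {big : K.Dart → Prop} (hc : IsCPTLabelling E big) (hL : Spr K (wt big))
    {S I : Finset W} (hS2 : 2 ≤ S.card) (hS : slk K (wt big) S = 0) (hd : Disjoint S I)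
    (hcl : ∀ u ∈ I, ∀ y, K.Adj u y → y ∈ S ∪ I) : ∃ T : Finset W, 2 ≤ T.card ∧ slk K (wt big) T = 0 ∧ ∀ y, y ∈ T ↔ y ∉ I :=
  ⟨Iᶜ, (X_tight hc hL hS2 hS hd hcl).1, (X_tight hc hL hS2 hS hd hcl).2, fun y => Finset.mem_compl⟩

lemma X_conn' {E : PlaneEmb K} {big : K.Dart → Prop} (hc : IsCPTLabelling E big) (hL : Spr K (wt big))
    (h2c : ∀ (z b : W) (A : Set W), A.Nonempty → z ∉ A → b ≠ z → b ∉ A → ∃ x ∈ A, ∃ y, y ∉ A ∧ y ≠ z ∧ K.Adj x y)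
    {S I : Finset W} (hS2 : 2 ≤ S.card) (hS : slk K (wt big) S = 0) (hd : Disjoint S I)
    (hcl : ∀ u ∈ I, ∀ y, K.Adj u y → y ∈ S ∪ I) :
    ∀ A ⊆ (I : Set W)ᶜ, A.Nonempty → (∀ x ∈ A, ∀ y ∈ (I : Set W)ᶜ, K.Adj x y → y ∈ A) → A = (I : Set W)ᶜ := by
  have := X_conn hc hL h2c hS2 hS hd hcl
  rwa [Finset.coe_compl] at this
end X1

section X2
open scoped Classical
variable {V : Type} [Fintype V] {G : SimpleGraph V} {E : PlaneEmb G} {v : V} {a b : ↥({v}ᶜ : Set V)}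
    {K : SimpleGraph ↥({v}ᶜ : Set V)} {F : PlaneEmb K} {B : K.Dart → Prop}
local notation "Vc" => (compl (Singleton.singleton v) : Set V)
local notation "TT" => TS G E v a b K F

lemma TS.tight_zero (h : TT) (hc : IsCPTLabelling F B) (hL : Spr K (wt B))
    (h2c : ∀ (z b : ↥Vc) (A : Set ↥Vc), A.Nonempty → z ∉ A → b ≠ z → b ∉ A → ∃ x ∈ A, ∃ y, y ∉ A ∧ y ≠ z ∧ K.Adj x y)
    {p : V → ℝ × ℝ} (hp : GenericConf p) {q0 : ↥Vc → ℝ × ℝ}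
    (hq0 : IsInfMotion (G.induce Vc) (fun x => p x) q0)
    {T : Finset ↥Vc} (hT2 : 2 ≤ T.card) (hT : slk K (wt B) T = 0) (hab : ¬ (a ∈ T ∧ b ∈ T))
    {o1 o2 : ↥Vc} (ho : o1 ≠ o2) (h1 : o1 ∈ T) (h2 : o2 ∈ T) (z1 : q0 o1 = 0) (z2 : q0 o2 = 0)
    {c : ↥Vc} (hcT : c ∈ T) : q0 c = 0 := by
  obtain ⟨M, hMK, hM0, hMs⟩ := lemP2 hc hL h2c hT2 hT
  have hp' := generic_sub hp Vc
  have hr := lamRig hT2 hM0 hMs hp'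
  have hm : TrivOn T (fun x : ↥Vc => p x) q0 := by
    apply hr
    intro x y hx hy hxy
    rcases (h.hK x y).1 (hMK hxy) with h' | ⟨rfl, rfl⟩ | ⟨rfl, rfl⟩
    · exact hq0 x y h'
    · exact absurd ⟨hx, hy⟩ hab
    · exact absurd ⟨hy, hx⟩ hab
  obtain ⟨α, t, ht⟩ := hm
  have hne : p o1 ≠ p o2 := gen_ne hp' (u := o1) (w := o2) ho
  have := triv_uniq (m := (α, t)) (m' := (0, 0)) hne (by
    simpa using (ht o1 h1).symm.trans z1) (by simpa using (ht o2 h2).symm.trans z2)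
  simp only [Prod.mk.injEq] at this
  rw [ht c hcT, this.1, this.2]
  simp

lemma TS.gp_wi (h : TT) (i : ℕ) : E.dartFace (h.wi (i + 1)) = h.gp i := h.gap_prev i

lemma TS.gap_in (h : TT) {T : Set ↥Vc} {i : ℕ} (hy : h.yi (i + 1) ∈ T)
    (hno : ∀ e, isH v e → E.dartFace e = h.gp i → (up F e).fst ∈ T → (up F e).snd ∈ T) :
    ∀ e, isH v e → E.dartFace e = h.gp i → (up F e).fst ∈ T ∧ (up F e).snd ∈ T := by
  have key : ∀ e, E.dartFace (h.wi (i + 1)) = E.dartFace e → E.dartFace e = h.gp i ∧ (isH v e → (up F e).fst ∈ T) := by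
    intro e he
    refine face_ind E (P := fun e => E.dartFace e = h.gp i ∧ (isH v e → (up F e).fst ∈ T)) ?_ ?_ he
    · rintro e ⟨h1, h2⟩
      refine ⟨(face_fac E e).trans h1, fun h3 => ?_⟩
      have hf : (fac E e).fst = e.snd := E.rot_fst _
      by_cases h4 : isH v e
      · have h5 := hno e h4 h1 (h2 h4)
        have : (up F (fac E e)).fst = (up F e).snd := Subtype.ext (by rw [(h.up_spec h3).1, (h.up_spec h4).2, hf])
        rw [this]; exact h5
      · by_cases h5 : e.fst = v
        · have : e = h.wi (i + 1) := h.from_unique h5 (h.wi_fst _) (h1.trans (h.gp_wi i).symm)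
          have h6 : (up F (fac E e)).fst = h.yi (i + 1) := Subtype.ext (by rw [(h.up_spec h3).1, hf, this]; rfl)
          rw [h6]; exact hy
        · exfalso
          have h6 : e.snd = v := by
            by_contra h6; exact h4 ⟨h5, h6⟩
          exact h3.1 (hf.trans h6)
    · exact ⟨h.gp_wi i, fun h3 => absurd (h.wi_fst _) h3.1⟩
  intro e he hf
  have h1 := (key e ((h.gp_wi i).trans hf.symm)).2 he
  exact ⟨h1, hno e he hf h1⟩

lemma TS.gap_step (h : TT) {T : Set ↥Vc} {i : ℕ} (hy : h.yi (i + 1) ∈ T)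
    (hno : ∀ e, isH v e → E.dartFace e = h.gp i → (up F e).fst ∈ T → (up F e).snd ∈ T) : h.yi i ∈ T := by
  have hp := h.isH_pre (h.wi_fst i)
  have h1 := (h.gap_in hy hno (pre E (h.wi i)).symm hp.symm (h.gp_pre i)).2
  have : (up F (pre E (h.wi i)).symm).snd = h.yi i := Subtype.ext (by
    rw [(h.up_spec hp.symm).2]; exact pre_fst _)
  rwa [this] at h1

lemma TS.Xmain (h : TT) (hc : IsCPTLabelling F B) (hL : Spr K (wt B))
    (h2c : ∀ (z b : ↥Vc) (A : Set ↥Vc), A.Nonempty → z ∉ A → b ≠ z → b ∉ A → ∃ x ∈ A, ∃ y, y ∉ A ∧ y ≠ z ∧ K.Adj x y)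
    {p : V → ℝ × ℝ} (hp : GenericConf p) {q0 : ↥Vc → ℝ × ℝ}
    (hq0 : IsInfMotion (G.induce Vc) (fun x => p x) q0)
    {o1 o2 : ↥Vc} (ho : o1 ≠ o2) (h1 : Outv F o1) (h2 : Outv F o2) (z1 : q0 o1 = 0) (z2 : q0 o2 = 0)
    {r : ℕ} (hr : h.wi r = h.swap.av) (hrd : r < h.dg) (hnout : ∀ i < r, h.gp i ≠ E.outer)
    {S : Finset ↥Vc} (hS2 : 2 ≤ S.card) (hS : slk K (wt B) S = 0) 
    {c : ↥Vc} (hcS : c ∈ S) (hqc : q0 c ≠ 0)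
    {L R : ℕ} (hLR : L < R) (hRr : R ≤ r) (hyL : h.yi L ∈ S) (hyR : h.yi R ∈ S) (hmid : mid (h.m B) (h.s B) L R) : a ∈ S ∧ b ∈ S := by
  by_contra hab
  obtain ⟨x, hxab, hxS⟩ : ∃ x, (x = a ∨ x = b) ∧ x ∉ S := by
    by_contra hcon
    push Not at hcon
    exact hab ⟨hcon a (Or.inl rfl), hcon b (Or.inr rfl)⟩
  obtain ⟨I, hxI, hd, hcl, hI⟩ := comp_data K S hxS
  have hSI : ∀ y ∈ S, y ∉ I := fun y hy => Finset.disjoint_left.1 hd hy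
  by_cases hout : ∃ o ∈ I, Outv F o
  swap
  · push Not at hout
    obtain ⟨T, hT2, hT, hTm⟩ := X_tight' hc hL hS2 hS hd hcl
    refine hqc (h.tight_zero hc hL h2c hp hq0 hT2 hT ?_ ho ?_ ?_ z1 z2 (c := c) ?_)
    · rintro ⟨ha, hb⟩
      rw [hTm] at ha hb
      rcases hxab with rfl | rfl
      · exact ha hxI
      · exact hb hxI
    · rw [hTm]; exact fun h' => hout _ h' h1
    · rw [hTm]; exact fun h' => hout _ h' h2
    · rw [hTm]; exact hSI c hcS
  obtain ⟨o, hoI, hoo⟩ := hout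
  have hcz := X_cz hc hL h2c hS2 hS hd hcl hI hoI hoo
  have hcon := X_conn' hc hL h2c hS2 hS hd hcl
  have hmem : ∀ y, y ∈ (I : Set ↥Vc)ᶜ ↔ y ∉ I := by intro y; simp
  have hcoI : ((I : Set ↥Vc)ᶜ)ᶜ = (I : Set _) := by ext y; simp
  have hbond : ∀ d1 d2 : K.Dart, d1.fst ∉ I → d1.snd ∈ I → d2.fst ∉ I → d2.snd ∈ I → F.dartFace d1 = F.dartFace d2 → d1 = d2 := by
    intro d1 d2 e1 e2 e3 e4 hf
    refine bond F (S := (I : Set ↥Vc)ᶜ) hcon ?_ ((hmem _).2 e1) (fun h' => (hmem _).1 h' e2) ((hmem _).2 e3) (fun h' => (hmem _).1 h' e4) hf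
    rw [hcoI]
    intro A hA hne hAc
    obtain ⟨A', rfl⟩ : ∃ A' : Finset ↥Vc, A = A' := ⟨A.toFinset, by simp⟩
    rw [hI A' (by exact_mod_cast hA) (by exact_mod_cast hne) (by exact_mod_cast hAc)]
  have hF1 : ∀ i < r, ∀ e, isH v e → E.dartFace e = h.gp i → F.dartFace (up F e) = F.dartFace h.ab := by
    intro i hi e he hf
    have := (h.cm_side hr hrd he.symm).2 ⟨i, hi, by rw [angle_eq, SimpleGraph.Dart.symm_symm]; exact hf⟩
    rwa [angle_eq, h.up_symm he.symm, SimpleGraph.Dart.symm_symm] at this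
  have hDF : DF F I (F.dartFace h.ab) := by
    rcases hxab with rfl | rfl
    · exact DF_fst hxI
    · exact ⟨h.ab, hxI, rfl⟩
  have desc : ∀ n, n ≤ r → ∀ k, k ≤ n → h.yi n ∉ I → 
      (∀ i, k ≤ i → i < n → ∀ e, isH v e → E.dartFace e = h.gp i → (up F e).fst ∉ I → (up F e).snd ∉ I) → ∀ i, k ≤ i → i ≤ n → h.yi i ∉ I := by
    intro n hn k hk hyn hno i hi hin
    obtain ⟨j, rfl⟩ : ∃ j, n = i + j := ⟨n - i, by omega⟩
    clear hk hn
    induction j with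
    | zero => exact hyn
    | succ j ih =>
      refine ih ?_ (fun i' h1 h2 => hno i' h1 (by omega)) (by omega)
      exact h.gap_step (T := {y | y ∉ I}) hyn (hno (i + j) (by omega) (by omega))
  have hgaps : ∀ i, L ≤ i → i < R → ∀ e, isH v e → E.dartFace e = h.gp i → (up F e).fst ∉ I → (up F e).snd ∉ I := by
    intro i hi hiR e he hf e1 e2
    have haI : a ∉ I := by
      have := desc L (by omega) 0 (by omega) (hSI _ hyL) (by
        intro j _ hj e' he' hf' e3 e4
        have h3 := hbond _ _ e1 e2 e3 e4 ((hF1 i (by omega) e he hf).trans (hF1 j (by omega) e' he' hf').symm)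
        have h4 := h.up_inj he he' h3
        rw [h4, hf'] at hf
        have := h.gp_inj (by omega) (by omega) hf
        omega) 0 (by omega) (by omega)
      exact this
    have hbI : b ∉ I := by
      intro hb
      exact h.up_ne he (hbond _ h.ab e1 e2 haI hb (hF1 i (by omega) e he hf))
    rcases hxab with rfl | rfl
    · exact haI hxI
    · exact hbI hxI
  have hyI : ∀ i, L ≤ i → i ≤ R → h.yi i ∉ I := desc R hRr L hLR.le (hSI _ hyR) hgaps
  have hin : ∀ i, L ≤ i → i < R → ∀ e, isH v e → E.dartFace e = h.gp i → (up F e).fst ∉ I ∧ (up F e).snd ∉ I := by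
    intro i h1 h2
    exact h.gap_in (T := {y | y ∉ I}) (hyI (i + 1) (by omega) (by omega)) (hgaps i h1 h2)
  rcases hmid with ⟨i, hi, hiR, hm⟩ | ⟨i, hi, hiR, hs⟩
  · rw [TS.m, if_neg (hnout i (by omega))] at hm
    obtain ⟨e, he, hne⟩ : ∃ e ∈ Finset.univ.filter (fun e => cm v E e), ib (E.angleFace e = h.gp i ∧ ¬ B (up F e)) ≠ 0 := by
      apply Finset.exists_ne_zero_of_sum_ne_zero
      unfold TS.m0 at hm
      omega
    rw [Finset.mem_filter] at he
    rw [Ne, ib_zero, not_not] at hne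
    have k1 := (hin i hi hiR e.symm he.2.1.symm hne.1).1
    rw [← h.up_symm he.2.1] at k1
    have k2 := (hin i hi hiR (E.rot e) he.2.2 ((face_rot E e).trans hne.1)).2
    rw [← h.rotH he.2.1 he.2.2] at k2
    have k3 := (hin i hi hiR e.symm he.2.1.symm hne.1).2
    rw [← h.up_symm he.2.1] at k3
    refine cz_zero_no hc (hcz _ k3) (d := up F e) rfl hne.2 k1 k2 ?_
    rw [(h.cm_side hr hrd he.2.1).2 ⟨i, by omega, hne.1⟩]
    exact hDF
  · rw [TS.s, ib_one] at hs
    have hpH := h.isH_pre (h.wi_fst i)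
    have k0 := hin i hi.le hiR (pre E (h.wi i)).symm hpH.symm (h.gp_pre i)
    rw [← h.up_symm hpH] at k0
    obtain ⟨j, rfl⟩ : ∃ j, i = j + 1 := ⟨i - 1, by omega⟩
    have hne := h.wi_ne hr (i := j + 1) hrd (by omega) (by omega) (by omega)
    have k2 := (hin j (by omega) (by omega) (E.rot (h.wi (j + 1)).symm) (h.isH_rot (h.wi_fst _)) (by
      rw [face_rot, SimpleGraph.Dart.symm_symm]; exact h.gp_wi j)).2
    rw [← TS.rot_pre h (h.wi_fst _) hne.1 hne.2] at k2
    refine cz_zero_no hc (hcz _ k0.2) (d := up F (pre E (h.wi (j + 1)))) rfl hs k0.1 k2 ?_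
    rw [(h.pre_side hr hrd (by omega)).2 (by omega)]
    exact hDF
end X2

section X3
open scoped Classical
variable {V : Type} [Fintype V] {G : SimpleGraph V} {E : PlaneEmb G} {v : V} {a b : ↥({v}ᶜ : Set V)}
    {K : SimpleGraph ↥({v}ᶜ : Set V)} {F : PlaneEmb K} {B : K.Dart → Prop}
local notation "Vc" => (compl (Singleton.singleton v) : Set V)
local notation "TT" => TS G E v a b K F

lemma outv_snd {W : Type} [Fintype W] {J : SimpleGraph W} {F : PlaneEmb J} {d : J.Dart} (h : F.dartFace d = F.outer) : Outv F d.fst ∧ Outv F d.snd :=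
  ⟨⟨d, rfl, h⟩, ⟨fac F d, F.rot_fst _, (face_fac F d).trans h⟩⟩

lemma TS.outv_gap (h : TT) {i : ℕ} (ho : h.gp i = E.outer) : Outv F (h.yi i) ∧ Outv F (h.yi (i + 1)) := by
  constructor
  · have hp := (h.isH_pre (h.wi_fst i)).symm
    have h1 := h.outer_lam ((h.gp_pre i).trans ho)
    change lam v E F (pre E (h.wi i)).symm = _ at h1
    rw [lam_isH hp] at h1
    have := (outv_snd h1).2
    convert this using 1
    exact Subtype.ext (by rw [(h.up_spec hp).2]; exact (pre_fst _).symm)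
  · have hp := h.isH_rot (h.wi_fst (i + 1))
    have h1 := h.outer_lam (e := E.rot (h.wi (i + 1)).symm) (by
      rw [face_rot, SimpleGraph.Dart.symm_symm, h.gp_wi i, ho])
    rw [lam_isH hp] at h1
    have := (outv_snd h1).1
    convert this using 1
    exact Subtype.ext (by rw [(h.up_spec hp).1, E.rot_fst]; rfl)

def OP (E : PlaneEmb G) (v : V) (o1 o2 : ↥Vc) : Prop :=
  (∃ w : G.Dart, w.fst = v ∧ E.angleFace w = E.outer ∧ (o1 : V) = w.snd ∧ (o2 : V) = (E.rot w).snd) ∨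
  (nov v E E.outer ∧ ∃ e : G.Dart, E.dartFace e = E.outer ∧ isH v e ∧ (o1 : V) = e.fst ∧ (o2 : V) = e.snd)

lemma TS.op (h : TT) {o1 o2 : ↥Vc} (ho : OP E v o1 o2) :
    Outv F o1 ∧ Outv F o2 ∧ ∀ i < h.dg, h.gp i = E.outer → o1 = h.yi i ∧ o2 = h.yi (i + 1) := by
  rcases ho with ⟨w, hw, hf, h1, h2⟩ | ⟨hn, e, hf, he, h1, h2⟩
  · obtain ⟨j, hj, rfl⟩ := h.wi_surj hw
    have e1 : o1 = h.yi j := Subtype.ext h1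
    have e2 : o2 = h.yi (j + 1) := Subtype.ext (by rw [h2, ← h.wi_succ]; rfl)
    obtain ⟨g1, g2⟩ := h.outv_gap hf
    refine ⟨e1 ▸ g1, e2 ▸ g2, fun i hi hio => ?_⟩
    have : i = j := h.gp_inj hi hj (hio.trans hf.symm)
    subst this
    exact ⟨e1, e2⟩
  · have g := h.outer_lam hf
    rw [lam_isH he] at g
    obtain ⟨g1, g2⟩ := outv_snd g
    have e1 : o1 = (up F e).fst := Subtype.ext (h1.trans (h.up_spec he).1.symm)
    have e2 : o2 = (up F e).snd := Subtype.ext (h2.trans (h.up_spec he).2.symm)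
    refine ⟨e1 ▸ g1, e2 ▸ g2, fun i hi hio => ?_⟩
    exact absurd (hio ▸ hn) (h.gp_not_nov i)

lemma TS.td (h : TT) (hc : IsCPTLabelling F B) {r : ℕ} (hr : h.wi r = h.swap.av) (hrd : r < h.dg) :
    ∃ p1 p2 p3 q1 q2 q3, TD h.dg r (h.m B) (h.s B) (h.t B) (h.swap.t B) p1 p2 p3 q1 q2 q3 := by
  obtain ⟨p1, p2, p3, a1, a2, a3, a4, a5, a6⟩ := tokens2 (h.side_eq hc hr hrd)
  obtain ⟨q1, q2, q3, b1, b2, b3, b4, b5, b6⟩ := tokens2 (h.side_eq2 hc hr hrd)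
  have key : ∀ j, cn (j + 2 * r) (q1 + 2 * r) (q2 + 2 * r) (q3 + 2 * r) = cn j q1 q2 q3 := by
    intro j; simp only [cn, Nat.add_right_cancel_iff]
  refine ⟨p1, p2, p3, q1 + 2 * r, q2 + 2 * r, q3 + 2 * r, a4, a5, a6, ?_, ?_, ?_, by omega, ⟨h.r_pos hr, hrd⟩, h.s_le B, h.end_a hc, ?_, h.t_le B, h.swap.t_le B⟩
  · intro i hi hid
    have := b4 (i - r) (by omega)
    rw [← key] at this
    rw [show i - r + r = i by omega, show 2 * (i - r) + 1 + 2 * r = 2 * i + 1 by omega] at this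
    exact this
  · intro i hi hid
    have := b5 (i - r) (by omega)
    rw [← key] at this
    rw [show i - r + r = i by omega, show 2 * (i - r) + 2 * r = 2 * i by omega] at this
    exact this
  · rw [← key, show 2 * (h.dg - r) + 2 * r = 2 * h.dg by omega] at b6
    exact b6
  · have := h.swap.end_a hc
    rwa [h.s_swap hr, zero_add] at this

def ExtL (E : PlaneEmb G) (a b : ↥({v}ᶜ : Set V)) (F : PlaneEmb K) (B : K.Dart → Prop) : Prop :=
  ∃ big : G.Dart → Prop, IsCPTLabelling E big ∧ GenLaman G big ∧ ExtendsAddLabel G v a b K E F big B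

lemma TS.fin (h : TT) (hc : IsCPTLabelling F B) (hL : Spr K (wt B)) {r : ℕ} (hr : h.wi r = h.swap.av) (hrd : r < h.dg)
    {aft vg bef : ℕ → Prop} (hs : ASol h.dg r (h.m B) (h.s B) (h.t B) (h.swap.t B) aft vg bef)
    (hS : ∀ S : Finset ↥Vc, 2 ≤ S.card → slk K (wt B) S = 0 →
      (∀ i < h.dg, anu h.dg r (h.s B) (h.t B) (h.swap.t B) aft bef i → h.yi i ∈ S) → a ∈ S ∧ b ∈ S) : ExtL E a b F B := by
  have hs' : Sol h B r aft vg bef := ⟨hs.cnt, hs.av, hs.ex, hs.vu⟩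
  exact ⟨h.lb B aft vg bef, hs'.cpt hc hr, h.genLaman hs' hc hL hr hrd hS, h.ext_lb⟩

lemma TS.yi_swap (h : TT) {r : ℕ} (hr : h.wi r = h.swap.av) (i : ℕ) : h.swap.yi i = h.yi (i + r) :=
  Subtype.ext (by unfold TS.yi; simp only [h.wi_swap hr])

lemma TS.finC (h : TT) (hc : IsCPTLabelling F B) (hL : Spr K (wt B))
    (h2c : ∀ (z b : ↥Vc) (A : Set ↥Vc), A.Nonempty → z ∉ A → b ≠ z → b ∉ A → ∃ x ∈ A, ∃ y, y ∉ A ∧ y ≠ z ∧ K.Adj x y)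
    {p : V → ℝ × ℝ} (hp : GenericConf p) {q0 : ↥Vc → ℝ × ℝ}
    (hq0 : IsInfMotion (G.induce Vc) (fun x => p x) q0)
    {o1 o2 : ↥Vc} (ho : o1 ≠ o2) (hop : OP E v o1 o2) (z1 : q0 o1 = 0) (z2 : q0 o2 = 0)
    {r : ℕ} (hr : h.wi r = h.swap.av) (hrd : h.dg = r + 2) (h2r : 2 ≤ r) (hqc : q0 (h.yi (r + 1)) ≠ 0) : ExtL E a b F B := by
  obtain ⟨p1, p2, p3, q1, q2, q3, T⟩ := h.td hc hr (by omega)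
  obtain ⟨aft, vg, bef, hs, hC⟩ := case1 T h2r hrd
  clear T
  obtain ⟨g1, g2, g3⟩ := h.op hop
  refine h.fin hc hL hr (by omega) hs ?_
  intro S hS2 hS hnu
  rcases hC with ⟨n0, nr⟩ | ⟨nc, hC⟩
  · exact ⟨hnu 0 (by omega) n0, h.yi_r hr ▸ hnu r (by omega) nr⟩
  have hcS := hnu (r + 1) (by omega) nc
  have hsw : (1 ≤ h.m B r ∧ h.yi r ∈ S) ∨ (1 ≤ h.m B (r + 1) ∧ h.yi (r + 2) ∈ S) → a ∈ S ∧ b ∈ S := by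
    intro hor
    have hno : ∀ i < h.dg - r, h.swap.gp i ≠ E.outer := by
      intro i hi hio
      have e : h.swap.gp i = h.gp (i + r) := by unfold TS.gp; rw [h.wi_swap hr]
      rw [e] at hio
      obtain ⟨e1, e2⟩ := g3 (i + r) (by omega) hio
      have hi' : i = 0 ∨ i = 1 := by omega
      rcases hi' with rfl | rfl
      · rw [show 0 + r + 1 = r + 1 by omega] at e2
        exact hqc (e2 ▸ z2)
      · rw [show 1 + r = r + 1 by omega] at e1
        exact hqc (e1 ▸ z1)
    have X := fun L R => h.swap.Xmain hc hL h2c hp hq0 ho g1 g2 z1 z2 (r := h.dg - r) (h.r_swap hr (by omega)) (by rw [h.dg_swap]; omega) hno hS2 hS hcS hqc (L := L) (R := R)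
    simp only [h.yi_swap hr, And.comm (a := b ∈ S)] at X
    rcases hor with ⟨hm, hy⟩ | ⟨hm, hy⟩
    · refine X 0 1 (by omega) (by omega) (by rwa [zero_add]) (by rwa [add_comm]) (Or.inl ⟨0, by omega, by omega, ?_⟩)
      rwa [h.m_swap hr, zero_add]
    · refine X 1 2 (by omega) (by omega) (by rwa [add_comm]) (by rwa [add_comm]) (Or.inl ⟨1, by omega, by omega, ?_⟩)
      rwa [h.m_swap hr, add_comm]
  rcases hC with ⟨L, R, hLR, hRr, nL, nR, hmid, h3⟩ | ⟨nr, hm⟩ | ⟨n0, hm⟩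
  · by_cases hout : ∃ i < r, h.gp i = E.outer
    · obtain ⟨i, hi, hio⟩ := hout
      obtain ⟨e1, e2⟩ := g3 i (by omega) hio
      obtain ⟨n1, n2⟩ := h3 i hi (by unfold TS.m; rw [if_pos hio])
      by_contra hab
      exact hqc (h.tight_zero hc hL h2c hp hq0 hS2 hS hab ho (e1 ▸ hnu i (by omega) n1) (e2 ▸ hnu (i + 1) (by omega) n2) z1 z2 hcS)
    · push Not at hout
      exact h.Xmain hc hL h2c hp hq0 ho g1 g2 z1 z2 hr (by omega) hout hS2 hS hcS hqc hLR hRr (hnu L (by omega) nL) (hnu R (by omega) nR) hmid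
  · exact hsw (Or.inl ⟨hm, hnu r (by omega) nr⟩)
  · refine hsw (Or.inr ⟨hm, ?_⟩)
    have : h.yi (r + 2) = h.yi 0 := Subtype.ext (by
      unfold TS.yi; simp only [← hrd]; rw [← Nat.zero_add h.dg, h.wi_add])
    rw [this]
    exact hnu 0 (by omega) n0

lemma TS.finB (h : TT) (hc : IsCPTLabelling F B) (hL : Spr K (wt B))
    {r : ℕ} (hr : h.wi r = h.swap.av) (hrd : h.dg = r + 1) (h2r : 2 ≤ r) : ExtL E a b F B := by
  obtain ⟨p1, p2, p3, q1, q2, q3, T⟩ := h.td hc hr (by omega)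
  rcases case0 T h2r hrd with ⟨aft, vg, bef, hs, n0, nr⟩ | ⟨aft, vg, bef, aft', vg', bef', L, R, hs, hs', hLR, hRr, n0, nL, nR, m0, mL, mR⟩
  · refine h.fin hc hL hr (by omega) hs ?_
    intro S hS2 hS hnu
    exact ⟨hnu 0 (by omega) n0, h.yi_r hr ▸ hnu r (by omega) nr⟩
  · by_contra hcon
    have f1 := mt (h.fin hc hL hr (by omega) hs) hcon
    have f2 := mt (h.fin hc hL hr (by omega) hs') hcon
    push Not at f1 f2
    obtain ⟨S, hS2, hS, hnu, hab⟩ := f1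
    obtain ⟨S', hS2', hS', hnu', hab'⟩ := f2
    have ha : a ∈ S := hnu 0 (by omega) n0
    have hb' : b ∈ S' := h.yi_r hr ▸ hnu' r (by omega) m0
    have hb := hab ha
    have ha' : a ∉ S' := fun h' => hab' h' hb'
    have hi := slk_union_inter_strict K (wt B) S S' h.ab.adj ha ha' hb' hb
    have c2 : 2 ≤ (S ∩ S').card := by
      have hne : h.yi L ≠ h.yi R := fun h' => by
        have := h.yi_inj (by omega) (by omega) h'; omega
      rw [← Finset.card_pair hne]
      apply Finset.card_le_card
      intro y hy
      rw [Finset.mem_insert, Finset.mem_singleton] at hy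
      rw [Finset.mem_inter]
      rcases hy with rfl | rfl
      · exact ⟨hnu L (by omega) nL, hnu' L (by omega) mL⟩
      · exact ⟨hnu R (by omega) nR, hnu' R (by omega) mR⟩
    have i1 := hL _ c2
    have i2 := hL (S ∪ S') (c2.trans (Finset.card_le_card (Finset.inter_subset_union)))
    rw [hS, hS'] at hi
    omega
end X3

section asm
open scoped Classical
variable {V : Type} [Fintype V] {G : SimpleGraph V} {E : PlaneEmb G} {v : V}
local notation "Vc" => (compl (Singleton.singleton v) : Set V)

lemma per_ge (E : PlaneEmb G) {L : SimpleGraph V} (hLG : L ≤ G) (hdeg : Nat.card (L.neighborSet v) = 3) {w : G.Dart} (hw : w.fst = v) :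
    3 ≤ Function.minimalPeriod E.rot w := by
  have hpos : 0 < Function.minimalPeriod E.rot w := by
    apply Function.minimalPeriod_pos_of_mem_periodicPts
    exact Function.Injective.mem_periodicPts E.rot.injective w
  have key : ∀ y : L.neighborSet v, ∃ i : Fin (Function.minimalPeriod E.rot w), ((E.rot^[i]) w).snd = y := by
    intro y
    obtain ⟨n, hn⟩ := E.rot_vertex w ⟨(v, y), hLG y.2⟩ hw
    refine ⟨⟨n % Function.minimalPeriod E.rot w, Nat.mod_lt _ hpos⟩, ?_⟩
    simp only
    rw [Function.iterate_mod_minimalPeriod_eq, ← Equiv.Perm.coe_pow, hn]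
  choose f hf using key
  have hinj : Function.Injective f := by
    intro y y' h
    apply Subtype.ext
    rw [← hf y, ← hf y', h]
  have := Nat.card_le_card_of_injective f hinj
  rw [hdeg, Nat.card_fin] at this
  exact this

lemma conn_del (hGrig : GenRigid G) : ∀ A ⊆ Vc, A.Nonempty → (∀ x ∈ A, ∀ y ∈ Vc, G.Adj x y → y ∈ A) → A = Vc := by
  intro A hA hne hcl
  apply Set.Subset.antisymm hA
  intro b hb
  by_contra hbA
  obtain ⟨x, hx, y, hy, hyv, hxy⟩ := rigid_cut hGrig hne (fun h => hA h rfl) hb hbA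
  exact hy (hcl x hx y hyv hxy)

lemma mkTS (hGrig : GenRigid G) {p : V → ℝ × ℝ} {q : ↥Vc → ℝ × ℝ}
    (hq : IsInfMotion (G.induce Vc) (fun x => p x) q)
    {a b : ↥Vc} (hav : G.Adj v a) (hbv : G.Adj v b) (hab : ¬ lk (fun x : ↥Vc => p x) q a b)
    (F : PlaneEmb (G.induce Vc ⊔ SimpleGraph.fromEdgeSet {s(a, b)}))
    (ind : IsInducedPlaneEmbAdd G v a b _ E F) : TS G E v a b (G.induce Vc ⊔ SimpleGraph.fromEdgeSet {s(a, b)}) F := by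
  have hne : a ≠ b := by
    rintro rfl; apply hab; simp [lk, dot2]
  refine ⟨?_, hav, hbv, hne, fun h => hab (hq a b h), ind, conn_del hGrig⟩
  intro x y
  rw [SimpleGraph.sup_adj, SimpleGraph.fromEdgeSet_adj, Set.mem_singleton_iff, Sym2.eq_iff]
  constructor
  · rintro (h | ⟨h, _⟩)
    · exact Or.inl h
    · exact Or.inr h
  · rintro (h | ⟨rfl, rfl⟩ | ⟨rfl, rfl⟩)
    · exact Or.inl h
    · exact Or.inr ⟨Or.inl ⟨rfl, rfl⟩, hne⟩
    · exact Or.inr ⟨Or.inr ⟨rfl, rfl⟩, hne.symm⟩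

lemma lk_sub {W : Type} {p q : W → ℝ × ℝ} (m : ℝ × (ℝ × ℝ)) (x y : W) :
    lk p (fun x => q x - (m.1 • rot90 (p x) + m.2)) x y ↔ lk p q x y := by
  simp only [lk, dot2, rot90, Prod.fst_sub, Prod.snd_sub, Prod.fst_add, Prod.snd_add, Prod.smul_fst, Prod.smul_snd, smul_eq_mul]
  constructor <;> intro h <;> linarith

def Concl (E : PlaneEmb G) (v : V) : Prop :=
    ∃ a b : ↥({v}ᶜ : Set V), G.Adj v (a : V) ∧ G.Adj v (b : V) ∧ a ≠ b ∧
      GenRigid (G.induce ({v}ᶜ : Set V) ⊔ SimpleGraph.fromEdgeSet {s(a, b)}) ∧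
      ∀ E'' : PlaneEmb (G.induce ({v}ᶜ : Set V) ⊔ SimpleGraph.fromEdgeSet {s(a, b)}),
        IsInducedPlaneEmbAdd G v a b _ E E'' →
        ∀ big'' : (G.induce ({v}ᶜ : Set V) ⊔ SimpleGraph.fromEdgeSet {s(a, b)}).Dart → Prop,
          IsCPTLabelling E'' big'' →
          GenLaman (G.induce ({v}ᶜ : Set V) ⊔ SimpleGraph.fromEdgeSet {s(a, b)}) big'' → ExtL E a b E'' big''

def sn (w : G.Dart) (hw : w.fst = v) : ↥Vc := ⟨w.snd, fun h => w.adj.ne (hw.trans (Eq.symm h))⟩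

lemma sn_adj (w : G.Dart) (hw : w.fst = v) : G.Adj v (sn w hw) := by
  have := w.adj; rw [hw] at this; exact this

lemma asm1 (hGrig : GenRigid G) {L : SimpleGraph V} (hLG : L ≤ G) (hLaman : LamanGraph L)
    (hdeg : Nat.card (L.neighborSet v) = 3) {p : V → ℝ × ℝ} (hp : GenericConf p)
    {q : ↥Vc → ℝ × ℝ} (hq : IsInfMotion (G.induce Vc) (fun x => p x) q)
    (hnt : ¬ IsTrivialMotion (fun x : ↥Vc => p x) q)
    {w : G.Dart} (hw : w.fst = v) (hw' : (E.rot w).fst = v) 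
    (hnl : ¬ lk (fun x : ↥Vc => p x) q (sn (E.rot w) hw') (sn w hw)) : Concl E v := by
  have hne : sn (E.rot w) hw' ≠ sn w hw := by
    intro h; rw [h] at hnl; apply hnl; simp [lk, dot2]
  refine ⟨_, _, sn_adj _ hw', sn_adj _ hw, hne, unlinked_rigid hLG hLaman hdeg hp hq hnt hnl, ?_⟩
  intro F hind B hc hgl
  have h := mkTS hGrig hq (sn_adj _ hw') (sn_adj _ hw) hnl F hind
  have hav : h.av = E.rot w := dext hw'.symm rfl
  have hbv : h.swap.av = w := dext hw.symm rfl
  have hd : 3 ≤ h.dg := by unfold TS.dg; rw [hav]; exact per_ge E hLG hdeg hw'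
  refine h.finB hc ((genLaman_iff _ _).1 hgl) (r := h.dg - 1) ?_ (by omega) (by omega)
  apply E.rot.injective
  rw [← h.wi_succ, show h.dg - 1 + 1 = 0 + h.dg by omega, h.wi_add, h.wi_zero, hav, hbv]

lemma op_ex (E : PlaneEmb G) {L : SimpleGraph V} (hLG : L ≤ G) 
    (hdeg : Nat.card (L.neighborSet v) = 3) {p : V → ℝ × ℝ}
    {q : ↥Vc → ℝ × ℝ} (hq : IsInfMotion (G.induce Vc) (fun x => p x) q)
    (hlk : ∀ (w : G.Dart) (hw : w.fst = v) (hw' : (E.rot w).fst = v), lk (fun x : ↥Vc => p x) q (sn (E.rot w) hw') (sn w hw)) :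
    ∃ o1 o2, OP E v o1 o2 ∧ o1 ≠ o2 ∧ lk (fun x : ↥Vc => p x) q o1 o2 := by
  by_cases hn : nov v E E.outer
  · obtain ⟨e, he⟩ := Quotient.exists_rep E.outer
    have he : E.dartFace e = E.outer := he
    have hH := hn e he
    refine ⟨⟨e.fst, hH.1⟩, ⟨e.snd, hH.2⟩, Or.inr ⟨hn, e, he, hH, rfl, rfl⟩, fun h => e.adj.ne (congrArg Subtype.val h), hq _ _ e.adj⟩
  · obtain ⟨w, hw, hf⟩ := touch hn
    have hw' : (E.rot w).fst = v := (E.rot_fst w).trans hw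
    refine ⟨sn w hw, sn (E.rot w) hw', Or.inl ⟨w, hw, hf, rfl, rfl⟩, ?_, lk_symm (hlk w hw hw')⟩
    intro h
    have h1 : E.rot w = w := dext (hw'.trans hw.symm) (congrArg Subtype.val h).symm
    have := per_ge E hLG hdeg hw
    have h2 : Function.IsPeriodicPt E.rot 1 w := h1
    have := h2.minimalPeriod_le (by omega)
    omega

lemma asm2 (hGrig : GenRigid G) {L : SimpleGraph V} (hLG : L ≤ G) (hLaman : LamanGraph L)
    (hdeg : Nat.card (L.neighborSet v) = 3) {p : V → ℝ × ℝ} (hp : GenericConf p)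
    {q : ↥Vc → ℝ × ℝ} (hq : IsInfMotion (G.induce Vc) (fun x => p x) q)
    (hnt : ¬ IsTrivialMotion (fun x : ↥Vc => p x) q)
    (hlk : ∀ (w : G.Dart) (hw : w.fst = v) (hw' : (E.rot w).fst = v), lk (fun x : ↥Vc => p x) q (sn (E.rot w) hw') (sn w hw))
    {o1 o2 : ↥Vc} (hop : OP E v o1 o2) (ho : o1 ≠ o2) (z1 : q o1 = 0) (z2 : q o2 = 0)
    {w0 : G.Dart} (hw0 : w0.fst = v) : Concl E v := by
  have hf : ∀ i, ((E.rot ^ i) w0).fst = v := by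
    intro i
    induction i with
    | zero => exact hw0
    | succ i ih => rw [pow_succ', Equiv.Perm.mul_apply, E.rot_fst, ih]
  have hd := per_ge E hLG hdeg hw0
  have hs : ∀ i, (E.rot ^ (i + 1)) w0 = E.rot ((E.rot ^ i) w0) := fun i => by rw [pow_succ', Equiv.Perm.mul_apply]
  have hper : ∀ i, (E.rot ^ (i + Function.minimalPeriod E.rot w0)) w0 = (E.rot ^ i) w0 := by
    intro i
    rw [pow_add, Equiv.Perm.mul_apply, Equiv.Perm.coe_pow, Equiv.Perm.coe_pow, Function.iterate_minimalPeriod]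
  have hsurj : ∀ y : ↥Vc, G.Adj v y → ∃ i, sn ((E.rot ^ i) w0) (hf i) = y := by
    intro y hy
    obtain ⟨n, hn⟩ := E.rot_vertex w0 ⟨(v, y), hy⟩ hw0
    exact ⟨n, Subtype.ext (by unfold sn; simp only [hn])⟩
  have hp' := generic_sub hp Vc
  obtain ⟨i, hqc, hnl⟩ := ring_choice (p := fun x : ↥Vc => p x) (q := q) (w := fun i => sn ((E.rot ^ i) w0) (hf i)) hd
    (fun i => Subtype.ext (by unfold sn; simp only [hper]))
    (by
      intro i j hij hj h
      have h1 : (E.rot ^ i) w0 = (E.rot ^ j) w0 := dext ((hf i).trans (hf j).symm) (congrArg Subtype.val h)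
      obtain ⟨k, rfl⟩ : ∃ k, j = i + k := ⟨j - i, by omega⟩
      rw [pow_add, Equiv.Perm.mul_apply] at h1
      have h2 := (E.rot ^ i).injective h1
      have h3 : Function.IsPeriodicPt E.rot k w0 := by
        rw [Equiv.Perm.coe_pow] at h2; exact h2.symm
      have := h3.minimalPeriod_le (by omega)
      omega)
    (fun x y h => gen_ne hp' h) (fun x y z h1 h2 h3 => gen_noncol hp' h1 h2 h3)
    (by
      intro i
      have hw' : (E.rot ((E.rot ^ i) w0)).fst = v := (E.rot_fst _).trans (hf i)
      have := lk_symm (hlk _ (hf i) hw')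
      have e : sn ((E.rot ^ (i + 1)) w0) (hf (i + 1)) = sn (E.rot ((E.rot ^ i) w0)) hw' := Subtype.ext (by unfold sn; simp only [hs])
      simp only [e]; exact this)
    (by
      intro m
      obtain ⟨y, hy, hne⟩ := nbrs_not_rigid (hGrig p hp) hq hnt m
      obtain ⟨i, rfl⟩ := hsurj y hy
      exact ⟨i, hne⟩)
  have hnl' := fun h => hnl (lk_symm h)
  have hne : sn ((E.rot ^ (i + 2)) w0) (hf (i + 2)) ≠ sn ((E.rot ^ i) w0) (hf i) := by
    intro h; apply hnl'; simp only [h]; simp [lk, dot2]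
  have hrig := unlinked_rigid hLG hLaman hdeg hp hq hnt hnl'
  refine ⟨_, _, sn_adj _ (hf (i + 2)), sn_adj _ (hf i), hne, hrig, ?_⟩
  intro F hind B hc hgl
  have h := mkTS hGrig hq (sn_adj _ (hf (i + 2))) (sn_adj _ (hf i)) hnl' F hind
  have hav : h.av = (E.rot ^ (i + 2)) w0 := dext (hf _).symm rfl
  have hbv : h.swap.av = (E.rot ^ i) w0 := dext (hf _).symm rfl
  have hd3 : 3 ≤ h.dg := by unfold TS.dg; rw [hav]; exact per_ge E hLG hdeg (hf _)
  have hr : h.wi (h.dg - 2) = h.swap.av := by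
    apply E.rot.injective
    apply E.rot.injective
    rw [← h.wi_succ, ← h.wi_succ, show h.dg - 2 + 1 + 1 = 0 + h.dg by omega, h.wi_add, h.wi_zero, hav, hbv, hs, hs]
  have hd4 : 4 ≤ h.dg := by
    by_contra hlt
    have e3 : h.dg - 2 = 0 + 1 := by omega
    rw [e3, h.wi_succ, h.wi_zero, hav, hbv] at hr
    have hw' : (E.rot ((E.rot ^ (i + 2)) w0)).fst = v := (E.rot_fst _).trans (hf _)
    have h5 := hlk _ (hf (i + 2)) hw'
    have e : sn (E.rot ((E.rot ^ (i + 2)) w0)) hw' = sn ((E.rot ^ i) w0) (hf i) := Subtype.ext (by unfold sn; simp only [hr])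
    rw [e] at h5
    exact hnl h5
  refine h.finC hc ((genLaman_iff _ _).1 hgl) (fun z b A => rigid_cut hrig) hp hq ho hop z1 z2 hr (by omega) (by omega) ?_
  have e : h.yi (h.dg - 2 + 1) = sn ((E.rot ^ (i + 1)) w0) (hf (i + 1)) := Subtype.ext (by
    change (h.wi (h.dg - 2 + 1)).snd = ((E.rot ^ (i + 1)) w0).snd
    rw [h.wi_succ, hr, hbv, hs])
  rw [e]
  exact hqc

lemma asm (hGrig : GenRigid G) {L : SimpleGraph V} (hLG : L ≤ G) (hLaman : LamanGraph L)
    (hdeg : Nat.card (L.neighborSet v) = 3) (hnotrig : ¬ GenRigid (G.induce Vc)) : Concl E v := by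
  obtain ⟨p, hp⟩ := exists_generic V
  have hp' := generic_sub hp Vc
  obtain ⟨x, y, hxy⟩ : ∃ x y : L.neighborSet v, x ≠ y := by
    have : 1 < Nat.card (L.neighborSet v) := by omega
    haveI := Finite.one_lt_card_iff_nontrivial.1 this
    exact exists_pair_ne _
  have hnr : ¬ InfRigid (G.induce Vc) (fun x : ↥Vc => p x) := by
    intro h
    apply hnotrig
    intro p2 hp2
    rw [← rigOn_univ] at h ⊢
    have hu : ∀ z : L.neighborSet v, (z : V) ∈ Vc := fun z hz => (hLG z.2).ne (Eq.symm hz)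
    exact rig_generic (u := ⟨x, hu x⟩) (w := ⟨y, hu y⟩) (Finset.mem_univ _) (Finset.mem_univ _)
      (gen_ne hp' (u := ⟨x, hu x⟩) (w := ⟨y, hu y⟩) (fun h => hxy (Subtype.ext (congrArg (fun z : ↥Vc => (z : V)) h)))) hp2 h
  unfold InfRigid at hnr
  push Not at hnr
  obtain ⟨q, hq, hnt⟩ := hnr
  by_cases hlk : ∀ (w : G.Dart) (hw : w.fst = v) (hw' : (E.rot w).fst = v), lk (fun x : ↥Vc => p x) q (sn (E.rot w) hw') (sn w hw)
  swap
  · push Not at hlk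
    obtain ⟨w, hw, hw', hnl⟩ := hlk
    exact asm1 hGrig hLG hLaman hdeg hp hq hnt hw hw' hnl
  obtain ⟨o1, o2, hop, hne, hl⟩ := op_ex E hLG hdeg hq hlk
  obtain ⟨m, m1, m2⟩ := lk_triv (p := fun x : ↥Vc => p x) (q := q) (x := o1) (y := o2) (gen_ne hp' hne) hl
  refine asm2 (q := fun x => q x - (m.1 • rot90 (p x) + m.2)) hGrig hLG hLaman hdeg hp ?_ ?_ ?_ hop hne ?_ ?_ (w0 := ⟨(v, x), hLG x.2⟩) rfl
  · intro x y hxy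
    exact (lk_sub (p := fun x : ↥Vc => p x) m x y).2 (hq x y hxy)
  · rintro ⟨α, t, ht⟩
    apply hnt
    refine ⟨α + m.1, t + m.2, fun x => ?_⟩
    have := ht x
    rw [sub_eq_iff_eq_add] at this
    rw [this, add_smul]; abel
  · intro w hw hw'
    exact (lk_sub (p := fun x : ↥Vc => p x) m _ _).2 (hlk w hw hw')
  · simp only [m1]; exact sub_self _
  · simp only [m2]; exact sub_self _
end asm

/-- **Corollary 4.**  Let `G` be a generically rigid plane graph and `v` a vertex of degree
three in a Laman spanning subgraph of `G` such that `G ∖ v` is not generically rigid.  Then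
there is an edge `e = ab` between two neighbors of `v` such that `G' := (G ∖ v) ∪ e` is
generically rigid and every CPT-labelling of `G'` (w.r.t. the induced plane embedding) with
the generalized Laman property extends to a CPT-labelling of `G` with the generalized Laman
property (all common angles, except possibly those at the endpoints of `e`, keep their
labels). -/
theorem degree_three_vertex_cpt_labelling_extension
    {V : Type} [Fintype V] [DecidableEq V] (G : SimpleGraph V)
    (E : PlaneEmb G) (hGrig : GenRigid G) (v : V)
    (L : SimpleGraph V) (hLG : L ≤ G) (hLaman : LamanGraph L)
    (hdeg : Nat.card (L.neighborSet v) = 3)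
    (hnotrig : ¬ GenRigid (G.induce ({v}ᶜ : Set V))) :
    ∃ a b : ↥({v}ᶜ : Set V), G.Adj v (a : V) ∧ G.Adj v (b : V) ∧ a ≠ b ∧
      GenRigid (G.induce ({v}ᶜ : Set V) ⊔ SimpleGraph.fromEdgeSet {s(a, b)}) ∧
      ∀ E'' : PlaneEmb (G.induce ({v}ᶜ : Set V) ⊔ SimpleGraph.fromEdgeSet {s(a, b)}),
        IsInducedPlaneEmbAdd G v a b _ E E'' →
        ∀ big'' : (G.induce ({v}ᶜ : Set V) ⊔ SimpleGraph.fromEdgeSet {s(a, b)}).Dart → Prop,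
          IsCPTLabelling E'' big'' →
          GenLaman (G.induce ({v}ᶜ : Set V) ⊔ SimpleGraph.fromEdgeSet {s(a, b)}) big'' →
          ∃ big : G.Dart → Prop, IsCPTLabelling E big ∧ GenLaman G big ∧
            ExtendsAddLabel G v a b _ E E'' big big'' := by
  exact asm hGrig hLG hLaman hdeg hnotrig
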